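/- Let (G(d^n),T(d^n),Γ(d^n)) be a random tree-rooted graph with degree sequence d^n. Define p_−(k) := ∑_{ℓ≥0} α(k,ℓ) (so that μ1(p_−) = μ1(p) − 2). Set ν = μ2(p_−)/μ1(p_−) − 1 and η = (1/μ1(p_−))·∑_{i,j≥1} ij·α(i,j) when μ1(p) > 2, and ν = η = 0 when μ1(p) = 2. Then, as n → ∞, the conditional probability P(G(d^n) is simple | T(d^n)) converges in probability to exp(−ν/2 − ν²/4 − η), where a multigraph is simple if it has no loops and no multiple edges. -/

import Mathlib

open Classical Filter

namespace TWG

/-- Half-edges for the degree sequence `d`: vertex `i` carries `d i` half-edges,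
encoded as `⟨i, j⟩` for `j : Fin (d i)`; `⟨i, d i - 1⟩` is the root half-edge of `i`. -/
abbrev HE {n : ℕ} (d : Fin n → ℕ) := (i : Fin n) × Fin (d i)

def IsRootHE {n : ℕ} (d : Fin n → ℕ) (h : HE d) : Prop := (h.2 : ℕ) = d h.1 - 1

def IsNonRootHE {n : ℕ} (d : Fin n → ℕ) (h : HE d) : Prop := (h.2 : ℕ) < d h.1 - 1

/-- A candidate execution path: at each of the `n-1` steps, a pair
(root half-edge `r_k`, non-root half-edge `s_k`) is chosen. -/
abbrev Path {n : ℕ} (d : Fin n → ℕ) := Fin (n - 1) → HE d × HE d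

/-- Vertices `a` and `b` lie in the same tree of the forest present at the start of
step `k`, i.e. they are joined by the edges created at steps `j < k`. -/
def SameTree {n : ℕ} {d : Fin n → ℕ} (E : Path d) (k : Fin (n - 1)) (a b : Fin n) : Prop :=
  Relation.ReflTransGen
    (fun x y => ∃ j, j < k ∧
      (((E j).1.1 = x ∧ (E j).2.1 = y) ∨ ((E j).1.1 = y ∧ (E j).2.1 = x))) a b

/-- `E` is a valid execution path of Pitman's additive coalescent for `d`:
at each step, `r_k` is an as-yet-unpaired root half-edge, `s_k` is an
as-yet-unpaired non-root half-edge, and they lie in different trees of the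
current forest. -/
def IsExecPath {n : ℕ} (d : Fin n → ℕ) (E : Path d) : Prop :=
  ∀ k : Fin (n - 1),
    IsRootHE d (E k).1 ∧ IsNonRootHE d (E k).2 ∧
    (∀ j, j < k → (E j).1 ≠ (E k).1) ∧
    (∀ j, j < k → (E j).2 ≠ (E k).2) ∧
    ¬ SameTree E k (E k).1.1 (E k).2.1

/-- The number of children of vertex `i` in the tree `T(d)` built by `E`. -/
noncomputable def cc {n : ℕ} {d : Fin n → ℕ} (E : Path d) (i : Fin n) : ℕ :=
  Nat.card {k : Fin (n - 1) // (E k).2.1 = i}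

/-- `v` is a non-root vertex of the tree built by `E`. -/
def IsNonRootV {n : ℕ} {d : Fin n → ℕ} (E : Path d) (v : Fin n) : Prop :=
  ∃ k, (E k).1.1 = v

/-- The parent of `v` in the tree built by `E` (equal to `v` itself for the root). -/
noncomputable def parentOf {n : ℕ} {d : Fin n → ℕ} (E : Path d) (v : Fin n) : Fin n :=
  if h : ∃ k, (E k).1.1 = v then (E h.choose).2.1 else v

/-- The tree built by `E` is the rooted tree with root `root` and parent map `par`. -/
def TreeEq {n : ℕ} {d : Fin n → ℕ} (E : Path d) (root : Fin n) (par : Fin n → Fin n) : Prop :=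
  (∀ k, par (E k).1.1 = (E k).2.1) ∧ ∀ v, v ≠ root → ∃ k, (E k).1.1 = v

/-- `(root, par)` encodes a rooted tree on `Fin n`: the root is a fixed point of the
parent map and every vertex reaches the root by iterating the parent map. -/
def IsRootedTree {n : ℕ} (root : Fin n) (par : Fin n → Fin n) : Prop :=
  par root = root ∧ ∀ v, ∃ m, par^[m] v = root

/-- The number of children of `i` in the rooted tree `(root, par)`. -/
noncomputable def childCount {n : ℕ} (root : Fin n) (par : Fin n → Fin n) (i : Fin n) : ℕ :=
  Nat.card {v : Fin n // v ≠ root ∧ par v = i}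

/-- `h` is one of the half-edges paired during the execution path `E`. -/
def UsedIn {n : ℕ} {d : Fin n → ℕ} (E : Path d) (h : HE d) : Prop :=
  (∃ k, (E k).1 = h) ∨ (∃ k, (E k).2 = h)

/-- `M` pairs up, as a fixed-point-free involution, exactly the half-edges left
unpaired by `E` (its fixed points are exactly the half-edges used by `E`). -/
def IsCompletion {n : ℕ} {d : Fin n → ℕ} (E : Path d) (M : HE d → HE d) : Prop :=
  Function.Involutive M ∧ ∀ h, (M h = h ↔ UsedIn E h)

/-- The number of half-edges at `u`, unpaired by `E`, which `M` matches to a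
half-edge at `v`.  For `u ≠ v` this is the number of `M`-edges joining `u` and `v`;
for `u = v` it is twice the number of `M`-loops at `u`. -/
noncomputable def matchCount {n : ℕ} {d : Fin n → ℕ} (E : Path d) (M : HE d → HE d)
    (u v : Fin n) : ℕ :=
  Nat.card {h : HE d // ¬ UsedIn E h ∧ h.1 = u ∧ (M h).1 = v}

/-- `P(Bin(m, ρ) = a)`. -/
noncomputable def binomP (ρ : ℝ) (m a : ℕ) : ℝ :=
  (m.choose a : ℝ) * ρ ^ a * (1 - ρ) ^ (m - a)


/-- `μ₁(p) = ∑ k, k⋅p(k)`. -/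
noncomputable def mu1 (p : ℕ → ℝ) : ℝ := ∑' k : ℕ, (k : ℝ) * p k

/-- `ρ = 1/(μ₁(p) - 1)`. -/
noncomputable def rho (p : ℕ → ℝ) : ℝ := 1 / (mu1 p - 1)

/-- `α(k,ℓ) = ∑_{a₁,a₂ ≥ 0} a₂ p(ℓ+a₂+1) P(Bin(ℓ+a₂,ρ)=a₂) ⋅ p(k+a₁+1) P(Bin(k+a₁,ρ)=a₁)`. -/
noncomputable def alphaF (p : ℕ → ℝ) (k l : ℕ) : ℝ :=
  ∑' a : ℕ × ℕ, (a.2 : ℝ) * p (l + a.2 + 1) * binomP (rho p) (l + a.2) a.2 *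
    (p (k + a.1 + 1) * binomP (rho p) (k + a.1) a.1)

/-- `p₋(k) = ∑_ℓ α(k,ℓ)`. -/
noncomputable def pMinus (p : ℕ → ℝ) (k : ℕ) : ℝ := ∑' l : ℕ, alphaF p k l

/-- `ν`: equal to `μ₂(p₋)/μ₁(p₋) − 1` when `μ₁(p) > 2`, and `0` when `μ₁(p) = 2`. -/
noncomputable def nuConst (p : ℕ → ℝ) : ℝ :=
  if 2 < mu1 p then
    (∑' k : ℕ, (k : ℝ) ^ 2 * pMinus p k) / (∑' k : ℕ, (k : ℝ) * pMinus p k) - 1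
  else 0

/-- `η`: equal to `(1/μ₁(p₋)) ∑_{i,j} ij α(i,j)` when `μ₁(p) > 2`, and `0` when
`μ₁(p) = 2`. -/
noncomputable def etaConst (p : ℕ → ℝ) : ℝ :=
  if 2 < mu1 p then
    (∑' kl : ℕ × ℕ, (kl.1 : ℝ) * kl.2 * alphaF p kl.1 kl.2)
      / (∑' k : ℕ, (k : ℝ) * pMinus p k)
  else 0

/-- The trees built by the execution paths `E` and `E₀` coincide. -/
def SameTreeAs {n : ℕ} {d : Fin n → ℕ} (E E₀ : Path d) : Prop :=
  (∀ v, parentOf E v = parentOf E₀ v) ∧ ∀ v, (IsNonRootV E v ↔ IsNonRootV E₀ v)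

/-- `u` and `v` are joined by an edge of the tree built by `E`. -/
def TreeAdj {n : ℕ} {d : Fin n → ℕ} (E : Path d) (u v : Fin n) : Prop :=
  (IsNonRootV E u ∧ parentOf E u = v) ∨ (IsNonRootV E v ∧ parentOf E v = u)

/-- The multigraph `G(d)` produced by the pair `(E, M)` is simple: no loops, and every
pair of distinct vertices is joined by at most one edge (tree edges included). -/
noncomputable def SimpleG {n : ℕ} {d : Fin n → ℕ} (E : Path d) (M : HE d → HE d) : Prop :=
  (∀ u, matchCount E M u u = 0) ∧
  ∀ u v, u ≠ v →
    (if TreeAdj E u v then 1 else 0) + matchCount E M u v ≤ 1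

/-- `P(G(d) is simple | T(d))`, evaluated at the tree built by the execution path
`E₀`: the conditional probability, under the uniform law on pairs (execution path,
completing matching), that the resulting multigraph is simple given that the tree
coincides with that of `E₀`. -/
noncomputable def condSimpleProb {n : ℕ} {d : Fin n → ℕ} (E₀ : Path d) : ℝ :=
  (Nat.card {x : Path d × (HE d → HE d) //
      (IsExecPath d x.1 ∧ IsCompletion x.1 x.2) ∧ SameTreeAs x.1 E₀ ∧
      SimpleG x.1 x.2} : ℝ)
    / (Nat.card {x : Path d × (HE d → HE d) //
        (IsExecPath d x.1 ∧ IsCompletion x.1 x.2) ∧ SameTreeAs x.1 E₀} : ℝ)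

set_option linter.unusedSectionVars false

/-! ### Part 1: counting acyclic assignments -/

def VOn {ι V : Type*} (w : ι → V) (J : Finset ι) (R : ι → V) : Prop :=
  Set.InjOn R J ∧ ∃ h : V → ℕ, ∀ k ∈ J, h (w k) < h (R k)

def Anc {ι V : Type*} (w : ι → V) (J : Finset ι) (R : ι → V) : V → V → Prop :=
  Relation.ReflTransGen (fun x y => ∃ k ∈ J, R k = x ∧ w k = y)

lemma VOn.mono {ι V : Type*} {w : ι → V} {J K : Finset ι} {R : ι → V}
    (hJ : J ⊆ K) (h : VOn w K R) : VOn w J R :=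
  ⟨h.1.mono (by exact_mod_cast hJ), h.2.imp fun _ hh k hk => hh k (hJ hk)⟩

lemma VOn.congr {ι V : Type*} {w : ι → V} {J : Finset ι} {R R' : ι → V}
    (hR : ∀ k ∈ J, R k = R' k) (h : VOn w J R) : VOn w J R' := by
  refine ⟨h.1.congr fun k hk => hR k hk, ?_⟩
  obtain ⟨hh, H⟩ := h.2
  exact ⟨hh, fun k hk => by rw [← hR k hk]; exact H k hk⟩

lemma Anc.le {ι V : Type*} {w : ι → V} {J : Finset ι} {R : ι → V} {h : V → ℕ}
    (H : ∀ k ∈ J, h (w k) < h (R k)) {a b : V} (hab : Anc w J R a b) : h b ≤ h a := by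
  induction hab with
  | refl => exact le_rfl
  | tail _ hs ih =>
    obtain ⟨k, hk, rfl, rfl⟩ := hs
    exact (H k hk).le.trans ih

lemma Anc.step {ι V : Type*} {w : ι → V} {J : Finset ι} {R : ι → V} (hinj : Set.InjOn R J)
    {j : ι} (hj : j ∈ J) {u : V} (hne : R j ≠ u) (h : Anc w J R (R j) u) : Anc w J R (w j) u := by
  rcases Relation.ReflTransGen.cases_head h with h | ⟨c, ⟨k, hk, hkR, hkw⟩, hc⟩
  · exact absurd h hne
  · have : k = j := hinj hk hj hkR
    subst this; rw [hkw]; exact hc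

lemma Anc.exists_root {ι V : Type*} {w : ι → V} {J : Finset ι} {R : ι → V}
    (hv : VOn w J R) (a : V) : ∃ z, Anc w J R a z ∧ ∀ k ∈ J, R k ≠ z := by
  obtain ⟨h, H⟩ := hv.2
  induction hn : h a using Nat.strong_induction_on generalizing a with
  | _ m ih =>
    by_cases hr : ∀ k ∈ J, R k ≠ a
    · exact ⟨a, Relation.ReflTransGen.refl, hr⟩
    · push Not at hr
      obtain ⟨k, hk, hka⟩ := hr
      have h1 := H k hk
      rw [hka, hn] at h1
      obtain ⟨z, hz, hz'⟩ := ih _ h1 (w k) rfl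
      exact ⟨z, Relation.ReflTransGen.head ⟨k, hk, hka, rfl⟩ hz, hz'⟩

lemma Anc.root_unique {ι V : Type*} {w : ι → V} {J : Finset ι} {R : ι → V}
    (hinj : Set.InjOn R J) {a z z' : V} (h : Anc w J R a z) (h' : Anc w J R a z')
    (hz : ∀ k ∈ J, R k ≠ z) (hz' : ∀ k ∈ J, R k ≠ z') : z = z' := by
  have key : ∀ z z', Anc w J R z z' → (∀ k ∈ J, R k ≠ z) → z = z' := by
    intro z z' h hz
    rcases Relation.ReflTransGen.cases_head h with h | ⟨c, ⟨k, hk, hkR, hkw⟩, hc⟩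
    · exact h
    · exact absurd hkR (hz k hk)
  have ru : Relator.RightUnique (fun x y => ∃ k ∈ J, R k = x ∧ w k = y) := by
    rintro x y y' ⟨k, hk, hkx, hky⟩ ⟨k', hk', hkx', hky'⟩
    have : k = k' := hinj hk hk' (hkx.trans hkx'.symm)
    subst this; exact hky.symm.trans hky'
  rcases Relation.ReflTransGen.total_of_right_unique ru h h' with H | H
  · exact key _ _ H hz
  · exact (key _ _ H hz').symm

/-- adding an edge from a root `u` to a vertex not below `u` keeps acyclicity. -/
lemma VOn.insert {ι V : Type*} [DecidableEq ι] {w : ι → V} {J : Finset ι} {R : ι → V} {k : ι}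
    (hv : VOn w J R) (hu : ∀ j ∈ J, R j ≠ R k) (hna : ¬ Anc w J R (w k) (R k)) :
    VOn w (insert k J) R := by
  obtain ⟨h, H⟩ := hv.2
  constructor
  · intro a ha b hb hab
    simp only [Finset.coe_insert, Set.mem_insert_iff, Finset.mem_coe] at ha hb
    rcases ha with rfl | ha <;> rcases hb with rfl | hb
    · rfl
    · exact absurd hab.symm (hu b hb)
    · exact absurd hab (hu a ha)
    · exact hv.1 ha hb hab
  · refine ⟨fun x => h x + (if Anc w J R x (R k) then h (w k) + 1 else 0), ?_⟩
    intro j hj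
    rcases Finset.mem_insert.1 hj with rfl | hj
    · have : Anc w J R (R j) (R j) := Relation.ReflTransGen.refl
      simp only [if_pos this, if_neg hna]; omega
    · have h1 := H j hj
      have h2 : Anc w J R (R j) (R k) ↔ Anc w J R (w j) (R k) :=
        ⟨Anc.step hv.1 hj (hu j hj), fun h => Relation.ReflTransGen.head ⟨j, hj, rfl, rfl⟩ h⟩
      by_cases h3 : Anc w J R (w j) (R k)
      · simp only [if_pos h3, if_pos (h2.2 h3)]; omega
      · simp only [if_neg h3, if_neg (fun h => h3 (h2.1 h))]; omega

lemma Anc.congr {ι V : Type*} {w : ι → V} {J : Finset ι} {R R' : ι → V}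
    (hR : ∀ k ∈ J, R k = R' k) {a b} : Anc w J R a b ↔ Anc w J R' a b := by
  have : (fun x y => ∃ k ∈ J, R k = x ∧ w k = y) = (fun x y => ∃ k ∈ J, R' k = x ∧ w k = y) := by
    funext x y
    apply propext
    constructor
    · rintro ⟨k, hk, h1, h2⟩; exact ⟨k, hk, by rw [← hR k hk]; exact h1, h2⟩
    · rintro ⟨k, hk, h1, h2⟩; exact ⟨k, hk, by rw [hR k hk]; exact h1, h2⟩
  unfold Anc; rw [this]

lemma card_ext {ι V : Type*} [DecidableEq ι] [Fintype V] {w : ι → V} {J : Finset ι} {R : ι → V}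
    {k : ι} (hk : k ∉ J) (hv : VOn w J R) :
    (Finset.univ.filter (fun u => VOn w (insert k J) (Function.update R k u))).card
      = Fintype.card V - 1 - J.card := by
  obtain ⟨z, hz, hzr⟩ := Anc.exists_root hv (w k)
  have e : ∀ u, ∀ j ∈ J, R j = Function.update R k u j := fun u j hj => by
    rw [Function.update_of_ne]; rintro rfl; exact hk hj
  have key : Finset.univ.filter (fun u => VOn w (insert k J) (Function.update R k u))
      = Finset.univ \ (insert z (J.image R)) := by
    ext u
    simp only [Finset.mem_filter, Finset.mem_univ, true_and, Finset.mem_sdiff, Finset.mem_insert,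
      Finset.mem_image, not_or, not_exists, not_and]
    constructor
    · rintro ⟨h1, h, H⟩
      constructor
      · rintro rfl
        have h2 := H k (Finset.mem_insert_self _ _)
        rw [Function.update_self] at h2
        have h3 : Anc w J (Function.update R k u) (w k) u := (Anc.congr (e u)).1 hz
        have := Anc.le (h := h) (fun j hj => H j (Finset.mem_insert_of_mem hj)) h3
        omega
      · intro j hj hju
        have := h1 (x₁ := j) (x₂ := k) (by simp [hj]) (by simp) (by
          rw [← e u j hj, Function.update_self, hju])
        subst this; exact hk hj
    · rintro ⟨h1, h2⟩
      apply VOn.insert (hv.congr (e u))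
      · intro j hj; rw [← e u j hj, Function.update_self]; exact h2 j hj
      · rw [Function.update_self, ← Anc.congr (e u)]
        intro h3
        exact h1 (Anc.root_unique hv.1 h3 hz h2 hzr)
  rw [key, Finset.card_sdiff_of_subset (Finset.subset_univ _), Finset.card_univ,
    Finset.card_insert_of_notMem, Finset.card_image_of_injOn hv.1]
  · omega
  · simp only [Finset.mem_image, not_exists, not_and]; exact hzr

/-- number of valid completions of a valid partial assignment. -/
lemma card_completions {ι V : Type*} [DecidableEq ι] [Fintype ι] [Fintype V]
    (hc : Fintype.card V = Fintype.card ι + 1) {w : ι → V} {J : Finset ι} {R₀ : ι → V}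
    (hv : VOn w J R₀) :
    (Finset.univ.filter (fun R : ι → V => VOn w Finset.univ R ∧ ∀ k ∈ J, R k = R₀ k)).card
      = (Fintype.card ι - J.card).factorial := by
  induction hm : Fintype.card ι - J.card generalizing J R₀ with
  | zero =>
    have hJ : J = Finset.univ := by
      apply Finset.eq_univ_of_card
      have := Finset.card_le_univ J
      omega
    subst hJ
    rw [Nat.factorial_zero, Finset.card_eq_one]
    refine ⟨R₀, ?_⟩
    ext R
    simp only [Finset.mem_filter, Finset.mem_univ, true_and, Finset.mem_singleton, forall_const]
    constructor
    · rintro ⟨_, h⟩; exact funext h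
    · rintro rfl; exact ⟨hv, fun _ => rfl⟩
  | succ m ih =>
    have hJ : ∃ k, k ∉ J := by
      by_contra hcon
      push Not at hcon
      have : J = Finset.univ := Finset.eq_univ_iff_forall.2 hcon
      subst this
      simp at hm
    obtain ⟨k, hk⟩ := hJ
    have hcard : (insert k J).card = J.card + 1 := Finset.card_insert_of_notMem hk
    rw [Finset.card_eq_sum_card_fiberwise (f := fun R => R k) (t := Finset.univ)
      (fun _ _ => Finset.mem_coe.2 (Finset.mem_univ _))]
    have : ∀ u : V, (Finset.filter (fun R : ι → V => R k = u)
        (Finset.univ.filter (fun R : ι → V => VOn w Finset.univ R ∧ ∀ k ∈ J, R k = R₀ k))).card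
        = if VOn w (insert k J) (Function.update R₀ k u) then m.factorial else 0 := by
      intro u
      have e : (Finset.filter (fun R : ι → V => R k = u)
          (Finset.univ.filter (fun R : ι → V => VOn w Finset.univ R ∧ ∀ k ∈ J, R k = R₀ k)))
          = (Finset.univ.filter (fun R : ι → V => VOn w Finset.univ R ∧
            ∀ j ∈ insert k J, R j = Function.update R₀ k u j)) := by
        ext R
        simp only [Finset.mem_filter, Finset.mem_univ, true_and, Finset.mem_insert,
          forall_eq_or_imp, Function.update_self]
        constructor
        · rintro ⟨⟨h1, h2⟩, h3⟩
          refine ⟨h1, h3, fun j hj => ?_⟩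
          rw [Function.update_of_ne (by rintro rfl; exact hk hj)]; exact h2 j hj
        · rintro ⟨h1, h3, h2⟩
          refine ⟨⟨h1, fun j hj => ?_⟩, h3⟩
          have := h2 j hj
          rwa [Function.update_of_ne (by rintro rfl; exact hk hj)] at this
      rw [e]
      split_ifs with hV
      · exact ih hV (by omega)
      · rw [Finset.card_eq_zero, Finset.filter_eq_empty_iff]
        rintro R - ⟨h1, h2⟩
        exact hV ((h1.mono (Finset.subset_univ _)).congr h2)
    rw [Finset.sum_congr rfl (fun u _ => this u), ← Finset.sum_filter, Finset.sum_const,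
      card_ext hk hv, smul_eq_mul, Nat.factorial_succ, hc]
    congr 1

/-! ### Part 2: moments over acyclic assignments -/

section RM
variable {ι V : Type*} [DecidableEq ι] [Fintype ι] [DecidableEq V] [Fintype V]

noncomputable def RV (w : ι → V) : Finset (ι → V) :=
  Finset.univ.filter (fun R => VOn w Finset.univ R)

lemma card_RV (hc : Fintype.card V = Fintype.card ι + 1) (w : ι → V) :
    (RV w).card = (Fintype.card ι).factorial := by
  have : Nonempty V := Fintype.card_pos_iff.1 (by omega)
  have h0 : VOn w ∅ (fun _ => Classical.arbitrary V) := by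
    refine ⟨by simp, fun _ => 0, by simp⟩
  have := card_completions hc h0
  simpa [RV] using this

lemma RV_inj {w : ι → V} {R : ι → V} (hR : R ∈ RV w) : Function.Injective R := by
  have := (Finset.mem_filter.1 hR).2.1
  simpa using this

lemma card_RV1 (hc : Fintype.card V = Fintype.card ι + 1) (w : ι → V) (k : ι) (u : V) :
    ((RV w).filter (fun R => R k = u)).card
      = if u = w k then 0 else (Fintype.card ι - 1).factorial := by
  split_ifs with h
  · rw [Finset.card_eq_zero, Finset.filter_eq_empty_iff]
    intro R hR hk
    obtain ⟨hh, H⟩ := (Finset.mem_filter.1 hR).2.2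
    have := H k (Finset.mem_univ _)
    rw [hk, h] at this; exact lt_irrefl _ this
  · have h0 : VOn w {k} (fun _ => u) := by
      refine ⟨by simp, fun x => if x = u then 1 else 0, ?_⟩
      intro j hj
      rw [Finset.mem_singleton] at hj
      subst hj
      simp [Ne.symm h]
    have := card_completions hc h0
    rw [Finset.card_singleton] at this
    rw [← this, RV, Finset.filter_filter]
    congr 1
    ext R; simp

lemma card_RV2_eq (hc : Fintype.card V = Fintype.card ι + 1) (w : ι → V) {j k : ι} (hjk : j ≠ k)
    {u v : V} (h0 : VOn w {j, k} (fun i => if i = j then u else v)) :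
    ((RV w).filter (fun R => R j = u ∧ R k = v)).card = (Fintype.card ι - 2).factorial := by
  have := card_completions hc h0
  rw [Finset.card_pair hjk] at this
  rw [← this, RV, Finset.filter_filter]
  congr 1
  ext R
  simp [hjk.symm]

lemma card_RV2_le (hc : Fintype.card V = Fintype.card ι + 1) (w : ι → V) {j k : ι} (hjk : j ≠ k)
    (u v : V) :
    ((RV w).filter (fun R => R j = u ∧ R k = v)).card ≤ (Fintype.card ι - 2).factorial := by
  by_cases h0 : VOn w {j, k} (fun i => if i = j then u else v)
  · exact (card_RV2_eq hc w hjk h0).le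
  · have : ((RV w).filter (fun R => R j = u ∧ R k = v)) = ∅ := by
      rw [Finset.filter_eq_empty_iff]
      rintro R hR ⟨h1, h2⟩
      apply h0
      refine ((Finset.mem_filter.1 hR).2.mono (Finset.subset_univ _)).congr ?_
      intro i hi
      simp only [Finset.mem_insert, Finset.mem_singleton] at hi
      rcases hi with rfl | rfl
      · simp [h1]
      · simp [hjk.symm, h2]
    rw [this]; simp

lemma sum_RV_apply (w : ι → V) (k : ι) (g : V → ℝ) :
    ∑ R ∈ RV w, g (R k) = ∑ u, g u * (((RV w).filter (fun R => R k = u)).card : ℝ) := by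
  have := Finset.sum_fiberwise (RV w) (fun R => R k) (fun R => g (R k))
  rw [← this]
  refine Finset.sum_congr rfl fun u _ => ?_
  rw [Finset.sum_congr rfl (g := fun _ => g u), Finset.sum_const, nsmul_eq_mul, mul_comm]
  intro R hR
  rw [(Finset.mem_filter.1 hR).2]

lemma sum_RV1 (hc : Fintype.card V = Fintype.card ι + 1) (w : ι → V) (k : ι) (g : V → ℝ) :
    ∑ R ∈ RV w, g (R k) = ((Fintype.card ι - 1).factorial : ℝ) * ((∑ u, g u) - g (w k)) := by
  rw [sum_RV_apply]
  simp_rw [card_RV1 hc]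
  have : ∀ u, g u * ((if u = w k then 0 else (Fintype.card ι - 1).factorial : ℕ) : ℝ)
      = ((Fintype.card ι - 1).factorial : ℝ) * (g u - if u = w k then g u else 0) := by
    intro u; split_ifs <;> simp [mul_comm]
  simp_rw [this]
  rw [← Finset.mul_sum, Finset.sum_sub_distrib]
  simp

lemma sum_RV2_le (hc : Fintype.card V = Fintype.card ι + 1) (w : ι → V) {j k : ι} (hjk : j ≠ k)
    (g : V → ℝ) (hg : ∀ v, 0 ≤ g v) :
    ∑ R ∈ RV w, g (R j) * g (R k) ≤ ((Fintype.card ι - 2).factorial : ℝ) * (∑ u, g u) ^ 2 := by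
  have := Finset.sum_fiberwise (RV w) (fun R => (R j, R k)) (fun R => g (R j) * g (R k))
  rw [← this, sq, Finset.sum_mul_sum, ← Finset.sum_product', Finset.mul_sum]
  refine Finset.sum_le_sum fun p _ => ?_
  rw [Finset.sum_congr rfl (g := fun _ => g p.1 * g p.2), Finset.sum_const, nsmul_eq_mul]
  · refine mul_le_mul_of_nonneg_right ?_ (mul_nonneg (hg _) (hg _))
    have h2 := card_RV2_le hc w hjk p.1 p.2
    have h3 : Finset.filter (fun R : ι → V => (R j, R k) = p) (RV w)
      = (RV w).filter (fun R => R j = p.1 ∧ R k = p.2) := by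
      ext R; simp [Prod.ext_iff]
    rw [h3]; exact_mod_cast h2
  · intro R hR
    rw [← (Finset.mem_filter.1 hR).2]

/-- second moment of `∑ k, f (R k) f (w k)`. -/
lemma RV_var (hc : Fintype.card V = Fintype.card ι + 1) (hm : 2 ≤ Fintype.card ι) (w : ι → V)
    (f : V → ℝ) (hf : ∀ v, 0 ≤ f v) (m C F Q G : ℝ) (hmm : m = Fintype.card ι)
    (hC : C = ∑ k, f (w k)) (hF : F = ∑ v, f v) (hQ : Q = ∑ k, f (w k) ^ 2)
    (hG : G = ∑ v, f v ^ 2) :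
    ∑ R ∈ RV w, ((∑ k, f (R k) * f (w k)) - C * F / m) ^ 2
      ≤ ((Fintype.card ι).factorial : ℝ) *
        (C ^ 2 * F ^ 2 / (m ^ 2 * (m - 1)) + Q * G / m + 2 * C * F * Q / m ^ 2) := by
  obtain ⟨l, hl⟩ : ∃ l, Fintype.card ι = l + 2 := ⟨_, (Nat.sub_add_cancel hm).symm⟩
  have hml : m = (l : ℝ) + 2 := by rw [hmm, hl]; push_cast; ring
  set L : ℝ := (l.factorial : ℝ) with hL
  have e1 : ((Fintype.card ι - 1).factorial : ℝ) = (l + 1) * L := by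
    rw [hl]; simp [Nat.factorial_succ, hL]
  have e0 : ((Fintype.card ι).factorial : ℝ) = (l + 2) * ((l + 1) * L) := by
    rw [hl]; simp [Nat.factorial_succ]; ring
  have e2 : ((Fintype.card ι - 2).factorial : ℝ) = L := by
    rw [hl]; simp [hL]
  have hLpos : 0 < L := by positivity
  have first : ∑ R ∈ RV w, (∑ k, f (R k) * f (w k)) = (l + 1) * L * (C * F - Q) := by
    rw [Finset.sum_comm]
    simp_rw [← Finset.sum_mul]
    simp_rw [sum_RV1 hc, e1]
    rw [hC, hQ, ← hF, Finset.sum_mul, ← Finset.sum_sub_distrib, Finset.mul_sum]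
    refine Finset.sum_congr rfl fun k _ => ?_
    ring
  have second : ∑ R ∈ RV w, (∑ k, f (R k) * f (w k)) ^ 2
      ≤ L * (C ^ 2 * F ^ 2) + (l + 1) * L * (Q * G) := by
    have h1 : ∀ j k, ∑ R ∈ RV w, (f (R j) * f (w j)) * (f (R k) * f (w k))
        ≤ f (w j) * f (w k) * (L * F ^ 2)
          + if j = k then (l + 1) * L * G * f (w j) ^ 2 else 0 := by
      intro j k
      have h2 : ∑ R ∈ RV w, (f (R j) * f (w j)) * (f (R k) * f (w k))
          = f (w j) * f (w k) * ∑ R ∈ RV w, f (R j) * f (R k) := by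
        rw [Finset.mul_sum]; exact Finset.sum_congr rfl fun R _ => by ring
      rw [h2]
      split_ifs with hjk
      · subst hjk
        have h3 := sum_RV1 hc w j (fun v => f v ^ 2)
        rw [e1, ← hG] at h3
        have h4 : ∑ R ∈ RV w, f (R j) * f (R j) ≤ (l + 1) * L * G := by
          simp_rw [← sq]
          rw [h3]
          have : 0 ≤ (l + 1) * L * f (w j) ^ 2 := by positivity
          nlinarith
        have h5 : 0 ≤ f (w j) * f (w j) * (L * F ^ 2) := by
          have := hf (w j); positivity
        have := mul_le_mul_of_nonneg_left h4 (mul_nonneg (hf (w j)) (hf (w j)))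
        nlinarith
      · rw [add_zero]
        refine mul_le_mul_of_nonneg_left ?_ (mul_nonneg (hf _) (hf _))
        have := sum_RV2_le hc w hjk f hf
        rwa [e2, ← hF] at this
    calc ∑ R ∈ RV w, (∑ k, f (R k) * f (w k)) ^ 2
        = ∑ j, ∑ k, ∑ R ∈ RV w, (f (R j) * f (w j)) * (f (R k) * f (w k)) := by
          simp_rw [sq, Finset.sum_mul_sum]
          rw [Finset.sum_comm]
          refine Finset.sum_congr rfl fun j _ => ?_
          rw [Finset.sum_comm]
      _ ≤ ∑ j, ∑ k, (f (w j) * f (w k) * (L * F ^ 2)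
          + if j = k then (l + 1) * L * G * f (w j) ^ 2 else 0) :=
          Finset.sum_le_sum fun j _ => Finset.sum_le_sum fun k _ => h1 j k
      _ = _ := by
          simp_rw [Finset.sum_add_distrib]
          simp only [Finset.sum_ite_eq, Finset.mem_univ, if_true]
          simp_rw [← Finset.sum_mul, ← Finset.mul_sum]
          rw [← Finset.sum_mul, ← hC, ← hQ]
          ring
  have hmp : 0 < m := by rw [hml]; positivity
  have expand : ∑ R ∈ RV w, ((∑ k, f (R k) * f (w k)) - C * F / m) ^ 2
      = ∑ R ∈ RV w, (∑ k, f (R k) * f (w k)) ^ 2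
        - 2 * (C * F / m) * ∑ R ∈ RV w, (∑ k, f (R k) * f (w k))
        + ((l : ℝ) + 2) * ((l + 1) * L) * (C * F / m) ^ 2 := by
    simp_rw [sub_sq]
    rw [Finset.sum_add_distrib, Finset.sum_sub_distrib, Finset.sum_const, card_RV hc,
      nsmul_eq_mul, e0, Finset.mul_sum]
    congr 2
    refine Finset.sum_congr rfl fun R _ => by ring
  rw [expand, first, e0]
  refine (add_le_add_left (sub_le_sub_right second _) _).trans (le_of_eq ?_)
  rw [hml]
  have : (l : ℝ) + 2 ≠ 0 := by positivity
  have : (l : ℝ) + 2 - 1 ≠ 0 := by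
    have : (0 : ℝ) ≤ l := by positivity
    linarith
  field_simp
  ring

lemma card_root (hc : Fintype.card V = Fintype.card ι + 1) (h5 : 0 < Fintype.card ι) (w : ι → V) (v : V) :
    ((RV w).filter (fun R => ∀ k, R k ≠ v)).card
      = (Fintype.card ι - 1).factorial * (Finset.univ.filter (fun k => w k = v)).card := by
  have h1 := Finset.card_filter_add_card_filter_not (s := RV w) (fun R => ∀ k, R k ≠ v)
  have h2 : (RV w).filter (fun R => ¬ ∀ k, R k ≠ v)
      = Finset.univ.biUnion (fun k => (RV w).filter (fun R => R k = v)) := by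
    ext R; simp
  rw [h2, Finset.card_biUnion, card_RV hc] at h1
  · simp_rw [card_RV1 hc] at h1
    have h3 : ∑ k : ι, (if v = w k then 0 else (Fintype.card ι - 1).factorial)
        = (Fintype.card ι - 1).factorial * (Finset.univ.filter (fun k => ¬ w k = v)).card := by
      rw [mul_comm, ← smul_eq_mul, ← Finset.sum_const, Finset.sum_filter]
      refine Finset.sum_congr rfl fun k _ => ?_
      by_cases h : w k = v
      · simp [h]
      · simp [h, Ne.symm h]
    rw [h3] at h1
    have h4 := Finset.card_filter_add_card_filter_not (s := (Finset.univ : Finset ι))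
      (fun k => w k = v)
    rw [Finset.card_univ] at h4
    rw [← Nat.mul_factorial_pred h5.ne', ← h4] at h1
    rw [h4] at h1
    nlinarith
  · intro i _ j _ hij
    rw [Function.onFun, Finset.disjoint_left]
    intro R hR hR'
    rw [Finset.mem_filter] at hR hR'
    exact hij (RV_inj hR.1 (hR.2.trans hR'.2.symm))

/-- expectation of `f` at the root. -/
lemma RV_root (hc : Fintype.card V = Fintype.card ι + 1) (h5 : 0 < Fintype.card ι) (w : ι → V)
    (f : V → ℝ) :
    ∑ R ∈ RV w, ∑ v, (if ∀ k, R k ≠ v then f v else 0)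
      = ((Fintype.card ι - 1).factorial : ℝ) * ∑ k, f (w k) := by
  rw [Finset.sum_comm]
  have h1 : ∀ v, ∑ R ∈ RV w, (if ∀ k, R k ≠ v then f v else 0)
      = ((Fintype.card ι - 1).factorial : ℝ) * ∑ k, (if w k = v then f v else 0) := by
    intro v
    rw [← Finset.sum_filter, Finset.sum_const, card_root hc h5, ← Finset.sum_filter,
      Finset.sum_const]
    simp only [nsmul_eq_mul]; push_cast; ring
  simp_rw [h1]
  rw [← Finset.mul_sum, Finset.sum_comm]
  simp

lemma card_root2 (hc : Fintype.card V = Fintype.card ι + 1) (h5 : 2 ≤ Fintype.card ι) (w : ι → V)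
    (k : ι) (u : V) :
    ((RV w).filter (fun R => R k = u ∧ ∀ j, R j ≠ w k)).card
      ≤ (Fintype.card ι - 2).factorial * ((Finset.univ.filter (fun j => w j = w k)).card
          + (Finset.univ.filter (fun j => w j = u)).card) := by
  by_cases huv : u = w k
  · have : ((RV w).filter (fun R => R k = u ∧ ∀ j, R j ≠ w k)) = ∅ := by
      rw [Finset.filter_eq_empty_iff]
      rintro R hR ⟨h1, h2⟩
      exact h2 k (h1.trans huv)
    rw [this]; simp
  have h1 := Finset.card_filter_add_card_filter_not (s := (RV w).filter (fun R => R k = u))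
    (fun R => ∀ j, R j ≠ w k)
  rw [Finset.filter_filter, card_RV1 hc, if_neg huv] at h1
  set T := Finset.univ.filter (fun j => j ≠ k ∧ w j ≠ w k ∧ w j ≠ u) with hT
  have h2 : T.card * (Fintype.card ι - 2).factorial
      ≤ (((RV w).filter (fun R => R k = u)).filter (fun R => ¬ ∀ j, R j ≠ w k)).card := by
    have h3 : T.biUnion (fun j => (RV w).filter (fun R => R k = u ∧ R j = w k)) ⊆
        (((RV w).filter (fun R => R k = u)).filter (fun R => ¬ ∀ j, R j ≠ w k)) := by
      intro R hR
      simp only [Finset.mem_biUnion, Finset.mem_filter] at hR ⊢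
      obtain ⟨j, hj, hR1, hR2, hR3⟩ := hR
      exact ⟨⟨hR1, hR2⟩, fun h => h j hR3⟩
    refine le_trans ?_ (Finset.card_le_card h3)
    rw [Finset.card_biUnion]
    · rw [Finset.sum_congr rfl (g := fun _ => (Fintype.card ι - 2).factorial), Finset.sum_const,
        smul_eq_mul]
      intro j hj
      rw [hT, Finset.mem_filter] at hj
      apply card_RV2_eq hc w hj.2.1.symm
      refine ⟨?_, fun x => if x = u then 2 else if x = w k then 1 else 0, ?_⟩
      · intro a ha b hb hab
        simp only [Finset.coe_insert, Finset.coe_singleton, Set.mem_insert_iff,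
          Set.mem_singleton_iff] at ha hb
        rcases ha with rfl | rfl <;> rcases hb with rfl | rfl
        · rfl
        · simp [hj.2.1] at hab; exact absurd hab huv
        · simp [hj.2.1] at hab; exact absurd hab.symm huv
        · rfl
      · intro i hi
        simp only [Finset.mem_insert, Finset.mem_singleton] at hi
        rcases hi with rfl | rfl
        · simp [Ne.symm huv]
        · simp [hj.2.1, hj.2.2.1, hj.2.2.2, Ne.symm huv]
    · intro i _ j _ hij
      rw [Function.onFun, Finset.disjoint_left]
      intro R hR hR'
      rw [Finset.mem_filter] at hR hR'
      exact hij (RV_inj hR.1 (hR.2.2.trans hR'.2.2.symm))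
  have h3 : Fintype.card ι ≤ T.card + ((Finset.univ.filter (fun j => w j = w k)).card
          + (Finset.univ.filter (fun j => w j = u)).card) := by
    have : (Finset.univ : Finset ι) ⊆ T ∪ ((Finset.univ.filter (fun j => w j = w k)) ∪
        (Finset.univ.filter (fun j => w j = u))) := by
      intro j _
      simp only [hT, Finset.mem_union, Finset.mem_filter, Finset.mem_univ, true_and]
      by_cases hjk : j = k
      · subst hjk; simp
      · tauto
    calc Fintype.card ι = (Finset.univ : Finset ι).card := rfl
      _ ≤ _ := (Finset.card_le_card this).trans ((Finset.card_union_le _ _).trans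
        (Nat.add_le_add_left (Finset.card_union_le _ _) _))
  have h4 : (Fintype.card ι - 1).factorial
      = (Fintype.card ι - 1) * (Fintype.card ι - 2).factorial := by
    rw [← Nat.mul_factorial_pred (by omega : Fintype.card ι - 1 ≠ 0)]; rfl
  rw [h4] at h1
  obtain ⟨c, hc'⟩ : ∃ c, Fintype.card ι = c + 1 := ⟨Fintype.card ι - 1, by omega⟩
  have h6 : c * (Fintype.card ι - 2).factorial ≤ (T.card + ((Finset.univ.filter (fun j => w j = w k)).card
          + (Finset.univ.filter (fun j => w j = u)).card)) * (Fintype.card ι - 2).factorial :=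
    Nat.mul_le_mul_right _ (by omega)
  have h7 : Fintype.card ι - 1 = c := by omega
  rw [h7] at h1
  nlinarith

/-- expectation of the sum of `f` over children of the root. -/
lemma RV_root_children (hc : Fintype.card V = Fintype.card ι + 1) (h5 : 2 ≤ Fintype.card ι)
    (w : ι → V) (f : V → ℝ) (hf : ∀ v, 0 ≤ f v) :
    ∑ R ∈ RV w, ∑ k, (if ∀ j, R j ≠ w k then f (R k) else 0)
      ≤ ((Fintype.card ι - 2).factorial : ℝ) *
        ((∑ v, f v) * (∑ k, ((Finset.univ.filter (fun j => w j = w k)).card : ℝ))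
          + Fintype.card ι * ∑ k, f (w k)) := by
  rw [Finset.sum_comm]
  have h1 : ∀ k, ∑ R ∈ RV w, (if ∀ j, R j ≠ w k then f (R k) else 0)
      ≤ ((Fintype.card ι - 2).factorial : ℝ) *
        ((∑ v, f v) * ((Finset.univ.filter (fun j => w j = w k)).card : ℝ) + ∑ k, f (w k)) := by
    intro k
    rw [← Finset.sum_filter]
    have := Finset.sum_fiberwise ((RV w).filter (fun R => ∀ j, R j ≠ w k)) (fun R => R k)
      (fun R => f (R k))
    rw [← this]
    have h2 : ∀ u, ∑ R ∈ ((RV w).filter (fun R => ∀ j, R j ≠ w k)).filter (fun R => R k = u),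
        f (R k) ≤ ((Fintype.card ι - 2).factorial : ℝ) *
          (f u * ((Finset.univ.filter (fun j => w j = w k)).card : ℝ)
            + ∑ j, if w j = u then f u else 0) := by
      intro u
      rw [Finset.sum_congr rfl (g := fun _ => f u), Finset.sum_const, nsmul_eq_mul]
      · have h3 := card_root2 hc h5 w k u
        rw [Finset.filter_filter]
        simp_rw [and_comm] at h3 ⊢
        rw [← Finset.sum_filter (fun j => w j = u), Finset.sum_const, nsmul_eq_mul]
        have h4 := mul_le_mul_of_nonneg_right (Nat.cast_le (α := ℝ).2 h3) (hf u)
        refine h4.trans (le_of_eq ?_)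
        push_cast; ring
      · intro R hR
        rw [(Finset.mem_filter.1 hR).2]
    refine (Finset.sum_le_sum fun u _ => h2 u).trans (le_of_eq ?_)
    rw [← Finset.mul_sum, Finset.sum_add_distrib, ← Finset.sum_mul, Finset.sum_comm (s := Finset.univ)]
    simp
  refine (Finset.sum_le_sum fun k _ => h1 k).trans (le_of_eq ?_)
  rw [← Finset.mul_sum, Finset.sum_add_distrib, ← Finset.mul_sum]
  simp

end RM

/-! ### Part 3: moments over uniform injections -/

section SM
variable {ι Y : Type*} [DecidableEq ι] [Fintype ι] [DecidableEq Y] [Fintype Y]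

noncomputable def Inj (ι Y : Type*) [DecidableEq ι] [Fintype ι] [DecidableEq Y] [Fintype Y] : Finset (ι → Y) :=
  Finset.univ.filter (fun S => Function.Injective S)

lemma card_avoid (T : Finset Y) :
    ((Inj ι Y).filter (fun S => ∀ k, S k ∉ T)).card
      = (Fintype.card Y - T.card).descFactorial (Fintype.card ι) := by
  have h1 : Fintype.card (ι ↪ {y // y ∉ T})
      = (Fintype.card Y - T.card).descFactorial (Fintype.card ι) := by
    rw [Fintype.card_embedding_eq]
    congr 1
    rw [Fintype.card_subtype_compl]; simp
  rw [← h1, ← Fintype.card_coe]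
  refine Fintype.card_congr
    { toFun := fun S => ⟨fun k => ⟨S.1 k, (Finset.mem_filter.1 S.2).2 k⟩, fun a b hab => ?_⟩
      invFun := fun e => ⟨fun k => (e k).1, ?_⟩
      left_inv := fun S => rfl
      right_inv := fun e => rfl }
  · have := (Finset.mem_filter.1 (Finset.mem_filter.1 S.2).1).2
    exact this (Subtype.ext_iff.1 hab)
  · rw [Finset.mem_filter, Inj, Finset.mem_filter]
    exact ⟨⟨Finset.mem_univ _, fun a b hab => e.injective (Subtype.ext hab)⟩, fun k => (e k).2⟩

lemma descFact_shift (N k : ℕ) :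
    (N + 1) * N.descFactorial k = (N + 1 - k) * (N + 1).descFactorial k := by
  rw [← Nat.succ_descFactorial_succ, Nat.descFactorial_succ]

/-- indicator that `y` is not in the range of `S` -/
noncomputable def chi (S : ι → Y) (y : Y) : ℝ := if ∀ k, S k ≠ y then 1 else 0

lemma sum_chi_list (T : Finset Y) :
    ∑ S ∈ Inj ι Y, ∏ y ∈ T, chi S y
      = ((Fintype.card Y - T.card).descFactorial (Fintype.card ι) : ℝ) := by
  rw [← card_avoid, Finset.card_filter]
  push_cast
  refine Finset.sum_congr rfl fun S _ => ?_
  unfold chi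
  rw [Finset.prod_ite_zero]
  simp only [Finset.prod_const_one]
  congr 1
  apply propext
  constructor
  · intro h k hk; exact h _ hk k rfl
  · rintro h i hi k rfl; exact h k hi

lemma chi_sq (S : ι → Y) (y : Y) : chi S y * chi S y = chi S y := by
  unfold chi; split_ifs <;> simp

lemma chi_nonneg (S : ι → Y) (y : Y) : 0 ≤ chi S y := by
  unfold chi; split_ifs <;> simp

lemma chi_le_one (S : ι → Y) (y : Y) : chi S y ≤ 1 := by
  unfold chi; split_ifs <;> simp

variable (M L : ℝ)

lemma sum_chi1 (hM : M = Fintype.card Y) (hL : L = M - Fintype.card ι)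
    (hk : Fintype.card ι ≤ Fintype.card Y) (y : Y) :
    ∑ S ∈ Inj ι Y, chi S y = ((Inj ι Y).card : ℝ) * (L / M) := by
  have h0 := sum_chi_list (ι := ι) (∅ : Finset Y)
  have h1 := sum_chi_list (ι := ι) ({y} : Finset Y)
  simp only [Finset.prod_empty, Finset.sum_const, nsmul_eq_mul, mul_one, Finset.card_empty,
    Nat.sub_zero, Finset.prod_singleton, Finset.card_singleton] at h0 h1
  rw [h0, h1]
  have hpos : 0 < Fintype.card Y := Fintype.card_pos_iff.2 ⟨y⟩
  obtain ⟨N, hN⟩ : ∃ N, Fintype.card Y = N + 1 := ⟨_, (Nat.sub_add_cancel hpos).symm⟩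
  have h2 := descFact_shift N (Fintype.card ι)
  rw [hN] at hk ⊢
  have h3 : ((N + 1 : ℕ) : ℝ) * (N.descFactorial (Fintype.card ι) : ℝ)
      = L * ((N + 1).descFactorial (Fintype.card ι) : ℝ) := by
    rw [hL, hM, hN]
    rw [← Nat.cast_sub hk]
    exact_mod_cast h2
  have : M = ((N + 1 : ℕ) : ℝ) := by rw [hM, hN]
  rw [this]
  have : ((N + 1 : ℕ) : ℝ) ≠ 0 := by positivity
  rw [Nat.add_sub_cancel]
  field_simp
  linarith

lemma sum_chi2 (hM : M = Fintype.card Y) (hL : L = M - Fintype.card ι)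
    (hk : Fintype.card ι + 1 ≤ Fintype.card Y) {y z : Y} (hyz : y ≠ z) :
    ∑ S ∈ Inj ι Y, chi S y * chi S z
      = ((Inj ι Y).card : ℝ) * (L * (L - 1) / (M * (M - 1))) := by
  have h0 := sum_chi1 (ι := ι) M L hM hL (by omega) y
  have h0' := sum_chi_list (ι := ι) ({y} : Finset Y)
  have h1 := sum_chi_list (ι := ι) ({y, z} : Finset Y)
  rw [Finset.card_pair hyz] at h1
  simp only [Finset.prod_pair hyz, 
    Finset.prod_singleton, Finset.card_singleton] at h0' h1
  rw [h1]
  have hpos : 2 ≤ Fintype.card Y := by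
    have := Finset.card_le_univ ({y, z} : Finset Y)
    rwa [Finset.card_pair hyz] at this
  obtain ⟨N, hN⟩ : ∃ N, Fintype.card Y = N + 2 := ⟨_, (Nat.sub_add_cancel hpos).symm⟩
  have h2 := descFact_shift N (Fintype.card ι)
  rw [hN] at hk ⊢
  have e1 : N + 2 - 1 = N + 1 := by omega
  have h3 : ((N + 1 : ℕ) : ℝ) * (N.descFactorial (Fintype.card ι) : ℝ)
      = (L - 1) * ((N + 1).descFactorial (Fintype.card ι) : ℝ) := by
    have : L - 1 = ((N + 1 - Fintype.card ι : ℕ) : ℝ) := by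
      rw [hL, hM, hN]
      rw [Nat.cast_sub (by omega)]
      push_cast; ring
    rw [this]
    exact_mod_cast h2
  rw [hN, e1] at h0'
  rw [← h0', h0] at h3
  have hM1 : M - 1 = ((N + 1 : ℕ) : ℝ) := by rw [hM, hN]; push_cast; ring
  have hM2 : M = ((N + 2 : ℕ) : ℝ) := by rw [hM, hN]
  rw [hM1]
  have : ((N + 1 : ℕ) : ℝ) ≠ 0 := by positivity
  have : M ≠ 0 := by rw [hM2]; positivity
  rw [Nat.add_sub_cancel]
  field_simp at h3 ⊢
  linarith

lemma sum_chi4 (hM : M = Fintype.card Y) (hL : L = M - Fintype.card ι)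
    (hk : Fintype.card ι + 1 ≤ Fintype.card Y) {y z y' z' : Y} (hyz : y ≠ z) (hyz' : y' ≠ z')
    (h1 : y ≠ y') (h2 : y ≠ z') (h3 : z ≠ y') (h4 : z ≠ z') :
    ∑ S ∈ Inj ι Y, (chi S y * chi S z) * (chi S y' * chi S z')
      ≤ ((Inj ι Y).card : ℝ) * (L * (L - 1) / (M * (M - 1))) ^ 2 := by
  have hcard : ({y, z, y', z'} : Finset Y).card = 4 := by
    rw [Finset.card_insert_of_notMem (by simp [*]), Finset.card_insert_of_notMem (by simp [*]),
      Finset.card_pair hyz']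
  have c4 := sum_chi_list (ι := ι) ({y, z, y', z'} : Finset Y)
  have c2 := sum_chi_list (ι := ι) ({y, z} : Finset Y)
  rw [hcard] at c4
  have e4 : ∀ S : ι → Y, ∏ w ∈ ({y, z, y', z'} : Finset Y), chi S w
      = (chi S y * chi S z) * (chi S y' * chi S z') := by
    intro S
    rw [Finset.prod_insert (by simp [*]), Finset.prod_insert (by simp [*]), Finset.prod_pair hyz']
    ring
  simp_rw [e4] at c4
  rw [Finset.card_pair hyz] at c2
  simp only [Finset.prod_pair hyz] at c2
  have s2 := sum_chi2 (ι := ι) M L hM hL hk hyz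
  rw [c4, sq, ← mul_assoc, ← s2, c2]
  have hpos : 4 ≤ Fintype.card Y := by
    have := Finset.card_le_univ ({y, z, y', z'} : Finset Y)
    rwa [hcard] at this
  obtain ⟨N, hN⟩ : ∃ N, Fintype.card Y = N + 4 := ⟨_, (Nat.sub_add_cancel hpos).symm⟩
  have d1 := descFact_shift N (Fintype.card ι)
  have d2 := descFact_shift (N + 1) (Fintype.card ι)
  rw [hN] at hk ⊢
  have e1 : N + 4 - 2 = N + 2 := by omega
  rw [e1, Nat.add_sub_cancel]
  set a := Fintype.card ι
  have hM' : M = (N : ℝ) + 4 := by rw [hM, hN]; push_cast; ring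
  have hLN : L = (N : ℝ) + 4 - a := by rw [hL, hM']
  have hL1 : 1 ≤ L := by
    rw [hLN]
    have : ((a + 1 : ℕ) : ℝ) ≤ ((N + 4 : ℕ) : ℝ) := by exact_mod_cast hk
    push_cast at this; linarith
  have hN0 : (0 : ℝ) ≤ N := by positivity
  have rhs : 0 ≤ ((N + 2).descFactorial a : ℝ) * (L * (L - 1) / (M * (M - 1))) := by
    rw [hM']
    have : 0 ≤ L - 1 := by linarith
    have : 0 < (N : ℝ) + 4 - 1 := by linarith
    positivity
  by_cases hbig : N + 1 ≤ a
  · have : N.descFactorial a = 0 := Nat.descFactorial_eq_zero_iff_lt.2 (by omega)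
    rw [this]; simpa using rhs
  · have r1 : ((N : ℝ) + 1) * (N.descFactorial a) = (L - 3) * ((N + 1).descFactorial a) := by
      have : L - 3 = ((N + 1 - a : ℕ) : ℝ) := by
        rw [hLN, Nat.cast_sub (by omega)]; push_cast; ring
      rw [this]; exact_mod_cast d1
    have r2 : ((N : ℝ) + 2) * ((N + 1).descFactorial a) = (L - 2) * ((N + 2).descFactorial a) := by
      have : L - 2 = ((N + 1 + 1 - a : ℕ) : ℝ) := by
        rw [hLN, Nat.cast_sub (by omega)]; push_cast; ring
      rw [this]; exact_mod_cast d2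
    have hL4 : 4 ≤ L := by
      rw [hLN]
      have : (a : ℝ) ≤ N := by exact_mod_cast (by omega : a ≤ N)
      linarith
    have hLM : L ≤ M := by rw [hLN, hM']; have : (0 : ℝ) ≤ a := by positivity
                           linarith
    have q1 : (N.descFactorial a : ℝ)
        = ((N + 2).descFactorial a : ℝ) * ((L - 2) / (M - 2) * ((L - 3) / (M - 3))) := by
      have : M - 2 = (N : ℝ) + 2 := by rw [hM']; ring
      rw [this]
      have : M - 3 = (N : ℝ) + 1 := by rw [hM']; ring
      rw [this]
      field_simp
      linear_combination (N + 2 : ℝ) * r1 + (L - 3) * r2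
    rw [q1]
    refine mul_le_mul_of_nonneg_left ?_ (by positivity)
    have t1 : (L - 2) / (M - 2) ≤ L / M := by
      rw [div_le_div_iff₀ (by linarith) (by linarith)]; nlinarith
    have t2 : (L - 3) / (M - 3) ≤ (L - 1) / (M - 1) := by
      rw [div_le_div_iff₀ (by linarith) (by linarith)]; nlinarith
    calc (L - 2) / (M - 2) * ((L - 3) / (M - 3)) ≤ L / M * ((L - 1) / (M - 1)) := by
          refine mul_le_mul t1 t2 ?_ ?_
          · apply div_nonneg <;> linarith
          · apply div_nonneg <;> linarith
      _ = _ := by rw [div_mul_div_comm]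

/-- variance of the number of free pairs -/
lemma chi_pair_var (hM : M = Fintype.card Y) (hL : L = M - Fintype.card ι)
    (hk : Fintype.card ι + 1 ≤ Fintype.card Y) (P : Finset (Y × Y)) (hP : ∀ p ∈ P, p.1 ≠ p.2)
    (D : ℕ) (hD1 : ∀ y, (P.filter (fun q => q.1 = y)).card ≤ D)
    (hD2 : ∀ y, (P.filter (fun q => q.2 = y)).card ≤ D) :
    ∑ S ∈ Inj ι Y, ((∑ p ∈ P, chi S p.1 * chi S p.2)
        - (L * (L - 1) / (M * (M - 1))) * P.card) ^ 2
      ≤ ((Inj ι Y).card : ℝ) * ((L * (L - 1) / (M * (M - 1))) * (4 * D * P.card)) := by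
  set π := L * (L - 1) / (M * (M - 1)) with hπ
  set Z := ((Inj ι Y).card : ℝ) with hZ
  have hZ0 : 0 ≤ Z := by positivity
  have hL1 : 1 ≤ L := by
    rw [hL, hM]
    have : ((Fintype.card ι + 1 : ℕ) : ℝ) ≤ (Fintype.card Y : ℝ) := by exact_mod_cast hk
    push_cast at this; linarith
  have hM1 : 1 ≤ M := by
    have : (0 : ℝ) ≤ Fintype.card ι := by positivity
    linarith
  have hπ0 : 0 ≤ π := by
    apply div_nonneg <;> apply mul_nonneg <;> linarith
  have first : ∑ S ∈ Inj ι Y, (∑ p ∈ P, chi S p.1 * chi S p.2) = Z * (π * P.card) := by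
    rw [Finset.sum_comm, Finset.sum_congr rfl (g := fun _ => Z * π), Finset.sum_const, nsmul_eq_mul]
    · ring
    · intro p hp; exact sum_chi2 M L hM hL hk (hP p hp)
  have second : ∑ S ∈ Inj ι Y, (∑ p ∈ P, chi S p.1 * chi S p.2) ^ 2
      ≤ Z * (π * P.card) ^ 2 + Z * (π * (4 * D * P.card)) := by
    have e : ∑ S ∈ Inj ι Y, (∑ p ∈ P, chi S p.1 * chi S p.2) ^ 2
        = ∑ p ∈ P, ∑ q ∈ P, ∑ S ∈ Inj ι Y, (chi S p.1 * chi S p.2) * (chi S q.1 * chi S q.2) := by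
      simp_rw [sq, Finset.sum_mul_sum]
      rw [Finset.sum_comm]
      refine Finset.sum_congr rfl fun p _ => ?_
      rw [Finset.sum_comm]
    rw [e]
    have h1 : ∀ p ∈ P, ∀ q ∈ P, ∑ S ∈ Inj ι Y, (chi S p.1 * chi S p.2) * (chi S q.1 * chi S q.2)
        ≤ Z * π ^ 2 + Z * π * ((if q.1 = p.1 then 1 else 0) + (if q.1 = p.2 then 1 else 0)
          + (if q.2 = p.1 then 1 else 0) + (if q.2 = p.2 then 1 else 0)) := by
      intro p hp q hq
      have hZπ : 0 ≤ Z * π := by positivity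
      have base : ∑ S ∈ Inj ι Y, (chi S p.1 * chi S p.2) * (chi S q.1 * chi S q.2) ≤ Z * π := by
        rw [← sum_chi2 M L hM hL hk (hP p hp)]
        refine Finset.sum_le_sum fun S _ => ?_
        exact mul_le_of_le_one_right (mul_nonneg (chi_nonneg _ _) (chi_nonneg _ _))
          (mul_le_one₀ (chi_le_one _ _) (chi_nonneg _ _) (chi_le_one _ _))
      have hZπ2 : 0 ≤ Z * π ^ 2 := by positivity
      by_cases g1 : q.1 = p.1 ∨ q.1 = p.2 ∨ q.2 = p.1 ∨ q.2 = p.2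
      · have : (1 : ℝ) ≤ ((if q.1 = p.1 then 1 else 0) + (if q.1 = p.2 then 1 else 0)
          + (if q.2 = p.1 then 1 else 0) + (if q.2 = p.2 then 1 else 0)) := by
          have hh : ∀ c : Prop, [Decidable c] → (0 : ℝ) ≤ if c then 1 else 0 := by
            intro c _; split_ifs <;> simp
          have a1 := hh (q.1 = p.1)
          have a2 := hh (q.1 = p.2)
          have a3 := hh (q.2 = p.1)
          have a4 := hh (q.2 = p.2)
          rcases g1 with g | g | g | g
          · rw [if_pos g]; linarith
          · rw [if_pos g]; linarith
          · rw [if_pos g] at *; linarith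
          · rw [if_pos g] at *; linarith
        nlinarith
      · push Not at g1
        rw [if_neg g1.1, if_neg g1.2.1, if_neg g1.2.2.1, if_neg g1.2.2.2]
        have := sum_chi4 (ι := ι) M L hM hL hk (hP p hp) (hP q hq) (Ne.symm g1.1)
          (Ne.symm g1.2.2.1) (Ne.symm g1.2.1) (Ne.symm g1.2.2.2)
        simpa using this
    refine (Finset.sum_le_sum fun p hp => Finset.sum_le_sum fun q hq => h1 p hp q hq).trans ?_
    have h2 : ∀ p ∈ P, ∑ q ∈ P, (Z * π ^ 2 + Z * π * ((if q.1 = p.1 then 1 else 0)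
        + (if q.1 = p.2 then 1 else 0)
          + (if q.2 = p.1 then 1 else 0) + (if q.2 = p.2 then 1 else 0)))
          ≤ P.card * (Z * π ^ 2) + Z * π * (4 * D) := by
      intro p _
      rw [Finset.sum_add_distrib, Finset.sum_const, nsmul_eq_mul, ← Finset.mul_sum]
      simp_rw [Finset.sum_add_distrib, Finset.sum_boole]
      have a1 : ((P.filter (fun q => q.1 = p.1)).card : ℝ) ≤ D := by exact_mod_cast hD1 p.1
      have a2 : ((P.filter (fun q => q.1 = p.2)).card : ℝ) ≤ D := by exact_mod_cast hD1 p.2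
      have a3 : ((P.filter (fun q => q.2 = p.1)).card : ℝ) ≤ D := by exact_mod_cast hD2 p.1
      have a4 : ((P.filter (fun q => q.2 = p.2)).card : ℝ) ≤ D := by exact_mod_cast hD2 p.2
      have : 0 ≤ Z * π := by positivity
      gcongr
      linarith
    refine (Finset.sum_le_sum h2).trans (le_of_eq ?_)
    rw [Finset.sum_const, nsmul_eq_mul]
    ring
  have expand : ∑ S ∈ Inj ι Y, ((∑ p ∈ P, chi S p.1 * chi S p.2) - π * P.card) ^ 2
      = ∑ S ∈ Inj ι Y, (∑ p ∈ P, chi S p.1 * chi S p.2) ^ 2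
        - 2 * (π * P.card) * ∑ S ∈ Inj ι Y, (∑ p ∈ P, chi S p.1 * chi S p.2)
        + Z * (π * P.card) ^ 2 := by
    simp_rw [sub_sq]
    rw [Finset.sum_add_distrib, Finset.sum_sub_distrib, Finset.sum_const, nsmul_eq_mul,
      Finset.mul_sum]
    congr 2
    refine Finset.sum_congr rfl fun R _ => by ring
  rw [expand, first]
  linarith

lemma chi_lin_mean (hM : M = Fintype.card Y) (hL : L = M - Fintype.card ι)
    (hk : Fintype.card ι + 1 ≤ Fintype.card Y) (g : Y → ℝ) :
    ∑ S ∈ Inj ι Y, (∑ y, g y * chi S y) = ((Inj ι Y).card : ℝ) * (L / M * ∑ y, g y) := by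
  rw [Finset.sum_comm]
  simp_rw [← Finset.mul_sum]
  simp_rw [sum_chi1 (ι := ι) M L hM hL (by omega)]
  rw [← Finset.sum_mul]; ring

lemma chi_lin_var (hM : M = Fintype.card Y) (hL : L = M - Fintype.card ι)
    (hk : Fintype.card ι + 1 ≤ Fintype.card Y) (g : Y → ℝ) (hg : ∀ y, 0 ≤ g y) :
    ∑ S ∈ Inj ι Y, ((∑ y, g y * chi S y) - L / M * ∑ y, g y) ^ 2
      ≤ ((Inj ι Y).card : ℝ) * (L / M * ∑ y, g y ^ 2) := by
  have first := chi_lin_mean (ι := ι) M L hM hL hk g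
  set π := L / M with hπ
  set Z := ((Inj ι Y).card : ℝ) with hZ
  set G := ∑ y, g y with hG
  have hZ0 : 0 ≤ Z := by positivity
  have hL1 : 1 ≤ L := by
    rw [hL, hM]
    have : ((Fintype.card ι + 1 : ℕ) : ℝ) ≤ (Fintype.card Y : ℝ) := by exact_mod_cast hk
    push_cast at this; linarith
  have hLM : L ≤ M := by
    have : (0 : ℝ) ≤ Fintype.card ι := by positivity
    linarith
  have hπ0 : 0 ≤ π := by apply div_nonneg <;> linarith
  have second : ∑ S ∈ Inj ι Y, (∑ y, g y * chi S y) ^ 2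
      ≤ Z * (π * G) ^ 2 + Z * (π * ∑ y, g y ^ 2) := by
    have e : ∑ S ∈ Inj ι Y, (∑ y, g y * chi S y) ^ 2
        = ∑ y, ∑ z, ∑ S ∈ Inj ι Y, (g y * chi S y) * (g z * chi S z) := by
      simp_rw [sq, Finset.sum_mul_sum]
      rw [Finset.sum_comm]
      refine Finset.sum_congr rfl fun p _ => ?_
      rw [Finset.sum_comm]
    rw [e]
    have h1 : ∀ y z, ∑ S ∈ Inj ι Y, (g y * chi S y) * (g z * chi S z)
        ≤ Z * π ^ 2 * (g y * g z) + (if y = z then Z * π * g y ^ 2 else 0) := by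
      intro y z
      have e2 : ∑ S ∈ Inj ι Y, (g y * chi S y) * (g z * chi S z)
          = (g y * g z) * ∑ S ∈ Inj ι Y, chi S y * chi S z := by
        rw [Finset.mul_sum]; exact Finset.sum_congr rfl fun S _ => by ring
      rw [e2]
      have hgg : 0 ≤ g y * g z := mul_nonneg (hg y) (hg z)
      split_ifs with hyz
      · subst hyz
        simp_rw [chi_sq]
        rw [sum_chi1 (ι := ι) M L hM hL (by omega)]
        have : 0 ≤ Z * π ^ 2 * (g y * g y) := by positivity
        nlinarith
      · rw [sum_chi2 (ι := ι) M L hM hL hk hyz, add_zero, mul_comm]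
        refine mul_le_mul_of_nonneg_right ?_ hgg
        refine mul_le_mul_of_nonneg_left ?_ hZ0
        have hM2 : 2 ≤ M := by
          have := Finset.card_le_univ ({y, z} : Finset Y)
          rw [Finset.card_pair hyz] at this
          rw [hM]; exact_mod_cast this
        rw [hπ, ← div_mul_div_comm, sq]
        refine mul_le_mul_of_nonneg_left ?_ hπ0
        rw [div_le_div_iff₀ (by linarith) (by linarith)]; nlinarith
    refine (Finset.sum_le_sum fun p _ => Finset.sum_le_sum fun q _ => h1 p q).trans (le_of_eq ?_)
    simp_rw [Finset.sum_add_distrib]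
    simp only [Finset.sum_ite_eq, Finset.mem_univ, if_true]
    simp_rw [← Finset.mul_sum]
    rw [← Finset.sum_mul, ← hG]; ring
  have expand : ∑ S ∈ Inj ι Y, ((∑ y, g y * chi S y) - π * G) ^ 2
      = ∑ S ∈ Inj ι Y, (∑ y, g y * chi S y) ^ 2
        - 2 * (π * G) * ∑ S ∈ Inj ι Y, (∑ y, g y * chi S y)
        + Z * (π * G) ^ 2 := by
    clear_value G
    simp_rw [sub_sq]
    rw [Finset.sum_add_distrib, Finset.sum_sub_distrib, Finset.sum_const, nsmul_eq_mul,
      Finset.mul_sum (Inj ι Y)]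
    congr 2
    refine Finset.sum_congr rfl fun R _ => by ring
  rw [expand, first]
  linarith

end SM

/-! ### Part 4: uniform matchings and a Poisson approximation -/

section MS
variable {H : Type*} [DecidableEq H] [Fintype H]

def cj (b z : H) (M : H → H) : H → H := fun h => Equiv.swap b z (M (Equiv.swap b z h))

lemma cj_cj (b z : H) (M : H → H) : cj b z (cj b z M) = M := by
  funext h; simp [cj]

structure Swp (Ω : Finset (H → H)) (F : Finset H) : Prop where
  inv : ∀ M ∈ Ω, ∀ h, M (M h) = h
  maps : ∀ M ∈ Ω, ∀ a ∈ F, M a ∈ F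
  nofix : ∀ M ∈ Ω, ∀ a ∈ F, M a ≠ a
  swap : ∀ M ∈ Ω, ∀ b ∈ F, ∀ z ∈ F, cj b z M ∈ Ω

noncomputable def avg {A : Type*} (Ω : Finset A) (Φ : A → ℝ) : ℝ := (∑ M ∈ Ω, Φ M) / Ω.card

lemma avg_mono {A : Type*} {Ω : Finset A} {Φ Ψ : A → ℝ} (h : ∀ M ∈ Ω, Φ M ≤ Ψ M) :
    avg Ω Φ ≤ avg Ω Ψ := by
  unfold avg
  exact div_le_div_of_nonneg_right (Finset.sum_le_sum h) (by positivity)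

lemma avg_add {A : Type*} (Ω : Finset A) (Φ Ψ : A → ℝ) :
    avg Ω (fun M => Φ M + Ψ M) = avg Ω Φ + avg Ω Ψ := by
  unfold avg; rw [Finset.sum_add_distrib, add_div]

lemma avg_sub {A : Type*} (Ω : Finset A) (Φ Ψ : A → ℝ) :
    avg Ω (fun M => Φ M - Ψ M) = avg Ω Φ - avg Ω Ψ := by
  unfold avg; rw [Finset.sum_sub_distrib, sub_div]

lemma avg_mul {A : Type*} (Ω : Finset A) (c : ℝ) (Φ : A → ℝ) :
    avg Ω (fun M => c * Φ M) = c * avg Ω Φ := by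
  unfold avg; rw [← Finset.mul_sum, mul_div_assoc]

lemma avg_sum {A B : Type*} (Ω : Finset A) (s : Finset B) (Φ : B → A → ℝ) :
    avg Ω (fun M => ∑ i ∈ s, Φ i M) = ∑ i ∈ s, avg Ω (Φ i) := by
  unfold avg; rw [Finset.sum_comm, Finset.sum_div]

lemma avg_const {A : Type*} {Ω : Finset A} (h : Ω.Nonempty) (c : ℝ) :
    avg Ω (fun _ => c) = c := by
  unfold avg
  have : (Ω.card : ℝ) ≠ 0 := by exact_mod_cast h.card_pos.ne'
  rw [Finset.sum_const, nsmul_eq_mul]; field_simp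

lemma abs_avg_le {A : Type*} (Ω : Finset A) (Φ : A → ℝ) :
    |avg Ω Φ| ≤ avg Ω (fun M => |Φ M|) := by
  unfold avg
  rw [abs_div, Nat.abs_cast]
  exact div_le_div_of_nonneg_right (Finset.abs_sum_le_sum_abs _ _) (by positivity)

lemma avg_nonneg {A : Type*} {Ω : Finset A} {Φ : A → ℝ} (h : ∀ M ∈ Ω, 0 ≤ Φ M) : 0 ≤ avg Ω Φ := by
  unfold avg
  exact div_nonneg (Finset.sum_nonneg h) (by positivity)

noncomputable def cnd (Ω : Finset (H → H)) (a b : H) : Finset (H → H) := Ω.filter (fun M => M a = b)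

lemma Swp.coupling {Ω : Finset (H → H)} {F : Finset H} (hS : Swp Ω F) {a b : H} (ha : a ∈ F)
    (hb : b ∈ F) (hab : a ≠ b) (Φ : (H → H) → H → ℝ) :
    ∑ M ∈ cnd Ω a b, ∑ z ∈ F.erase a, Φ M z = ∑ M ∈ Ω, Φ (cj b (M a) M) (M a) := by
  have hmaps : ∀ M ∈ Ω, M a ∈ F.erase a := fun M hM =>
    Finset.mem_erase.2 ⟨hS.nofix M hM a ha, hS.maps M hM a ha⟩
  rw [← Finset.sum_fiberwise_of_maps_to hmaps, Finset.sum_comm]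
  refine Finset.sum_congr rfl fun z hz => ?_
  obtain ⟨hza, hzF⟩ := Finset.mem_erase.1 hz
  have hsw : ∀ M : H → H, cj b z M a = Equiv.swap b z (M a) := fun M => by
    simp only [cj]; rw [Equiv.swap_apply_of_ne_of_ne hab (Ne.symm hza)]
  refine Finset.sum_nbij' (fun M => cj b z M) (fun M => cj b z M) ?_ ?_ ?_ ?_ ?_
  · intro M hM
    obtain ⟨h1, h2⟩ := Finset.mem_filter.1 hM
    refine Finset.mem_filter.2 ⟨hS.swap M h1 b hb z hzF, ?_⟩
    rw [hsw, h2, Equiv.swap_apply_left]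
  · intro M hM
    obtain ⟨h1, h2⟩ := Finset.mem_filter.1 hM
    refine Finset.mem_filter.2 ⟨hS.swap M h1 b hb z hzF, ?_⟩
    rw [hsw, h2, Equiv.swap_apply_right]
  · intro M _; exact cj_cj b z M
  · intro M _; exact cj_cj b z M
  · intro M hM
    obtain ⟨h1, h2⟩ := Finset.mem_filter.1 hM
    have : cj b z M a = z := by rw [hsw, h2, Equiv.swap_apply_left]
    rw [this, cj_cj]

lemma Swp.coupling1 {Ω : Finset (H → H)} {F : Finset H} (hS : Swp Ω F) {a b : H} (ha : a ∈ F)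
    (hb : b ∈ F) (hab : a ≠ b) (Φ : (H → H) → ℝ) :
    ((F.card : ℝ) - 1) * ∑ M ∈ cnd Ω a b, Φ M = ∑ M ∈ Ω, Φ (cj b (M a) M) := by
  rw [← hS.coupling ha hb hab (fun M _ => Φ M), Finset.mul_sum]
  refine Finset.sum_congr rfl fun M _ => ?_
  rw [Finset.sum_const, Finset.card_erase_of_mem ha, nsmul_eq_mul,
    Nat.cast_sub (Finset.card_pos.2 ⟨a, ha⟩)]
  simp

lemma Swp.card {Ω : Finset (H → H)} {F : Finset H} (hS : Swp Ω F) {a b : H} (ha : a ∈ F)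
    (hb : b ∈ F) (hab : a ≠ b) : ((F.card : ℝ) - 1) * (cnd Ω a b).card = Ω.card := by
  have := hS.coupling1 ha hb hab (fun _ => 1)
  simpa using this

lemma two_le_card {F : Finset H} {a b : H} (ha : a ∈ F) (hb : b ∈ F) (hab : a ≠ b) :
    2 ≤ F.card := by
  rw [← Finset.card_pair hab]
  apply Finset.card_le_card
  intro x hx; simp only [Finset.mem_insert, Finset.mem_singleton] at hx
  rcases hx with rfl | rfl <;> assumption

lemma Swp.avg_cnd {Ω : Finset (H → H)} {F : Finset H} (hS : Swp Ω F) {a b : H} (ha : a ∈ F)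
    (hb : b ∈ F) (hab : a ≠ b) (Φ : (H → H) → ℝ) :
    avg (cnd Ω a b) Φ = avg Ω (fun M => Φ (cj b (M a) M)) := by
  unfold avg
  rw [← hS.coupling1 ha hb hab, ← hS.card ha hb hab]
  have h2 : (2 : ℝ) ≤ F.card := by exact_mod_cast two_le_card ha hb hab
  rw [mul_div_mul_left]
  linarith

lemma Swp.avg_cnd2 {Ω : Finset (H → H)} {F : Finset H} (hS : Swp Ω F) {a b : H} (ha : a ∈ F)
    (hb : b ∈ F) (hab : a ≠ b) (Φ : (H → H) → H → ℝ) :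
    avg Ω (fun M => Φ (cj b (M a) M) (M a))
      = avg (cnd Ω a b) (fun M => ∑ z ∈ F.erase a, Φ M z) / ((F.card : ℝ) - 1) := by
  unfold avg
  rw [← hS.coupling ha hb hab, ← hS.card ha hb hab, div_div, mul_comm]

lemma Swp.cnd_nonempty {Ω : Finset (H → H)} {F : Finset H} (hS : Swp Ω F) {a b : H} (ha : a ∈ F)
    (hb : b ∈ F) (hab : a ≠ b) (hne : Ω.Nonempty) : (cnd Ω a b).Nonempty := by
  by_contra h
  rw [Finset.not_nonempty_iff_eq_empty] at h
  have := hS.card ha hb hab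
  rw [h] at this
  have hp : (0 : ℝ) < Ω.card := by exact_mod_cast hne.card_pos
  rw [Finset.card_empty, Nat.cast_zero, mul_zero] at this
  linarith

lemma Swp.prob {Ω : Finset (H → H)} {F : Finset H} (hS : Swp Ω F)
    {a b : H} (ha : a ∈ F) (hb : b ∈ F) (hab : a ≠ b) (Φ : (H → H) → ℝ) :
    avg Ω (fun M => if M a = b then Φ M else 0) = avg (cnd Ω a b) Φ / ((F.card : ℝ) - 1) := by
  unfold avg
  rw [← Finset.sum_filter, ← hS.card ha hb hab, div_div, mul_comm]
  rfl

lemma Swp.cond {Ω : Finset (H → H)} {F : Finset H} (hS : Swp Ω F) {a b : H} :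
    Swp (cnd Ω a b) ((F.erase a).erase b) where
  inv M hM := hS.inv M (Finset.mem_filter.1 hM).1
  maps M hM h hh := by
    obtain ⟨h1, h2⟩ := Finset.mem_filter.1 hM
    simp only [Finset.mem_erase] at hh ⊢
    have hi := hS.inv M h1
    refine ⟨?_, ?_, hS.maps M h1 h hh.2.2⟩
    · intro e
      have : M (M h) = M (M a) := by rw [e, h2]
      rw [hi, hi] at this; exact hh.2.1 this
    · intro e
      have : M (M h) = M a := by rw [e]
      rw [hi, h2] at this; exact hh.1 this
  nofix M hM h hh := by
    simp only [Finset.mem_erase] at hh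
    exact hS.nofix M (Finset.mem_filter.1 hM).1 h hh.2.2
  swap M hM u hu z hz := by
    obtain ⟨h1, h2⟩ := Finset.mem_filter.1 hM
    simp only [Finset.mem_erase] at hu hz
    refine Finset.mem_filter.2 ⟨hS.swap M h1 u hu.2.2 z hz.2.2, ?_⟩
    simp only [cj]
    rw [Equiv.swap_apply_of_ne_of_ne (Ne.symm hu.2.1) (Ne.symm hz.2.1), h2,
      Equiv.swap_apply_of_ne_of_ne (Ne.symm hu.1) (Ne.symm hz.1)]

/-- A system `Ω` which is swappable on `F`, with forced pairs (if any) in `K`. -/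
structure Good (Ω : Finset (H → H)) (F : Finset H) (K : Finset (H × H)) : Prop extends Swp Ω F where
  ne : Ω.Nonempty
  forced : ∀ M ∈ Ω, ∀ u v, u ≠ v → u ∉ F → (u, v) ∉ K → M u ≠ v

lemma Good.mono {Ω : Finset (H → H)} {F : Finset H} {K K' : Finset (H × H)} (hG : Good Ω F K)
    (hK : K ⊆ K') : Good Ω F K' :=
  { hG with forced := fun M hM u v hne hu hv => hG.forced M hM u v hne hu fun h => hv (hK h) }

lemma Good.cond {Ω : Finset (H → H)} {F : Finset H} {K : Finset (H × H)} (hG : Good Ω F K)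
    {a b : H} (ha : a ∈ F) (hb : b ∈ F) (hab : a ≠ b) :
    Good (cnd Ω a b) ((F.erase a).erase b) (insert (a, b) (insert (b, a) K)) where
  toSwp := hG.toSwp.cond
  ne := hG.toSwp.cnd_nonempty ha hb hab hG.ne
  forced M hM u v hne hu hv := by
    obtain ⟨h1, h2⟩ := Finset.mem_filter.1 hM
    have hba : M b = a := by rw [← h2, hG.inv M h1]
    simp only [Finset.mem_insert, not_or, Prod.mk.injEq, not_and] at hv
    simp only [Finset.mem_erase, not_and] at hu
    by_cases e1 : u = a
    · subst e1; rw [h2]; exact fun h => hv.1 rfl h.symm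
    by_cases e2 : u = b
    · subst e2; rw [hba]; exact fun h => hv.2.1 rfl h.symm
    exact hG.forced M h1 u v hne (hu e2 e1) hv.2.2

lemma card_erase2 {F : Finset H} {a b : H} (ha : a ∈ F) (hb : b ∈ F) (hab : a ≠ b) :
    (((F.erase a).erase b).card : ℝ) = F.card - 2 := by
  have h2 := two_le_card ha hb hab
  rw [Finset.card_erase_of_mem (Finset.mem_erase.2 ⟨hab.symm, hb⟩), Finset.card_erase_of_mem ha,
    Nat.sub_sub, Nat.cast_sub h2]; norm_num

lemma Good.pair_le {Ω : Finset (H → H)} {F : Finset H} {K : Finset (H × H)} (hG : Good Ω F K)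
    {u v : H} (hne : u ≠ v) (huv : (u, v) ∉ K) {c : ℝ} (hc : 0 < c) (hcF : c ≤ F.card - 1) (Φ : (H → H) → ℝ)
    {B : ℝ} (hB : 0 ≤ B)
    (h : u ∈ F → v ∈ F → u ≠ v → avg (cnd Ω u v) Φ ≤ B) :
    avg Ω (fun M => if M u = v then Φ M else 0) ≤ B / c := by
  by_cases hh : u ∈ F ∧ v ∈ F ∧ u ≠ v
  · obtain ⟨h1, h2, h3⟩ := hh
    rw [hG.toSwp.prob h1 h2 h3]
    exact div_le_div₀ hB (h h1 h2 h3) hc hcF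
  · have : ∀ M ∈ Ω, M u ≠ v := by
      intro M hM e
      by_cases hu : u ∈ F
      · apply hh
        refine ⟨hu, e ▸ hG.maps M hM u hu, ?_⟩
        rintro rfl; exact hG.nofix M hM u hu e
      · exact hG.forced M hM u v hne hu huv e
    have : avg Ω (fun M => if M u = v then Φ M else 0) = 0 := by
      unfold avg
      rw [Finset.sum_congr rfl (g := fun _ => 0)]
      · simp
      · intro M hM; exact if_neg (this M hM)
    rw [this]; positivity

abbrev Qd (H : Type*) := H × H × H × H

def Xq (q : Qd H) (M : H → H) : Prop := M q.1 = q.2.1 ∧ M q.2.2.1 = q.2.2.2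

noncomputable def xi (q : Qd H) (M : H → H) : ℝ := if Xq q M then 1 else 0

def tch (q : Qd H) (z : H) : Prop := z = q.1 ∨ z = q.2.1 ∨ z = q.2.2.1 ∨ z = q.2.2.2

noncomputable def WJ (J : Finset (Qd H)) (M : H → H) : ℕ := (J.filter (fun q => Xq q M)).card

noncomputable def TJ (J : Finset (Qd H)) (z : H) (M : H → H) : ℕ :=
  (J.filter (fun q => Xq q M ∧ tch q z)).card

lemma WJ_eq (J : Finset (Qd H)) (M : H → H) : (WJ J M : ℝ) = ∑ q ∈ J, xi q M := by
  unfold WJ xi; rw [Finset.card_filter]; push_cast; rfl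

lemma TJ_eq (J : Finset (Qd H)) (z : H) (M : H → H) :
    TJ J z M = WJ (J.filter (fun q => tch q z)) M := by
  unfold TJ WJ; rw [Finset.filter_filter]
  congr 1; ext q; simp [and_comm]

lemma sum_TJ_le (J : Finset (Qd H)) (s : Finset H) (M : H → H) :
    ∑ z ∈ s, TJ J z M ≤ 4 * WJ J M := by
  have e : ∀ z, TJ J z M = ∑ q ∈ J.filter (fun q => Xq q M), if tch q z then 1 else 0 := by
    intro z
    rw [TJ, ← Finset.card_filter, Finset.filter_filter]
  simp_rw [e]
  rw [Finset.sum_comm, WJ, Finset.card_eq_sum_ones, Finset.mul_sum]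
  refine Finset.sum_le_sum fun q _ => ?_
  rw [← Finset.card_filter]
  refine (Finset.card_le_card (t := {q.1, q.2.1, q.2.2.1, q.2.2.2}) ?_).trans ?_
  · intro z hz
    have := (Finset.mem_filter.1 hz).2
    simpa [tch] using this
  · exact Finset.card_le_four.trans (by norm_num)

lemma Xq_of_cj {q : Qd H} {b z : H} {M : H → H} (hX : Xq q (cj b z M)) (hb : ¬ tch q b)
    (hz : ¬ tch q z) : Xq q M := by
  simp only [tch, not_or] at hb hz
  have key : ∀ u v, cj b z M u = v → b ≠ u → z ≠ u → b ≠ v → z ≠ v → M u = v := by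
    intro u v h h1 h2 h3 h4
    simp only [cj] at h
    rw [Equiv.swap_apply_of_ne_of_ne h1.symm h2.symm] at h
    have : M u = Equiv.swap b z v := by rw [← h]; simp
    rwa [Equiv.swap_apply_of_ne_of_ne h3.symm h4.symm] at this
  exact ⟨key _ _ hX.1 hb.1 hz.1 hb.2.1 hz.2.1, key _ _ hX.2 hb.2.2.1 hz.2.2.1 hb.2.2.2 hz.2.2.2⟩

lemma Xq_cj {q : Qd H} {a b : H} {M : H → H} (hi : ∀ h, M (M h) = h) (hX : Xq q M)
    (ha : ¬ tch q a) (hb : ¬ tch q b) : Xq q (cj b (M a) M) := by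
  simp only [tch, not_or] at hb ha
  have key : ∀ u v, M u = v → a ≠ u → b ≠ u → a ≠ v → b ≠ v → cj b (M a) M u = v := by
    intro u v h h1 h2 h3 h4
    have e1 : u ≠ M a := by
      rintro rfl; exact h3 (by rw [← h, hi])
    have e2 : v ≠ M a := by
      intro e; apply h1; rw [← hi a, ← e, ← h, hi]
    simp only [cj]
    rw [Equiv.swap_apply_of_ne_of_ne h2.symm e1, h, Equiv.swap_apply_of_ne_of_ne h4.symm e2]
  exact ⟨key _ _ hX.1 ha.1 hb.1 ha.2.1 hb.2.1, key _ _ hX.2 ha.2.2.1 hb.2.2.1 ha.2.2.2 hb.2.2.2⟩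

lemma pow_diff_le {s : ℝ} (h0 : 0 ≤ s) (h1 : s ≤ 1) (m n : ℕ) : |s ^ m - s ^ n| ≤ 1 := by
  have a1 := pow_nonneg h0 m
  have a2 := pow_nonneg h0 n
  have b1 := pow_le_one₀ h0 h1 (n := m)
  have b2 := pow_le_one₀ h0 h1 (n := n)
  rw [abs_le]; constructor <;> linarith

lemma coupling_diff {J : Finset (Qd H)} {a b : H} {M : H → H} (hi : ∀ h, M (M h) = h) {s : ℝ}
    (h0 : 0 ≤ s) (h1 : s ≤ 1) :
    |s ^ WJ J (cj b (M a) M) - s ^ WJ J M| ≤ (TJ J a M + TJ J b M : ℝ)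
      + (TJ J b (cj b (M a) M) + TJ J (M a) (cj b (M a) M) : ℝ) := by
  set S := (TJ J a M + TJ J b M) + (TJ J b (cj b (M a) M) + TJ J (M a) (cj b (M a) M)) with hS
  have : (TJ J a M + TJ J b M : ℝ)
      + (TJ J b (cj b (M a) M) + TJ J (M a) (cj b (M a) M) : ℝ) = (S : ℝ) := by
    rw [hS]; push_cast; ring
  rw [this]
  rcases Nat.eq_zero_or_pos S with h | h
  · have g1 : TJ J a M = 0 := by omega
    have g2 : TJ J b M = 0 := by omega
    have g3 : TJ J b (cj b (M a) M) = 0 := by omega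
    have g4 : TJ J (M a) (cj b (M a) M) = 0 := by omega
    rw [TJ, Finset.card_eq_zero, Finset.filter_eq_empty_iff] at g1 g2 g3 g4
    have : WJ J (cj b (M a) M) = WJ J M := by
      unfold WJ
      congr 1
      refine Finset.filter_congr fun q hq => ⟨fun hX => ?_, fun hX => ?_⟩
      · exact Xq_of_cj hX (fun ht => g3 hq ⟨hX, ht⟩) (fun ht => g4 hq ⟨hX, ht⟩)
      · exact Xq_cj hi hX (fun ht => g1 hq ⟨hX, ht⟩) (fun ht => g2 hq ⟨hX, ht⟩)
    rw [this, sub_self, abs_zero]; positivity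
  · exact (pow_diff_le h0 h1 _ _).trans (by exact_mod_cast h)

lemma Swp.step {Ω : Finset (H → H)} {F : Finset H} (hS : Swp Ω F) {a b : H} (ha : a ∈ F)
    (hb : b ∈ F) (hab : a ≠ b) (J : Finset (Qd H)) {s : ℝ} (h0 : 0 ≤ s) (h1 : s ≤ 1)
    {τ Λ c : ℝ} (hc : 0 < c) (hcF : c ≤ F.card - 1)
    (t1 : avg Ω (fun M => (TJ J a M : ℝ)) ≤ τ) (t2 : avg Ω (fun M => (TJ J b M : ℝ)) ≤ τ)
    (t3 : avg (cnd Ω a b) (fun M => (TJ J b M : ℝ)) ≤ τ)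
    (t4 : avg (cnd Ω a b) (fun M => (WJ J M : ℝ)) ≤ Λ) :
    |avg (cnd Ω a b) (fun M => s ^ WJ J M) - avg Ω (fun M => s ^ WJ J M)|
      ≤ 3 * τ + 4 * Λ / c := by
  rw [hS.avg_cnd ha hb hab, ← avg_sub]
  refine (abs_avg_le _ _).trans ?_
  refine (avg_mono (Ψ := fun M => (TJ J a M + TJ J b M : ℝ)
      + (TJ J b (cj b (M a) M) + TJ J (M a) (cj b (M a) M) : ℝ)) ?_).trans ?_
  · intro M hM; exact coupling_diff (hS.inv M hM) h0 h1
  rw [avg_add, avg_add, avg_add, ← hS.avg_cnd ha hb hab (fun M => (TJ J b M : ℝ)),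
    hS.avg_cnd2 ha hb hab (fun M z => (TJ J z M : ℝ))]
  have : avg (cnd Ω a b) (fun M => ∑ z ∈ F.erase a, (TJ J z M : ℝ)) / ((F.card : ℝ) - 1)
      ≤ 4 * Λ / c := by
    have h4 : avg (cnd Ω a b) (fun M => ∑ z ∈ F.erase a, (TJ J z M : ℝ)) ≤ 4 * Λ := by
      refine (avg_mono (Ψ := fun M => 4 * (WJ J M : ℝ)) ?_).trans ?_
      · intro M _; exact_mod_cast sum_TJ_le J (F.erase a) M
      · rw [avg_mul]; linarith
    have h5 : 0 ≤ avg (cnd Ω a b) (fun M => ∑ z ∈ F.erase a, (TJ J z M : ℝ)) :=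
      avg_nonneg fun M _ => Finset.sum_nonneg fun z _ => by positivity
    exact div_le_div₀ (h5.trans h4) h4 hc hcF
  linarith

end MS

section EV
variable {H : Type*} [DecidableEq H] [Fintype H]

noncomputable def Kq (r : Qd H) : Finset (H × H) :=
  {(r.1, r.2.1), (r.2.1, r.1), (r.2.2.1, r.2.2.2), (r.2.2.2, r.2.2.1)}

/-- A system of simple (`I1`) and double (`I2`) events on matchings. -/
structure Evs (F : Finset H) (I1 I2 : Finset (Qd H)) (b1 b2 b11 : ℕ) : Prop where
  typ1 : ∀ q ∈ I1, q.2.2.1 = q.1 ∧ q.2.2.2 = q.2.1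
  mem1 : ∀ q ∈ I1, q.1 ∈ F ∧ q.2.1 ∈ F ∧ q.1 ≠ q.2.1
  mem2 : ∀ q ∈ I2, q.1 ∈ F ∧ q.2.1 ∈ F ∧ q.1 ≠ q.2.1
  mem2' : ∀ q ∈ I2, q.2.2.1 ∈ F ∧ q.2.2.2 ∈ F ∧ q.2.2.1 ≠ q.2.2.2
  dj : ∀ q ∈ I2, q.2.2.1 ≠ q.1 ∧ q.2.2.1 ≠ q.2.1 ∧ q.2.2.2 ≠ q.1 ∧ q.2.2.2 ≠ q.2.1
  canon : ∀ q ∈ I1 ∪ I2, ∀ r ∈ I1 ∪ I2, (q.1, q.2.1) ∈ Kq r → (q.2.2.1, q.2.2.2) ∈ Kq r → q = r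
  tch1 : ∀ z, (I1.filter (fun q => tch q z)).card ≤ b1
  tch2 : ∀ z, (I2.filter (fun q => tch q z)).card ≤ b2
  prs : ∀ u v, (I2.filter (fun q => (q.1 = u ∧ q.2.1 = v) ∨ (q.2.2.1 = u ∧ q.2.2.2 = v))).card ≤ b11

variable {F : Finset H} {I1 I2 : Finset (Qd H)} {b1 b2 b11 : ℕ}

lemma Evs.disj (hE : Evs F I1 I2 b1 b2 b11) : Disjoint I1 I2 := by
  rw [Finset.disjoint_left]
  intro q h1 h2
  exact (hE.dj q h2).1 (hE.typ1 q h1).1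

lemma xi_eq (q : Qd H) (M : H → H) :
    xi q M = if M q.1 = q.2.1 then (if M q.2.2.1 = q.2.2.2 then 1 else 0) else 0 := by
  unfold xi Xq
  by_cases h1 : M q.1 = q.2.1 <;> by_cases h2 : M q.2.2.1 = q.2.2.2 <;> simp [h1, h2]

lemma Evs.bound (hE : Evs F I1 I2 b1 b2 b11) {r : Qd H} (hr : r ∈ I1 ∪ I2) {N : ℝ} (hN7 : 7 < N)
    {Ω : Finset (H → H)} {F' : Finset H} (hG : Good Ω F' (Kq r)) (hF' : N - 4 ≤ F'.card)
    {S1 S2 : Finset (Qd H)} (hS1 : S1 ⊆ I1) (hS2 : S2 ⊆ I2) (hr1 : r ∉ S1) (hr2 : r ∉ S2) :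
    avg Ω (fun M => (WJ (S1 ∪ S2) M : ℝ))
      ≤ (S1.card + 4 * b11) / (N - 5) + S2.card / ((N - 5) * (N - 7)) := by
  have p5 : 0 < N - 5 := by linarith
  have p7 : 0 < N - 7 := by linarith
  simp_rw [WJ_eq]
  rw [avg_sum, Finset.sum_union (hE.disj.mono hS1 hS2)]
  have g1 : ∀ q ∈ S1, avg Ω (xi q) ≤ 1 / (N - 5) := by
    intro q hq
    have hq1 := hS1 hq
    have ht := hE.typ1 q hq1
    have hne : q ≠ r := fun e => hr1 (e ▸ hq)
    have hK : (q.1, q.2.1) ∉ Kq r := fun h =>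
      hne (hE.canon q (Finset.mem_union_left _ hq1) r hr h (by rw [ht.1, ht.2]; exact h))
    have := hG.pair_le (hE.mem1 q hq1).2.2 hK p5 (by linarith) (fun _ => 1) zero_le_one
      (fun a b c => (avg_const (hG.toSwp.cnd_nonempty a b c hG.ne) 1).le)
    refine le_trans (le_of_eq ?_) this
    congr 1; funext M
    rw [xi_eq, ht.1, ht.2]
    split_ifs <;> rfl
  have g2 : ∀ q ∈ S2, avg Ω (xi q) ≤ 1 / ((N - 5) * (N - 7))
      + (if (q.1, q.2.1) ∈ Kq r ∨ (q.2.2.1, q.2.2.2) ∈ Kq r then 1 else 0) * (1 / (N - 5)) := by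
    intro q hq
    have hq2 := hS2 hq
    have hne : q ≠ r := fun e => hr2 (e ▸ hq)
    have hd := hE.dj q hq2
    have hcan := hE.canon q (Finset.mem_union_right _ hq2) r hr
    have pp : 0 ≤ 1 / ((N - 5) * (N - 7)) := by positivity
    by_cases k1 : (q.1, q.2.1) ∈ Kq r
    · have k2 : (q.2.2.1, q.2.2.2) ∉ Kq r := fun h => hne (hcan k1 h)
      rw [if_pos (Or.inl k1)]
      have := hG.pair_le (hE.mem2' q hq2).2.2 k2 p5 (by linarith) (fun _ => 1) zero_le_one
        (fun a b c => (avg_const (hG.toSwp.cnd_nonempty a b c hG.ne) 1).le)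
      have h2 : avg Ω (xi q) ≤ avg Ω (fun M => if M q.2.2.1 = q.2.2.2 then 1 else 0) := by
        refine avg_mono fun M _ => ?_
        rw [xi_eq]; split_ifs <;> simp
      linarith
    · by_cases k2 : (q.2.2.1, q.2.2.2) ∈ Kq r
      · rw [if_pos (Or.inr k2)]
        have := hG.pair_le (hE.mem2 q hq2).2.2 k1 p5 (by linarith) (fun _ => 1) zero_le_one
          (fun a b c => (avg_const (hG.toSwp.cnd_nonempty a b c hG.ne) 1).le)
        have h2 : avg Ω (xi q) ≤ avg Ω (fun M => if M q.1 = q.2.1 then 1 else 0) := by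
          refine avg_mono fun M _ => ?_
          rw [xi_eq]; split_ifs <;> simp
        linarith
      · rw [if_neg (by tauto), zero_mul, add_zero]
        have := hG.pair_le (hE.mem2 q hq2).2.2 k1 p5 (by linarith)
          (fun M => if M q.2.2.1 = q.2.2.2 then 1 else 0) (B := 1 / (N - 7)) (by positivity) ?_
        · have e : (1 / (N - 7)) / (N - 5) = 1 / ((N - 5) * (N - 7)) := by
            rw [div_div, mul_comm]
          rw [← e]
          refine le_trans (le_of_eq ?_) this
          congr 1; funext M; rw [xi_eq]
        · intro a b c
          have hG2 := hG.cond a b c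
          refine hG2.pair_le (hE.mem2' q hq2).2.2 ?_ p7 ?_ (fun _ => 1) zero_le_one
            (fun a b c => (avg_const (hG2.toSwp.cnd_nonempty a b c hG2.ne) 1).le)
          · simp only [Finset.mem_insert, Prod.mk.injEq, not_or]
            exact ⟨fun h => hd.1 h.1, fun h => hd.2.1 h.1, k2⟩
          · rw [card_erase2 a b c]; linarith
  have c2 : ((S2.filter (fun q => (q.1, q.2.1) ∈ Kq r ∨ (q.2.2.1, q.2.2.2) ∈ Kq r)).card : ℝ)
      ≤ 4 * b11 := by
    have : S2.filter (fun q => (q.1, q.2.1) ∈ Kq r ∨ (q.2.2.1, q.2.2.2) ∈ Kq r)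
        ⊆ (Kq r).biUnion (fun p => I2.filter
          (fun q => (q.1 = p.1 ∧ q.2.1 = p.2) ∨ (q.2.2.1 = p.1 ∧ q.2.2.2 = p.2))) := by
      intro q hq
      obtain ⟨h1, h2⟩ := Finset.mem_filter.1 hq
      rw [Finset.mem_biUnion]
      rcases h2 with h2 | h2
      · exact ⟨_, h2, Finset.mem_filter.2 ⟨hS2 h1, Or.inl ⟨rfl, rfl⟩⟩⟩
      · exact ⟨_, h2, Finset.mem_filter.2 ⟨hS2 h1, Or.inr ⟨rfl, rfl⟩⟩⟩
    have h3 := (Finset.card_le_card this).trans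
      (Finset.card_biUnion_le_card_mul _ _ b11 fun p _ => hE.prs p.1 p.2)
    have h4 : (Kq r).card ≤ 4 := Finset.card_le_four
    have h5 := h3.trans (Nat.mul_le_mul_right b11 h4)
    exact_mod_cast h5
  have s1 := Finset.sum_le_sum g1
  have s2 := Finset.sum_le_sum g2
  rw [Finset.sum_const, nsmul_eq_mul] at s1
  rw [Finset.sum_add_distrib, Finset.sum_const, nsmul_eq_mul, ← Finset.sum_mul,
    Finset.sum_boole] at s2
  have s3 := mul_le_mul_of_nonneg_right c2 (by positivity : 0 ≤ 1 / (N - 5))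
  have : (S1.card + 4 * b11) / (N - 5) + S2.card / ((N - 5) * (N - 7))
      = S1.card * (1 / (N - 5)) + (S2.card * (1 / ((N - 5) * (N - 7)))
        + 4 * b11 * (1 / (N - 5))) := by ring
  rw [this]
  linarith

lemma Evs.prob1 (hE : Evs F I1 I2 b1 b2 b11) {Ω : Finset (H → H)} (hG : Good Ω F ∅)
    {q : Qd H} (hq : q ∈ I1) (Φ : (H → H) → ℝ) :
    avg Ω (fun M => xi q M * Φ M) = avg (cnd Ω q.1 q.2.1) Φ * (1 / ((F.card : ℝ) - 1)) := by
  obtain ⟨h1, h2, h3⟩ := hE.mem1 q hq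
  have ht := hE.typ1 q hq
  have := hG.toSwp.prob h1 h2 h3 Φ
  rw [mul_one_div, ← this]
  congr 1; funext M; rw [xi_eq, ht.1, ht.2]; split_ifs <;> simp

lemma Evs.prob2 (hE : Evs F I1 I2 b1 b2 b11) {Ω : Finset (H → H)} (hG : Good Ω F ∅)
    {q : Qd H} (hq : q ∈ I2) (Φ : (H → H) → ℝ) :
    avg Ω (fun M => xi q M * Φ M) = avg (cnd (cnd Ω q.1 q.2.1) q.2.2.1 q.2.2.2) Φ
      * (1 / (((F.card : ℝ) - 1) * (F.card - 3))) := by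
  obtain ⟨h1, h2, h3⟩ := hE.mem2 q hq
  obtain ⟨h4, h5, h6⟩ := hE.mem2' q hq
  have hd := hE.dj q hq
  have hG2 := hG.cond h1 h2 h3
  have e1 := hG.toSwp.prob h1 h2 h3 (fun M => if M q.2.2.1 = q.2.2.2 then Φ M else 0)
  have e2 := hG2.toSwp.prob (a := q.2.2.1) (b := q.2.2.2) (by simp [hd, h4]) (by simp [hd, h5]) h6 Φ
  rw [card_erase2 h1 h2 h3] at e2
  rw [e2] at e1
  have : avg Ω (fun M => xi q M * Φ M)
      = avg Ω (fun M => if M q.1 = q.2.1 then (if M q.2.2.1 = q.2.2.2 then Φ M else 0) else 0) := by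
    congr 1; funext M; rw [xi_eq]; split_ifs <;> simp
  rw [this, e1, div_div, mul_one_div]
  congr 1; ring

lemma four_le (hE : Evs F I1 I2 b1 b2 b11) {q : Qd H} (hq : q ∈ I2) : 4 ≤ F.card := by
  obtain ⟨h1, h2, h3⟩ := hE.mem2 q hq
  obtain ⟨h4, h5, h6⟩ := hE.mem2' q hq
  have hd := hE.dj q hq
  have : ({q.1, q.2.1, q.2.2.1, q.2.2.2} : Finset H).card = 4 := by
    rw [Finset.card_insert_of_notMem, Finset.card_insert_of_notMem, Finset.card_pair h6]
    · simp [hd.2.1.symm, hd.2.2.2.symm]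
    · simp [hd.1.symm, hd.2.2.1.symm, h3]
  rw [← this]
  apply Finset.card_le_card
  intro x hx
  simp only [Finset.mem_insert, Finset.mem_singleton] at hx
  rcases hx with rfl | rfl | rfl | rfl <;> assumption

noncomputable def lam (N n1 n2 : ℝ) : ℝ := n1 / (N - 1) + n2 / ((N - 1) * (N - 3))

noncomputable def pq (F : Finset H) (I1 : Finset (Qd H)) (q : Qd H) : ℝ :=
  if q ∈ I1 then 1 / ((F.card : ℝ) - 1) else 1 / (((F.card : ℝ) - 1) * (F.card - 3))

lemma Evs.sum_pq (hE : Evs F I1 I2 b1 b2 b11) :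
    ∑ q ∈ I1 ∪ I2, pq F I1 q = lam F.card I1.card I2.card := by
  rw [Finset.sum_union hE.disj, Finset.sum_congr rfl (g := fun _ => 1 / ((F.card : ℝ) - 1)),
    Finset.sum_congr (s₁ := I2) rfl (g := fun _ => 1 / (((F.card : ℝ) - 1) * (F.card - 3)))]
  · simp only [Finset.sum_const, nsmul_eq_mul, lam, mul_one_div]
  · intro q hq; exact if_neg (Finset.disjoint_right.1 hE.disj hq)
  · intro q hq; exact if_pos hq

lemma Evs.mean (hE : Evs F I1 I2 b1 b2 b11) {Ω : Finset (H → H)} (hG : Good Ω F ∅) :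
    avg Ω (fun M => (WJ (I1 ∪ I2) M : ℝ)) = lam F.card I1.card I2.card := by
  simp_rw [WJ_eq]
  rw [avg_sum, ← hE.sum_pq]
  refine Finset.sum_congr rfl fun q hq => ?_
  unfold pq
  split_ifs with h
  · have := hE.prob1 hG h (fun _ => 1)
    obtain ⟨h1, h2, h3⟩ := hE.mem1 q h
    rw [avg_const (hG.toSwp.cnd_nonempty h1 h2 h3 hG.ne), one_mul] at this
    simpa using this
  · have hq2 : q ∈ I2 := (Finset.mem_union.1 hq).resolve_left h
    have := hE.prob2 hG hq2 (fun _ => 1)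
    obtain ⟨h1, h2, h3⟩ := hE.mem2 q hq2
    obtain ⟨h4, h5, h6⟩ := hE.mem2' q hq2
    have hd := hE.dj q hq2
    have hG2 := hG.cond h1 h2 h3
    rw [avg_const (hG2.toSwp.cnd_nonempty (by simp [hd, h4]) (by simp [hd, h5]) h6 hG2.ne),
      one_mul] at this
    simpa using this

/-- first moment bound -/
lemma Evs.union (hE : Evs F I1 I2 b1 b2 b11) {Ω : Finset (H → H)} (hG : Good Ω F ∅) :
    1 - lam F.card I1.card I2.card
      ≤ avg Ω (fun M => if WJ (I1 ∪ I2) M = 0 then 1 else 0) := by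
  rw [← hE.mean hG]
  have e1 : avg Ω (fun M => (1 : ℝ) - (WJ (I1 ∪ I2) M : ℝ))
      = 1 - avg Ω (fun M => (WJ (I1 ∪ I2) M : ℝ)) := by
    rw [avg_sub, avg_const hG.ne]
  rw [← e1]
  refine avg_mono fun M _ => ?_
  split_ifs with h
  · rw [h]; simp
  · have : (1 : ℝ) ≤ WJ (I1 ∪ I2) M := by exact_mod_cast Nat.pos_of_ne_zero h
    linarith

lemma ode_bound {ψ ψ' : ℝ → ℝ} {l err : ℝ} (hl : 0 ≤ l) (hd : ∀ s, HasDerivAt ψ (ψ' s) s)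
    (he : ∀ s, 0 ≤ s → s ≤ 1 → |ψ' s - l * ψ s| ≤ err) (h1 : ψ 1 = 1) :
    |ψ 0 - Real.exp (-l)| ≤ err := by
  have hg : ∀ s ∈ Set.Icc (0 : ℝ) 1, HasDerivWithinAt (fun s => ψ s * Real.exp (-l * s))
      (ψ' s * Real.exp (-l * s) + ψ s * (Real.exp (-l * s) * (-l * 1))) (Set.Icc 0 1) s := by
    intro s _
    exact ((hd s).mul (((hasDerivAt_id s).const_mul (-l)).exp)).hasDerivWithinAt
  have hb : ∀ s ∈ Set.Ico (0 : ℝ) 1,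
      ‖ψ' s * Real.exp (-l * s) + ψ s * (Real.exp (-l * s) * (-l * 1))‖ ≤ err := by
    intro s hs
    have e : ψ' s * Real.exp (-l * s) + ψ s * (Real.exp (-l * s) * (-l * 1))
        = (ψ' s - l * ψ s) * Real.exp (-l * s) := by ring
    rw [e, Real.norm_eq_abs, abs_mul, Real.abs_exp]
    have h3 : Real.exp (-l * s) ≤ 1 := by
      rw [Real.exp_le_one_iff]; nlinarith [hs.1]
    have h4 := he s hs.1 hs.2.le
    calc _ ≤ |ψ' s - l * ψ s| * 1 := mul_le_mul_of_nonneg_left h3 (abs_nonneg _)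
      _ ≤ err := by linarith
  have := norm_image_sub_le_of_norm_deriv_le_segment_01' hg hb
  rw [Real.norm_eq_abs, abs_sub_comm] at this
  simpa [h1] using this

lemma xi_pow (I : Finset (Qd H)) (s : ℝ) (M : H → H) :
    (WJ I M : ℝ) * s ^ (WJ I M - 1) = ∑ q ∈ I, xi q M * s ^ WJ (I.erase q) M := by
  have : ∀ q ∈ I, xi q M * s ^ WJ (I.erase q) M = xi q M * s ^ (WJ I M - 1) := by
    intro q hq
    unfold xi
    split_ifs with h
    · congr 2
      unfold WJ
      rw [← Finset.card_erase_of_mem (Finset.mem_filter.2 ⟨hq, h⟩)]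
      congr 1
      ext x; simp; tauto
    · simp
  rw [Finset.sum_congr rfl this, ← Finset.sum_mul, ← WJ_eq]

theorem Evs.poisson (hE : Evs F I1 I2 b1 b2 b11) {Ω : Finset (H → H)} (hG : Good Ω F ∅)
    {N : ℝ} (hN : N = F.card) (hN7 : 7 < N) {τ Λ : ℝ}
    (hτ : τ = (b1 + 4 * b11) / (N - 5) + b2 / ((N - 5) * (N - 7)))
    (hΛ : Λ = (I1.card + 4 * b11) / (N - 5) + I2.card / ((N - 5) * (N - 7))) :
    |avg Ω (fun M => if WJ (I1 ∪ I2) M = 0 then 1 else 0) - Real.exp (-lam N I1.card I2.card)|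
      ≤ lam N I1.card I2.card * (1 / (N - 1) + 2 * (3 * τ + 4 * Λ / (N - 5))) := by
  have p5 : 0 < N - 5 := by linarith
  have p7 : 0 < N - 7 := by linarith
  have p1 : 0 < N - 1 := by linarith
  have p3 : 0 < N - 3 := by linarith
  have hl0 : 0 ≤ lam N I1.card I2.card := by unfold lam; positivity
  set I := I1 ∪ I2 with hI
  have hψ0 : avg Ω (fun M => if WJ I M = 0 then 1 else 0) = avg Ω (fun M => (0 : ℝ) ^ WJ I M) := by
    congr 1; funext M; rw [zero_pow_eq]
  rw [hψ0]
  have hpq0 : ∀ q, 0 ≤ pq F I1 q := by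
    intro q; unfold pq; rw [← hN]; split_ifs <;> positivity
  -- the conditional systems
  have main : ∀ q ∈ I, ∀ s : ℝ, 0 ≤ s → s ≤ 1 →
      |avg Ω (fun M => xi q M * s ^ WJ (I.erase q) M) - pq F I1 q * avg Ω (fun M => s ^ WJ I M)|
        ≤ pq F I1 q * (1 / (N - 1) + 2 * (3 * τ + 4 * Λ / (N - 5))) := by
    intro q hq s hs0 hs1
    have hsub : I.erase q = (I1.erase q) ∪ (I2.erase q) := by rw [hI, Finset.erase_union_distrib]
    have bW : ∀ (Ω' : Finset (H → H)) (F' : Finset H), Good Ω' F' (Kq q) → N - 4 ≤ F'.card →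
        avg Ω' (fun M => (WJ (I.erase q) M : ℝ)) ≤ Λ := by
      intro Ω' F' hG' hF'
      rw [hsub, hΛ]
      refine (hE.bound hq hN7 hG' hF' (Finset.erase_subset _ _) (Finset.erase_subset _ _)
        (Finset.notMem_erase _ _) (Finset.notMem_erase _ _)).trans ?_
      have := Finset.card_le_card (Finset.erase_subset q I1)
      have := Finset.card_le_card (Finset.erase_subset q I2)
      gcongr
    have bT : ∀ (Ω' : Finset (H → H)) (F' : Finset H), Good Ω' F' (Kq q) → N - 4 ≤ F'.card →
        ∀ z, avg Ω' (fun M => (TJ (I.erase q) z M : ℝ)) ≤ τ := by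
      intro Ω' F' hG' hF' z
      simp_rw [TJ_eq]
      rw [hsub, hτ, Finset.filter_union]
      refine (hE.bound hq hN7 hG' hF' (S1 := (I1.erase q).filter (fun q => tch q z))
        (S2 := (I2.erase q).filter (fun q => tch q z))
        ((Finset.filter_subset _ _).trans (Finset.erase_subset _ _))
        ((Finset.filter_subset _ _).trans (Finset.erase_subset _ _))
        (by simp) (by simp)).trans ?_
      have a1 := (Finset.card_le_card (Finset.filter_subset_filter (fun q => tch q z)
        (Finset.erase_subset q I1))).trans (hE.tch1 z)
      have a2 := (Finset.card_le_card (Finset.filter_subset_filter (fun q => tch q z)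
        (Finset.erase_subset q I2))).trans (hE.tch2 z)
      gcongr
    have hG0 : Good Ω F (Kq q) := hG.mono (Finset.empty_subset _)
    have hΛτ : 0 ≤ 3 * τ + 4 * Λ / (N - 5) := by
      have : 0 ≤ τ := by rw [hτ]; positivity
      have : 0 ≤ Λ := by rw [hΛ]; positivity
      positivity
    -- one conditioning
    have fin : ∀ A : ℝ, avg Ω (fun M => xi q M * s ^ WJ (I.erase q) M) = A * pq F I1 q →
        |A - avg Ω (fun M => s ^ WJ (I.erase q) M)| ≤ 2 * (3 * τ + 4 * Λ / (N - 5)) →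
        avg Ω (fun M => xi q M) ≤ 1 / (N - 1) →
        |avg Ω (fun M => xi q M * s ^ WJ (I.erase q) M) - pq F I1 q * avg Ω (fun M => s ^ WJ I M)|
        ≤ pq F I1 q * (1 / (N - 1) + 2 * (3 * τ + 4 * Λ / (N - 5))) := by
      intro A h1 h2 h3
      have h4 : |avg Ω (fun M => s ^ WJ (I.erase q) M) - avg Ω (fun M => s ^ WJ I M)|
          ≤ 1 / (N - 1) := by
        refine le_trans ?_ h3
        rw [← avg_sub]
        refine (abs_avg_le _ _).trans (avg_mono fun M _ => ?_)
        unfold xi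
        split_ifs with hX
        · exact pow_diff_le hs0 hs1 _ _
        · have : WJ (I.erase q) M = WJ I M := by
            unfold WJ
            congr 1
            ext x
            simp only [Finset.mem_filter, Finset.mem_erase]
            constructor
            · rintro ⟨⟨_, h⟩, h'⟩; exact ⟨h, h'⟩
            · rintro ⟨h, h'⟩; exact ⟨⟨fun e => hX (e ▸ h'), h⟩, h'⟩
          rw [this]; simp
      rw [h1, mul_comm A, ← mul_sub, abs_mul, abs_of_nonneg (hpq0 q)]
      refine mul_le_mul_of_nonneg_left ?_ (hpq0 q)
      have := abs_sub_le A (avg Ω (fun M => s ^ WJ (I.erase q) M)) (avg Ω (fun M => s ^ WJ I M))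
      linarith
    by_cases hq1 : q ∈ I1
    · obtain ⟨h1, h2, h3⟩ := hE.mem1 q hq1
      have ht := hE.typ1 q hq1
      have hG1 : Good (cnd Ω q.1 q.2.1) ((F.erase q.1).erase q.2.1) (Kq q) := by
        refine (hG.cond h1 h2 h3).mono ?_
        intro p hp
        simp only [Kq, Finset.mem_insert, Finset.mem_singleton] at hp ⊢
        simp at hp
        tauto
      have hc1 := card_erase2 h1 h2 h3
      refine fin (avg (cnd Ω q.1 q.2.1) (fun M => s ^ WJ (I.erase q) M)) ?_ ?_ ?_
      · rw [hE.prob1 hG hq1, pq, if_pos hq1]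
      · have := hG.toSwp.step h1 h2 h3 (I.erase q) hs0 hs1 (τ := τ) (Λ := Λ) p5 (by linarith)
          (bT _ _ hG0 (by linarith) _) (bT _ _ hG0 (by linarith) _)
          (bT _ _ hG1 (by linarith) _) (bW _ _ hG1 (by linarith))
        linarith
      · have := hE.prob1 hG hq1 (fun _ => 1)
        rw [avg_const hG1.ne, one_mul, ← hN] at this
        simp only [mul_one] at this
        exact this.le
    · have hq2 : q ∈ I2 := (Finset.mem_union.1 hq).resolve_left hq1
      obtain ⟨h1, h2, h3⟩ := hE.mem2 q hq2
      obtain ⟨h4, h5, h6⟩ := hE.mem2' q hq2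
      have hd := hE.dj q hq2
      have m4 : q.2.2.1 ∈ (F.erase q.1).erase q.2.1 := by simp [hd, h4]
      have m5 : q.2.2.2 ∈ (F.erase q.1).erase q.2.1 := by simp [hd, h5]
      have hGa := hG.cond h1 h2 h3
      have hGb := hGa.cond m4 m5 h6
      have hG1 : Good (cnd Ω q.1 q.2.1) ((F.erase q.1).erase q.2.1) (Kq q) := by
        refine hGa.mono ?_
        intro p hp
        simp only [Kq, Finset.mem_insert, Finset.mem_singleton] at hp ⊢
        simp at hp
        tauto
      have hG2 := hGb.mono (K' := Kq q) (by
        intro p hp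
        simp only [Kq, Finset.mem_insert, Finset.mem_singleton] at hp ⊢
        simp at hp
        tauto)
      have hc1 := card_erase2 h1 h2 h3
      have hc2 := card_erase2 m4 m5 h6
      refine fin (avg (cnd (cnd Ω q.1 q.2.1) q.2.2.1 q.2.2.2)
        (fun M => s ^ WJ (I.erase q) M)) ?_ ?_ ?_
      · rw [hE.prob2 hG hq2, pq, if_neg hq1]
      · have e1 := hG.toSwp.step h1 h2 h3 (I.erase q) hs0 hs1 (τ := τ) (Λ := Λ) p5 (by linarith)
          (bT _ _ hG0 (by linarith) _) (bT _ _ hG0 (by linarith) _)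
          (bT _ _ hG1 (by linarith) _) (bW _ _ hG1 (by linarith))
        have e2 := hG1.toSwp.step m4 m5 h6 (I.erase q) hs0 hs1 (τ := τ) (Λ := Λ) p5 (by linarith)
          (bT _ _ hG1 (by linarith) _) (bT _ _ hG1 (by linarith) _)
          (bT _ _ hG2 (by linarith) _) (bW _ _ hG2 (by linarith))
        have := abs_sub_le (avg (cnd (cnd Ω q.1 q.2.1) q.2.2.1 q.2.2.2)
          (fun M => s ^ WJ (I.erase q) M)) (avg (cnd Ω q.1 q.2.1) (fun M => s ^ WJ (I.erase q) M))
          (avg Ω (fun M => s ^ WJ (I.erase q) M))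
        linarith
      · have := hE.prob2 hG hq2 (fun _ => 1)
        rw [avg_const hG2.ne, one_mul, ← hN] at this
        simp only [mul_one] at this
        rw [this]
        apply one_div_le_one_div_of_le p1
        nlinarith
  refine ode_bound (ψ := fun s => avg Ω (fun M => s ^ WJ I M))
    (ψ' := fun s => avg Ω (fun M => (WJ I M : ℝ) * s ^ (WJ I M - 1))) hl0 ?_ ?_ ?_
  · intro s
    unfold avg
    refine HasDerivAt.div_const ?_ _
    exact HasDerivAt.fun_sum fun M _ => hasDerivAt_pow _ _
  · intro s hs0 hs1
    simp only [xi_pow]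
    rw [avg_sum, hN, ← hE.sum_pq, Finset.sum_mul, ← Finset.sum_sub_distrib, Finset.sum_mul, ← hN]
    exact (Finset.abs_sum_le_sum_abs _ _).trans
      (Finset.sum_le_sum fun q hq => main q hq s hs0 hs1)
  · simp only [one_pow]
    exact avg_const hG.ne 1

end EV

/-! ### Part 5: structure of execution paths -/

section EX
variable {n : ℕ} {d : Fin n → ℕ}

def Rv (E : Path d) (k : Fin (n - 1)) : Fin n := (E k).1.1
def wv (E : Path d) (k : Fin (n - 1)) : Fin n := (E k).2.1

lemma HE_ext {h h' : HE d} (h1 : h.1 = h'.1) (h2 : (h.2 : ℕ) = h'.2) : h = h' := by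
  obtain ⟨i, j⟩ := h
  obtain ⟨i', j'⟩ := h'
  dsimp at h1 h2
  subst h1
  congr 1; exact Fin.ext h2

lemma rootHE_ext {h h' : HE d} (hr : IsRootHE d h) (hr' : IsRootHE d h') (h1 : h.1 = h'.1) :
    h = h' := by
  refine HE_ext h1 ?_
  unfold IsRootHE at hr hr'
  rw [hr, hr', h1]

lemma SameTree.symm' {E : Path d} {k : Fin (n - 1)} {a b : Fin n} (h : SameTree E k a b) :
    SameTree E k b a := by
  unfold SameTree at h ⊢
  induction h with
  | refl => exact Relation.ReflTransGen.refl
  | tail _ hs ih =>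
    refine Relation.ReflTransGen.head ?_ ih
    obtain ⟨j, hj, h | h⟩ := hs
    · exact ⟨j, hj, Or.inr h⟩
    · exact ⟨j, hj, Or.inl h⟩

theorem exec_iff (E : Path d) : IsExecPath d E ↔
    (∀ k, IsRootHE d (E k).1 ∧ IsNonRootHE d (E k).2) ∧ Function.Injective (fun k => (E k).2) ∧
      VOn (wv E) Finset.univ (Rv E) := by
  constructor
  · intro hE
    refine ⟨fun k => ⟨(hE k).1, (hE k).2.1⟩, ?_, ?_⟩
    · intro j k hjk
      by_contra hne
      rcases lt_or_gt_of_ne hne with h | h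
      · exact (hE k).2.2.2.1 j h hjk
      · exact (hE j).2.2.2.1 k h hjk.symm
    · have key : ∀ m : ℕ, VOn (wv E) (Finset.univ.filter (fun k : Fin (n - 1) => (k : ℕ) < m))
          (Rv E) := by
        intro m
        induction m with
        | zero =>
          refine ⟨by intro a ha; simp at ha, fun _ => 0, by simp⟩
        | succ m ih =>
          by_cases hm : m < n - 1
          · have e : Finset.univ.filter (fun k : Fin (n - 1) => (k : ℕ) < m + 1)
                = insert ⟨m, hm⟩ (Finset.univ.filter (fun k : Fin (n - 1) => (k : ℕ) < m)) := by
              ext k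
              simp only [Finset.mem_filter, Finset.mem_univ, true_and, Finset.mem_insert,
                Fin.ext_iff]
              omega
            rw [e]
            refine ih.insert ?_ ?_
            · intro j hj heq
              have hj' : j < ⟨m, hm⟩ := by simpa [Fin.lt_def] using hj
              exact (hE ⟨m, hm⟩).2.2.1 j hj' (rootHE_ext (hE j).1 (hE ⟨m, hm⟩).1 heq)
            · intro hA
              refine (hE ⟨m, hm⟩).2.2.2.2 (SameTree.symm' ?_)
              unfold Anc at hA
              unfold SameTree
              refine Relation.ReflTransGen.lift id ?_ _ _ hA
              rintro x y ⟨k, hk, h1, h2⟩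
              exact ⟨k, by simpa [Fin.lt_def] using hk, Or.inl ⟨h1, h2⟩⟩
          · have e : Finset.univ.filter (fun k : Fin (n - 1) => (k : ℕ) < m + 1)
                = Finset.univ.filter (fun k : Fin (n - 1) => (k : ℕ) < m) := by
              ext k
              simp only [Finset.mem_filter, Finset.mem_univ, true_and]
              have := k.2
              omega
            rw [e]; exact ih
      have := key (n - 1)
      rwa [Finset.filter_true_of_mem (fun k _ => k.2)] at this
  · rintro ⟨h1, h2, h3⟩ k
    have hinj : Set.InjOn (Rv E) (Finset.univ : Finset (Fin (n - 1))) := h3.1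
    refine ⟨(h1 k).1, (h1 k).2, ?_, ?_, ?_⟩
    · intro j hj e
      have : j = k := hinj (by simp) (by simp) (by simp only [Rv]; rw [e])
      exact hj.ne this
    · intro j hj e
      exact hj.ne (h2 e)
    · intro hS
      have key : ∀ a, SameTree E k (Rv E k) a → Anc (wv E) Finset.univ (Rv E) a (Rv E k) := by
        intro a ha
        unfold SameTree at ha
        induction ha with
        | refl => exact Relation.ReflTransGen.refl
        | tail _ hs ih =>
          obtain ⟨j, hj, ⟨rfl, rfl⟩ | ⟨rfl, rfl⟩⟩ := hs
          · refine Anc.step hinj (j := j) (by simp) ?_ ih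
            intro e
            exact hj.ne (hinj (by simp) (by simp) e)
          · exact Relation.ReflTransGen.head ⟨j, by simp, rfl, rfl⟩ ih
      have hA := key _ hS
      obtain ⟨h, H⟩ := h3.2
      have l1 := Anc.le H hA
      have l2 := H k (by simp)
      exact absurd l1 (by simpa [wv] using l2)

/-! Non-root half-edges and the bijection with pairs `(S, R)`. -/

abbrev Yt (d : Fin n → ℕ) := {h : HE d // IsNonRootHE d h}

def rHE (hd : ∀ i, 1 ≤ d i) (i : Fin n) : HE d := ⟨i, ⟨d i - 1, by have := hd i; omega⟩⟩

lemma rHE_root (hd : ∀ i, 1 ≤ d i) (i : Fin n) : IsRootHE d (rHE hd i) := rfl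

def yv (y : Yt d) : Fin n := y.1.1

def mkE (hd : ∀ i, 1 ≤ d i) (S : Fin (n - 1) → Yt d) (R : Fin (n - 1) → Fin n) : Path d :=
  fun k => (rHE hd (R k), (S k).1)

noncomputable def Exec (d : Fin n → ℕ) : Finset (Path d) := Finset.univ.filter (IsExecPath d)

lemma mem_Exec {E : Path d} : E ∈ Exec d ↔ IsExecPath d E := by simp [Exec]

lemma sum_Exec (hd : ∀ i, 1 ≤ d i) (Φ : Path d → ℝ) :
    ∑ E ∈ Exec d, Φ E
      = ∑ S ∈ Inj (Fin (n - 1)) (Yt d), ∑ R ∈ RV (fun k => yv (S k)), Φ (mkE hd S R) := by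
  rw [Finset.sum_sigma']
  symm
  refine Finset.sum_bij (fun x _ => mkE hd x.1 x.2) ?_ ?_ ?_ ?_
  · rintro ⟨S, R⟩ h
    obtain ⟨h1, h2⟩ := Finset.mem_sigma.1 h
    rw [mem_Exec, exec_iff]
    refine ⟨fun k => ⟨rHE_root hd _, (S k).2⟩, ?_, ?_⟩
    · intro j k hjk
      exact (Finset.mem_filter.1 h1).2 (Subtype.ext hjk)
    · exact (Finset.mem_filter.1 h2).2
  · rintro ⟨S, R⟩ _ ⟨S', R'⟩ _ h
    have e1 : S = S' := by
      funext k
      have := congrFun h k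
      exact Subtype.ext (Prod.ext_iff.1 this).2
    have e2 : R = R' := by
      funext k
      have := congrFun h k
      have := (Prod.ext_iff.1 this).1
      exact congrArg Sigma.fst this
    rw [e1, e2]
  · intro E hE
    rw [mem_Exec, exec_iff] at hE
    obtain ⟨h1, h2, h3⟩ := hE
    refine ⟨⟨fun k => ⟨(E k).2, (h1 k).2⟩, Rv E⟩, ?_, ?_⟩
    · refine Finset.mem_sigma.2 ⟨?_, ?_⟩
      · refine Finset.mem_filter.2 ⟨by simp, fun j k hjk => h2 (Subtype.ext_iff.1 hjk)⟩
      · exact Finset.mem_filter.2 ⟨by simp, h3⟩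
    · funext k
      refine Prod.ext ?_ rfl
      exact rootHE_ext (rHE_root hd _) (h1 k).1 rfl
  · intro x _; rfl

/-! Used half-edges. -/

def gE (E : Path d) : Fin (n - 1) ⊕ Fin (n - 1) → HE d
  | Sum.inl k => (E k).1
  | Sum.inr k => (E k).2

lemma usedIn_iff (E : Path d) (h : HE d) : UsedIn E h ↔ ∃ x, gE E x = h := by
  unfold UsedIn
  constructor
  · rintro (⟨k, rfl⟩ | ⟨k, rfl⟩)
    · exact ⟨Sum.inl k, rfl⟩
    · exact ⟨Sum.inr k, rfl⟩
  · rintro ⟨x | x, rfl⟩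
    · exact Or.inl ⟨x, rfl⟩
    · exact Or.inr ⟨x, rfl⟩

lemma Rv_inj {E : Path d} (hE : IsExecPath d E) : Function.Injective (Rv E) := by
  have := ((exec_iff E).1 hE).2.2.1
  simpa using this

lemma root_ne {h h' : HE d} (hr : IsRootHE d h) (hn : IsNonRootHE d h') : h ≠ h' := by
  rintro rfl
  unfold IsRootHE at hr; unfold IsNonRootHE at hn; omega

lemma gE_inj {E : Path d} (hE : IsExecPath d E) : Function.Injective (gE E) := by
  have h := (exec_iff E).1 hE
  rintro (j | j) (k | k) hjk
  · have : Rv E j = Rv E k := congrArg Sigma.fst hjk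
    rw [Rv_inj hE this]
  · exact absurd hjk (root_ne (h.1 j).1 (h.1 k).2)
  · exact absurd hjk.symm (root_ne (h.1 k).1 (h.1 j).2)
  · rw [h.2.1 hjk]

noncomputable def Us (E : Path d) : Finset (HE d) := Finset.univ.filter (UsedIn E)
noncomputable def Fr (E : Path d) : Finset (HE d) := Finset.univ.filter (fun h => ¬ UsedIn E h)

lemma mem_Fr {E : Path d} {h : HE d} : h ∈ Fr E ↔ ¬ UsedIn E h := by simp [Fr]
lemma mem_Us {E : Path d} {h : HE d} : h ∈ Us E ↔ UsedIn E h := by simp [Us]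

lemma card_Us {E : Path d} (hE : IsExecPath d E) : (Us E).card = 2 * (n - 1) := by
  have : Us E = Finset.univ.image (gE E) := by
    ext h; rw [mem_Us, usedIn_iff]; simp
  rw [this, Finset.card_image_of_injective _ (gE_inj hE)]
  simp; ring

lemma card_HE : Fintype.card (HE d) = ∑ i, d i := by simp

lemma card_Fr {E : Path d} (hE : IsExecPath d E) : (Fr E).card + 2 * (n - 1) = ∑ i, d i := by
  rw [← card_Us hE, ← card_HE (d := d), ← Finset.card_univ, add_comm]
  exact Finset.card_filter_add_card_filter_not _

/-! Completions. -/

noncomputable def Cmp (E : Path d) : Finset (HE d → HE d) := Finset.univ.filter (IsCompletion E)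

lemma mem_Cmp {E : Path d} {M : HE d → HE d} : M ∈ Cmp E ↔ IsCompletion E M := by simp [Cmp]

def conjP (σ : Equiv.Perm (HE d)) (M : HE d → HE d) : HE d → HE d := fun h => σ (M (σ.symm h))

lemma conjP_symm (σ : Equiv.Perm (HE d)) (M : HE d → HE d) : conjP σ.symm (conjP σ M) = M := by
  funext h; simp [conjP]

lemma conjP_symm' (σ : Equiv.Perm (HE d)) (M : HE d → HE d) : conjP σ (conjP σ.symm M) = M := by
  funext h; simp [conjP]

lemma conjP_comp {E E' : Path d} {σ : Equiv.Perm (HE d)} (h : ∀ x, UsedIn E' (σ x) ↔ UsedIn E x)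
    {M : HE d → HE d} (hM : IsCompletion E M) : IsCompletion E' (conjP σ M) := by
  refine ⟨fun x => by simp [conjP, hM.1 _], fun x => ?_⟩
  have := h (σ.symm x)
  rw [Equiv.apply_symm_apply] at this
  rw [this, ← hM.2]
  simp only [conjP]
  rw [← Equiv.eq_symm_apply]

lemma used_symm {E E' : Path d} {σ : Equiv.Perm (HE d)} (h : ∀ x, UsedIn E' (σ x) ↔ UsedIn E x) :
    ∀ x, UsedIn E (σ.symm x) ↔ UsedIn E' x := by
  intro x
  have := h (σ.symm x)
  rw [Equiv.apply_symm_apply] at this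
  exact this.symm

lemma card_Cmp_filter {E E' : Path d} {σ : Equiv.Perm (HE d)}
    (h : ∀ x, UsedIn E' (σ x) ↔ UsedIn E x) (P P' : (HE d → HE d) → Prop)
    (hP : ∀ M, P' (conjP σ M) ↔ P M) :
    ((Cmp E).filter P).card = ((Cmp E').filter P').card := by
  refine Finset.card_bij' (fun M _ => conjP σ M) (fun M _ => conjP σ.symm M) ?_ ?_ ?_ ?_
  · intro M hM
    obtain ⟨h1, h2⟩ := Finset.mem_filter.1 hM
    exact Finset.mem_filter.2 ⟨mem_Cmp.2 (conjP_comp h (mem_Cmp.1 h1)), (hP M).2 h2⟩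
  · intro M hM
    obtain ⟨h1, h2⟩ := Finset.mem_filter.1 hM
    refine Finset.mem_filter.2 ⟨mem_Cmp.2 (conjP_comp (used_symm h) (mem_Cmp.1 h1)), ?_⟩
    rw [← hP, conjP_symm']; exact h2
  · intro M _; exact conjP_symm σ M
  · intro M _; exact conjP_symm' σ M

lemma card_Cmp_eq {E E' : Path d} (hE : IsExecPath d E) (hE' : IsExecPath d E') :
    (Cmp E).card = (Cmp E').card := by
  have hc : Fintype.card {h // UsedIn E h} = Fintype.card {h // UsedIn E' h} := by
    rw [Fintype.card_subtype, Fintype.card_subtype]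
    exact (card_Us hE).trans (card_Us hE').symm
  have e : {h // UsedIn E h} ≃ {h // UsedIn E' h} := Fintype.equivOfCardEq hc
  have := card_Cmp_filter (E := E) (E' := E') (σ := e.extendSubtype) (fun x => ?_)
    (fun _ => True) (fun _ => True) (fun _ => Iff.rfl)
  · simpa using this
  · constructor
    · intro h; by_contra h'
      exact e.extendSubtype_not_mem x h' h
    · intro h; exact e.extendSubtype_mem x h

/-! Vertex preserving permutation for equal trees. -/

lemma parentOf_Rv {E : Path d} (hE : IsExecPath d E) (k : Fin (n - 1)) :
    parentOf E (Rv E k) = wv E k := by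
  unfold parentOf
  have h : ∃ k', (E k').1.1 = Rv E k := ⟨k, rfl⟩
  rw [dif_pos h]
  have : h.choose = k := Rv_inj hE h.choose_spec
  rw [this]; rfl

lemma exists_perm {E E' : Path d} (hE : IsExecPath d E) (hE' : IsExecPath d E')
    (hT : SameTreeAs E E') :
    ∃ σ : Equiv.Perm (HE d), (∀ x, UsedIn E' (σ x) ↔ UsedIn E x) ∧ ∀ x, (σ x).1 = x.1 := by
  have hk : ∀ k, ∃ k', Rv E' k' = Rv E k := fun k => by
    have := (hT.2 (Rv E k)).1 ⟨k, rfl⟩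
    exact this
  choose κ hκ using hk
  have κinj : Function.Injective κ := fun a b hab => Rv_inj hE (by rw [← hκ, ← hκ, hab])
  have κbij : Function.Bijective κ := Finite.injective_iff_bijective.1 κinj
  have hw : ∀ k, wv E' (κ k) = wv E k := fun k => by
    rw [← parentOf_Rv hE', hκ, ← hT.1, parentOf_Rv hE]
  let κe := Equiv.ofBijective κ κbij
  have hg : ∀ x, (gE E' (Equiv.sumCongr κe κe x)).1 = (gE E x).1 := by
    rintro (k | k)
    · exact hκ k
    · exact hw k
  have cnt : ∀ (E : Path d), IsExecPath d E → ∀ v, Fintype.card {j : Fin (d v) // UsedIn E ⟨v, j⟩}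
      = Fintype.card {x // (gE E x).1 = v} := by
    intro E hE v
    symm
    refine Fintype.card_of_bijective (f := fun x =>
      (⟨x.2 ▸ (gE E x.1).2, by
        obtain ⟨x, rfl⟩ := x
        exact (usedIn_iff E _).2 ⟨x, rfl⟩⟩ : {j : Fin (d v) // UsedIn E ⟨v, j⟩})) ⟨?_, ?_⟩
    · rintro ⟨x, hx⟩ ⟨y, hy⟩ hxy
      have : gE E x = gE E y := by
        refine HE_ext (hx.trans hy.symm) ?_
        subst hx
        have := congrArg (fun z => ((z.1 : Fin _) : ℕ)) hxy
        dsimp only at this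
        rw [this]
        have aux : ∀ (v : Fin n) (h : HE d) (e : h.1 = v), ((e ▸ h.2 : Fin (d v)) : ℕ) = h.2 := by
          rintro v h rfl; rfl
        exact aux _ _ _
      exact Subtype.ext (gE_inj hE this)
    · rintro ⟨j, hj⟩
      obtain ⟨x, hx⟩ := (usedIn_iff E _).1 hj
      refine ⟨⟨x, by rw [hx]⟩, ?_⟩
      refine Subtype.ext (Fin.ext ?_)
      have aux : ∀ (v : Fin n) (h : HE d) (e : h.1 = v), ((e ▸ h.2 : Fin (d v)) : ℕ) = h.2 := by
        rintro v h rfl; rfl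
      dsimp only
      rw [aux]; rw [hx]
  have hc : ∀ v, Fintype.card {j : Fin (d v) // UsedIn E ⟨v, j⟩}
      = Fintype.card {j : Fin (d v) // UsedIn E' ⟨v, j⟩} := by
    intro v
    rw [cnt E hE, cnt E' hE']
    refine Fintype.card_congr ((Equiv.sumCongr κe κe).subtypeEquiv fun x => ?_)
    rw [hg]
  let e := fun v => Fintype.equivOfCardEq (hc v)
  refine ⟨Equiv.sigmaCongrRight (fun v => (e v).extendSubtype), ?_, ?_⟩
  · rintro ⟨v, j⟩
    constructor
    · intro h; by_contra h'
      exact (e v).extendSubtype_not_mem j h' h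
    · intro h; exact (e v).extendSubtype_mem j h
  · rintro ⟨v, j⟩; rfl

lemma simple_conj {E E' : Path d} (hT : SameTreeAs E E') {σ : Equiv.Perm (HE d)}
    (h : ∀ x, UsedIn E' (σ x) ↔ UsedIn E x) (hv : ∀ x, (σ x).1 = x.1) (M : HE d → HE d) :
    SimpleG E' (conjP σ M) ↔ SimpleG E M := by
  have hm : ∀ u v, matchCount E' (conjP σ M) u v = matchCount E M u v := by
    intro u v
    symm
    refine Nat.card_congr (σ.subtypeEquiv fun x => ?_)
    rw [h, hv]
    simp only [conjP, Equiv.symm_apply_apply, hv]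
  have ht : ∀ u v, TreeAdj E' u v ↔ TreeAdj E u v := by
    intro u v; unfold TreeAdj
    rw [hT.1, hT.1, hT.2, hT.2]
  unfold SimpleG
  simp only [hm, ht]

lemma card_pairs (Q : Path d → Prop) (P : Path d → (HE d → HE d) → Prop) :
    Nat.card {x : Path d × (HE d → HE d) // Q x.1 ∧ P x.1 x.2}
      = ∑ E ∈ Finset.univ.filter Q, (Finset.univ.filter (P E)).card := by
  rw [Nat.card_eq_fintype_card, Fintype.card_subtype, ← Finset.card_sigma]
  refine Finset.card_bij (fun x _ => ⟨x.1, x.2⟩) ?_ ?_ ?_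
  · intro x hx
    have := (Finset.mem_filter.1 hx).2
    simp [this.1, this.2]
  · intro x _ y _ h
    simp only [Sigma.mk.injEq, heq_eq_eq] at h
    exact Prod.ext h.1 h.2
  · rintro ⟨E, M⟩ h
    obtain ⟨h1, h2⟩ := Finset.mem_sigma.1 h
    exact ⟨(E, M), Finset.mem_filter.2 ⟨by simp, (Finset.mem_filter.1 h1).2,
      (Finset.mem_filter.1 h2).2⟩, rfl⟩

def QQ (E₀ E : Path d) : Prop := IsExecPath d E ∧ SameTreeAs E E₀
def PP (E : Path d) (M : HE d → HE d) : Prop := IsCompletion E M ∧ SimpleG E M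

theorem condSimple_eq {E₀ : Path d} (hE₀ : IsExecPath d E₀) :
    condSimpleProb E₀ = avg (Cmp E₀) (fun M => if SimpleG E₀ M then 1 else 0) := by
  unfold condSimpleProb avg
  have e1 : Nat.card {x : Path d × (HE d → HE d) //
      (IsExecPath d x.1 ∧ IsCompletion x.1 x.2) ∧ SameTreeAs x.1 E₀ ∧ SimpleG x.1 x.2}
      = Nat.card {x : Path d × (HE d → HE d) // QQ E₀ x.1 ∧ PP x.1 x.2} :=
    Nat.card_congr (Equiv.subtypeEquivRight fun x => by unfold QQ PP; tauto)
  have e2 : Nat.card {x : Path d × (HE d → HE d) //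
      (IsExecPath d x.1 ∧ IsCompletion x.1 x.2) ∧ SameTreeAs x.1 E₀}
      = Nat.card {x : Path d × (HE d → HE d) // QQ E₀ x.1 ∧ (IsCompletion x.1 x.2)} :=
    Nat.card_congr (Equiv.subtypeEquivRight fun x => by unfold QQ; tauto)
  rw [e1, e2, card_pairs (QQ E₀) PP, card_pairs (QQ E₀) IsCompletion]
  have f1 : ∀ E ∈ Finset.univ.filter (QQ E₀), (Finset.univ.filter (PP E)).card
        = ((Cmp E₀).filter (SimpleG E₀)).card := by
    intro E hE
    obtain ⟨h1, h2⟩ := (Finset.mem_filter.1 hE).2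
    obtain ⟨σ, hσ, hσv⟩ := exists_perm h1 hE₀ h2
    rw [← card_Cmp_filter hσ (SimpleG E) (SimpleG E₀)
      (fun M => simple_conj h2 hσ hσv M), Cmp, Finset.filter_filter]
    congr 1
    ext M; simp only [Finset.mem_filter, Finset.mem_univ, true_and, PP]
  have f2 : ∀ E ∈ Finset.univ.filter (QQ E₀),
      (Finset.univ.filter (IsCompletion E)).card = (Cmp E₀).card := by
    intro E hE
    exact card_Cmp_eq (Finset.mem_filter.1 hE).2.1 hE₀
  rw [Finset.sum_congr rfl f1, Finset.sum_congr rfl f2, Finset.sum_const, Finset.sum_const,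
    smul_eq_mul, smul_eq_mul, ← Finset.sum_filter]
  have hpos : (Finset.univ.filter (QQ E₀)).card ≠ 0 := by
    rw [Finset.card_ne_zero]
    exact ⟨E₀, Finset.mem_filter.2 ⟨by simp, hE₀, fun _ => rfl, fun _ => Iff.rfl⟩⟩
  push_cast
  rw [mul_div_mul_left _ _ (by exact_mod_cast hpos)]
  simp

end EX

/-! ### Part 5b: the events "loop", "parallel to a tree edge", "double edge" -/

section EB
variable {n : ℕ} {d : Fin n → ℕ}

/-- symmetric closure of a relation -/
def ad (pr : Fin n → Fin n → Prop) (u v : Fin n) : Prop := pr u v ∨ pr v u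

def J1 (F : Finset (HE d)) (pr : Fin n → Fin n → Prop) (q : Qd (HE d)) : Prop :=
  q.2.2.1 = q.1 ∧ q.2.2.2 = q.2.1 ∧ q.1 ∈ F ∧ q.2.1 ∈ F ∧
    ((q.1.1 = q.2.1.1 ∧ (q.1.2 : ℕ) < q.2.1.2) ∨ pr q.1.1 q.2.1.1)

def J2 (F : Finset (HE d)) (pr : Fin n → Fin n → Prop) (q : Qd (HE d)) : Prop :=
  q.1 ∈ F ∧ q.2.1 ∈ F ∧ q.2.2.1 ∈ F ∧ q.2.2.2 ∈ F ∧ q.1.1 = q.2.2.1.1 ∧ q.2.1.1 = q.2.2.2.1 ∧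
    q.1.1 < q.2.1.1 ∧ ¬ ad pr q.1.1 q.2.1.1 ∧ (q.1.2 : ℕ) < q.2.2.1.2 ∧ q.2.1 ≠ q.2.2.2

noncomputable def I1 (F : Finset (HE d)) (pr : Fin n → Fin n → Prop) : Finset (Qd (HE d)) :=
  Finset.univ.filter (J1 F pr)
noncomputable def I2 (F : Finset (HE d)) (pr : Fin n → Fin n → Prop) : Finset (Qd (HE d)) :=
  Finset.univ.filter (J2 F pr)

lemma mem_I1 {F : Finset (HE d)} {pr : Fin n → Fin n → Prop} {q : Qd (HE d)} :
    q ∈ I1 F pr ↔ J1 F pr q := by simp [I1]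
lemma mem_I2 {F : Finset (HE d)} {pr : Fin n → Fin n → Prop} {q : Qd (HE d)} :
    q ∈ I2 F pr ↔ J2 F pr q := by simp [I2]

noncomputable def att (d : Fin n → ℕ) (v : Fin n) : Finset (HE d) :=
  Finset.univ.filter (fun h => h.1 = v)

lemma card_att (v : Fin n) : (att d v).card = d v := by
  have : att d v = Finset.univ.image (fun j : Fin (d v) => (⟨v, j⟩ : HE d)) := by
    ext h
    simp only [att, Finset.mem_filter, Finset.mem_univ, true_and, Finset.mem_image]
    constructor
    · rintro rfl; exact ⟨h.2, rfl⟩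
    · rintro ⟨j, rfl⟩; rfl
  rw [this, Finset.card_image_of_injective, Finset.card_univ, Fintype.card_fin]
  intro a b h
  simpa using h

noncomputable def sameP (d : Fin n → ℕ) : Finset (HE d × HE d) :=
  Finset.univ.filter (fun e => e.1.1 = e.2.1)

lemma card_sameP : (sameP d).card = ∑ i, d i ^ 2 := by
  have : sameP d = Finset.univ.biUnion (fun v => att d v ×ˢ att d v) := by
    ext e; simp [sameP, att, eq_comm]
  rw [this, Finset.card_biUnion]
  · refine Finset.sum_congr rfl fun v _ => ?_
    rw [Finset.card_product, card_att, sq]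
  · intro u _ v _ huv
    rw [Function.onFun, Finset.disjoint_left]
    intro e h1 h2
    simp [att] at h1 h2
    exact huv (h1.1.symm.trans h2.1)

structure PrOK (pr : Fin n → Fin n → Prop) (Δ : ℕ) : Prop where
  fn : ∀ u v v', pr u v → pr u v' → v = v'
  asymm : ∀ u v, pr u v → ¬ pr v u
  ch : ∀ v, (Finset.univ.filter (fun u => pr u v)).card ≤ Δ

lemma PrOK.irr {pr : Fin n → Fin n → Prop} {Δ : ℕ} (h : PrOK pr Δ) (u : Fin n) : ¬ pr u u :=
  fun hu => h.asymm u u hu hu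

lemma canon_aux {F : Finset (HE d)} {pr : Fin n → Fin n → Prop} {Δ : ℕ} (hp : PrOK pr Δ) :
    ∀ q ∈ I1 F pr ∪ I2 F pr, ∀ r ∈ I1 F pr ∪ I2 F pr, (q.1, q.2.1) ∈ Kq r →
      (q.2.2.1, q.2.2.2) ∈ Kq r → q = r := by
  rintro ⟨x, y, a, b⟩ hq ⟨x', y', a', b'⟩ hr h1 h2
  simp only [Kq, Finset.mem_insert, Finset.mem_singleton, Prod.mk.injEq] at h1 h2
  rw [Finset.mem_union, mem_I1, mem_I2] at hq hr
  rcases hq with hq | hq <;> rcases hr with hr | hr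
  · simp only [J1] at hq hr
    obtain ⟨rfl, rfl, -, -, hq⟩ := hq
    obtain ⟨rfl, rfl, -, -, hr⟩ := hr
    have h3 : (a = a' ∧ b = b') ∨ (a = b' ∧ b = a') := by tauto
    rcases h3 with ⟨rfl, rfl⟩ | ⟨rfl, rfl⟩
    · rfl
    · exfalso
      rcases hq with ⟨e, l⟩ | e <;> rcases hr with ⟨e', l'⟩ | e'
      · omega
      · rw [e] at e'; exact hp.irr _ e'
      · rw [e'] at e; exact hp.irr _ e
      · exact hp.asymm _ _ e e'
  · exfalso
    simp only [J1, J2, ad] at hq hr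
    obtain ⟨rfl, rfl, -, -, hq⟩ := hq
    obtain ⟨-, -, -, -, e1, e2, l, na, -, -⟩ := hr
    have l' := l
    rw [e1, e2] at l'
    have na' := na
    rw [e1, e2] at na'
    rcases h1 with ⟨rfl, rfl⟩ | ⟨rfl, rfl⟩ | ⟨rfl, rfl⟩ | ⟨rfl, rfl⟩
    · rcases hq with ⟨e, -⟩ | e
      · exact l.ne e
      · tauto
    · rcases hq with ⟨e, -⟩ | e
      · exact l.ne e.symm
      · tauto
    · rcases hq with ⟨e, -⟩ | e
      · exact l'.ne e
      · tauto
    · rcases hq with ⟨e, -⟩ | e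
      · exact l'.ne e.symm
      · tauto
  · exfalso
    simp only [J1, J2, ad] at hq hr
    obtain ⟨rfl, rfl, -, -, hr⟩ := hr
    obtain ⟨-, -, -, -, e1, e2, l, na, -, -⟩ := hq
    have h3 : (x = a' ∧ y = b') ∨ (x = b' ∧ y = a') := by tauto
    rcases h3 with ⟨rfl, rfl⟩ | ⟨rfl, rfl⟩
    · rcases hr with ⟨e, -⟩ | e
      · exact l.ne e
      · tauto
    · rcases hr with ⟨e, -⟩ | e
      · exact l.ne e.symm
      · tauto
  · simp only [J2] at hq hr
    obtain ⟨-, -, -, -, e1, e2, l, -, lt, -⟩ := hq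
    obtain ⟨-, -, -, -, e1', e2', l', -, lt', -⟩ := hr
    have l2 := l
    rw [e1, e2] at l2
    have l2' := l'
    rw [e1', e2'] at l2'
    have k1 : (x = x' ∧ y = y') ∨ (x = a' ∧ y = b') := by
      rcases h1 with h | ⟨rfl, rfl⟩ | h | ⟨rfl, rfl⟩
      · exact Or.inl h
      · exact absurd l l'.asymm
      · exact Or.inr h
      · exact absurd l l2'.asymm
    have k2 : (a = x' ∧ b = y') ∨ (a = a' ∧ b = b') := by
      rcases h2 with h | ⟨rfl, rfl⟩ | h | ⟨rfl, rfl⟩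
      · exact Or.inl h
      · exact absurd l2 l'.asymm
      · exact Or.inr h
      · exact absurd l2 l2'.asymm
    rcases k1 with ⟨rfl, rfl⟩ | ⟨rfl, rfl⟩ <;> rcases k2 with ⟨rfl, rfl⟩ | ⟨rfl, rfl⟩
    · omega
    · rfl
    · omega
    · omega

noncomputable def nbh (pr : Fin n → Fin n → Prop) (d : Fin n → ℕ) (v : Fin n) : Finset (HE d) :=
  Finset.univ.filter (fun h => h.1 = v ∨ pr v h.1 ∨ pr h.1 v)

lemma card_nbh {pr : Fin n → Fin n → Prop} {Δ : ℕ} (hp : PrOK pr Δ) (hΔ : ∀ i, d i ≤ Δ)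
    (v : Fin n) : (nbh pr d v).card ≤ Δ + (Δ + Δ * Δ) := by
  have hsub : nbh pr d v ⊆ att d v ∪ ((Finset.univ.filter (fun u => pr v u)).biUnion (att d)
      ∪ (Finset.univ.filter (fun u => pr u v)).biUnion (att d)) := by
    intro h hh
    simpa [nbh, att] using hh
  refine (Finset.card_le_card hsub).trans ((Finset.card_union_le _ _).trans ?_)
  refine Nat.add_le_add (card_att v ▸ hΔ v) ((Finset.card_union_le _ _).trans ?_)
  refine Nat.add_le_add ?_ ?_
  · refine (Finset.card_biUnion_le_card_mul _ _ Δ fun u _ => card_att u ▸ hΔ u).trans ?_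
    have : (Finset.univ.filter (fun u => pr v u)).card ≤ 1 := by
      rw [Finset.card_le_one]
      intro a ha b hb
      exact hp.fn v a b (by simpa using ha) (by simpa using hb)
    nlinarith
  · refine (Finset.card_biUnion_le_card_mul _ _ Δ fun u _ => card_att u ▸ hΔ u).trans ?_
    exact Nat.mul_le_mul_right _ (hp.ch v)

theorem evs_ok {F : Finset (HE d)} {pr : Fin n → Fin n → Prop} {Δ : ℕ} (hp : PrOK pr Δ)
    (hΔ : ∀ i, d i ≤ Δ) (hΔ1 : 1 ≤ Δ) :
    Evs F (I1 F pr) (I2 F pr) (6 * Δ ^ 2) (4 * (Δ * ∑ i, d i ^ 2)) (2 * Δ ^ 2) where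
  typ1 q hq := by
    rw [mem_I1] at hq; exact ⟨hq.1, hq.2.1⟩
  mem1 q hq := by
    rw [mem_I1] at hq
    obtain ⟨-, -, h1, h2, h3⟩ := hq
    refine ⟨h1, h2, fun e => ?_⟩
    rw [e] at h3
    rcases h3 with h | h
    · exact lt_irrefl _ h.2
    · exact hp.irr _ h
  mem2 q hq := by
    rw [mem_I2] at hq
    obtain ⟨h1, h2, -, -, -, -, l, -⟩ := hq
    refine ⟨h1, h2, fun e => ?_⟩
    rw [e] at l
    exact lt_irrefl _ l
  mem2' q hq := by
    rw [mem_I2] at hq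
    obtain ⟨-, -, h1, h2, e1, e2, l, -⟩ := hq
    refine ⟨h1, h2, fun e => ?_⟩
    rw [e1, e2, e] at l
    exact lt_irrefl _ l
  dj q hq := by
    rw [mem_I2] at hq
    obtain ⟨-, -, h1, h2, e1, e2, l, -, lt, ne⟩ := hq
    refine ⟨fun e => ?_, fun e => ?_, fun e => ?_, fun e => ?_⟩
    · rw [e] at lt; exact lt_irrefl _ lt
    · rw [e1, e] at l; exact lt_irrefl _ l
    · rw [e2, e] at l; exact lt_irrefl _ l
    · exact ne e.symm
  canon := canon_aux hp
  tch1 z := by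
    have hsub : (I1 F pr).filter (fun q => tch q z) ⊆ (nbh pr d z.1).image (fun h => (z, h, z, h))
        ∪ (nbh pr d z.1).image (fun h => (h, z, h, z)) := by
      rintro ⟨x, y, a, b⟩ hq
      obtain ⟨h1, h2⟩ := Finset.mem_filter.1 hq
      rw [mem_I1] at h1
      obtain ⟨e1, e2, -, -, h3⟩ := h1
      simp only at e1 e2 h3
      subst e1 e2
      simp only [tch] at h2
      have h2' : z = a ∨ z = b := by tauto
      rw [Finset.mem_union, Finset.mem_image, Finset.mem_image]
      rcases h2' with rfl | rfl
      · refine Or.inl ⟨b, ?_, rfl⟩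
        simp only [nbh, Finset.mem_filter, Finset.mem_univ, true_and]
        rcases h3 with h | h
        · exact Or.inl h.1.symm
        · exact Or.inr (Or.inl h)
      · refine Or.inr ⟨a, ?_, rfl⟩
        simp only [nbh, Finset.mem_filter, Finset.mem_univ, true_and]
        rcases h3 with h | h
        · exact Or.inl h.1
        · exact Or.inr (Or.inr h)
    refine (Finset.card_le_card hsub).trans ((Finset.card_union_le _ _).trans ?_)
    have := card_nbh hp hΔ z.1
    have i1 := Finset.card_image_le (s := nbh pr d z.1) (f := fun h => ((z, h, z, h) : Qd (HE d)))
    have i2 := Finset.card_image_le (s := nbh pr d z.1) (f := fun h => ((h, z, h, z) : Qd (HE d)))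
    nlinarith
  tch2 z := by
    have hsub : (I2 F pr).filter (fun q => tch q z) ⊆
        (((att d z.1 ×ˢ sameP d).image (fun t => ((z, t.2.1, t.1, t.2.2) : Qd (HE d))))
        ∪ ((att d z.1 ×ˢ sameP d).image (fun t => ((t.1, t.2.1, z, t.2.2) : Qd (HE d)))))
        ∪ (((att d z.1 ×ˢ sameP d).image (fun t => ((t.2.1, z, t.2.2, t.1) : Qd (HE d))))
        ∪ ((att d z.1 ×ˢ sameP d).image (fun t => ((t.2.1, t.1, t.2.2, z) : Qd (HE d))))) := by
      rintro ⟨x, y, a, b⟩ hq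
      obtain ⟨h1, h2⟩ := Finset.mem_filter.1 hq
      rw [mem_I2] at h1
      obtain ⟨-, -, -, -, e1, e2, -⟩ := h1
      simp only at e1 e2
      simp only [tch] at h2
      rw [Finset.mem_union, Finset.mem_union, Finset.mem_union, Finset.mem_image,
        Finset.mem_image, Finset.mem_image, Finset.mem_image]
      rcases h2 with rfl | rfl | rfl | rfl
      · exact Or.inl (Or.inl ⟨(a, y, b), by simp [att, sameP, e1, e2], rfl⟩)
      · exact Or.inr (Or.inl ⟨(b, x, a), by simp [att, sameP, e1, e2], rfl⟩)
      · exact Or.inl (Or.inr ⟨(x, y, b), by simp [att, sameP, e1, e2], rfl⟩)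
      · exact Or.inr (Or.inr ⟨(y, x, a), by simp [att, sameP, e1, e2], rfl⟩)
    have hc : (att d z.1 ×ˢ sameP d).card ≤ Δ * ∑ i, d i ^ 2 := by
      rw [Finset.card_product, card_att, card_sameP]
      exact Nat.mul_le_mul_right _ (hΔ _)
    have i : ∀ f : HE d × HE d × HE d → Qd (HE d),
        ((att d z.1 ×ˢ sameP d).image f).card ≤ Δ * ∑ i, d i ^ 2 :=
      fun f => Finset.card_image_le.trans hc
    refine (Finset.card_le_card hsub).trans ((Finset.card_union_le _ _).trans ?_)
    refine (Nat.add_le_add (Finset.card_union_le _ _) (Finset.card_union_le _ _)).trans ?_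
    refine (Nat.add_le_add (Nat.add_le_add (i _) (i _)) (Nat.add_le_add (i _) (i _))).trans ?_
    omega
  prs u v := by
    have hsub : (I2 F pr).filter (fun q => (q.1 = u ∧ q.2.1 = v) ∨ (q.2.2.1 = u ∧ q.2.2.2 = v)) ⊆
        ((att d u.1 ×ˢ att d v.1).image (fun t => ((u, v, t.1, t.2) : Qd (HE d))))
        ∪ ((att d u.1 ×ˢ att d v.1).image (fun t => ((t.1, t.2, u, v) : Qd (HE d)))) := by
      rintro ⟨x, y, a, b⟩ hq
      obtain ⟨h1, h2⟩ := Finset.mem_filter.1 hq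
      rw [mem_I2] at h1
      obtain ⟨-, -, -, -, e1, e2, -⟩ := h1
      simp only at e1 e2 h2
      rw [Finset.mem_union, Finset.mem_image, Finset.mem_image]
      rcases h2 with ⟨rfl, rfl⟩ | ⟨rfl, rfl⟩
      · exact Or.inl ⟨(a, b), by simp [att, e1, e2], rfl⟩
      · exact Or.inr ⟨(x, y), by simp [att, e1, e2], rfl⟩
    have hc : (att d u.1 ×ˢ att d v.1).card ≤ Δ ^ 2 := by
      rw [Finset.card_product, card_att, card_att, sq]
      exact Nat.mul_le_mul (hΔ _) (hΔ _)
    have i : ∀ f : HE d × HE d → Qd (HE d),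
        ((att d u.1 ×ˢ att d v.1).image f).card ≤ Δ ^ 2 :=
      fun f => Finset.card_image_le.trans hc
    refine (Finset.card_le_card hsub).trans ((Finset.card_union_le _ _).trans ?_)
    refine (Nat.add_le_add (i _) (i _)).trans ?_
    omega

end EB

section EC
variable {n : ℕ} {d : Fin n → ℕ}

def prE (E : Path d) (u v : Fin n) : Prop := IsNonRootV E u ∧ parentOf E u = v

lemma prE_iff {E : Path d} (hE : IsExecPath d E) (u v : Fin n) :
    prE E u v ↔ ∃ k, Rv E k = u ∧ wv E k = v := by
  constructor
  · rintro ⟨⟨k, rfl⟩, h⟩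
    exact ⟨k, rfl, by rw [← h]; exact (parentOf_Rv hE k).symm⟩
  · rintro ⟨k, rfl, rfl⟩
    exact ⟨⟨k, rfl⟩, parentOf_Rv hE k⟩

lemma prOK {E : Path d} (hE : IsExecPath d E) {Δ : ℕ} (hΔ : ∀ i, d i ≤ Δ) : PrOK (prE E) Δ where
  fn u v v' h h' := h.2.symm.trans h'.2
  asymm u v h h' := by
    obtain ⟨k, rfl, rfl⟩ := (prE_iff hE _ _).1 h
    obtain ⟨j, hj1, hj2⟩ := (prE_iff hE _ _).1 h'
    obtain ⟨ht, H⟩ := ((exec_iff E).1 hE).2.2.2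
    have h1 := H k (by simp)
    have h2 := H j (by simp)
    rw [hj1, hj2] at h2
    omega
  ch v := by
    have hsub : Finset.univ.filter (fun u => prE E u v)
        ⊆ (Finset.univ.filter (fun k => wv E k = v)).image (Rv E) := by
      intro u hu
      obtain ⟨k, h1, h2⟩ := (prE_iff hE _ _).1 (Finset.mem_filter.1 hu).2
      exact Finset.mem_image.2 ⟨k, by simp [h2], h1⟩
    refine (Finset.card_le_card hsub).trans (Finset.card_image_le.trans ?_)
    refine le_trans ?_ (hΔ v)
    rw [← card_att (d := d) v]
    refine Finset.card_le_card_of_injOn (fun k => (E k).2) ?_ ?_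
    · intro k hk
      have : wv E k = v := by simpa using hk
      simp only [att, Finset.coe_filter, Finset.mem_univ, true_and, Set.mem_ofPred_eq]
      exact this
    · exact fun a _ b _ h => ((exec_iff E).1 hE).2.1 h

lemma TreeAdj_iff (E : Path d) (u v : Fin n) : TreeAdj E u v ↔ ad (prE E) u v := Iff.rfl

theorem simple_iff {E : Path d} {M : HE d → HE d} (hM : IsCompletion E M) :
    SimpleG E M ↔ WJ (I1 (Fr E) (prE E) ∪ I2 (Fr E) (prE E)) M = 0 := by
  have hfr : ∀ h, h ∈ Fr E → M h ∈ Fr E := by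
    intro h hh
    rw [mem_Fr, ← hM.2] at hh ⊢
    rw [hM.1]; exact fun e => hh e.symm
  have hnf : ∀ h, h ∈ Fr E → M h ≠ h := by
    intro h hh
    rwa [mem_Fr, ← hM.2] at hh
  rw [WJ, Finset.card_eq_zero, Finset.filter_eq_empty_iff]
  have fin : ∀ u v, Finite {h : HE d // ¬ UsedIn E h ∧ h.1 = u ∧ (M h).1 = v} := fun u v =>
    inferInstance
  constructor
  · rintro ⟨h1, h2⟩ ⟨x, y, a, b⟩ hq ⟨hX1, hX2⟩
    simp only at hX1 hX2
    rw [Finset.mem_union, mem_I1, mem_I2] at hq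
    rcases hq with hq | hq
    · simp only [J1] at hq
      obtain ⟨rfl, rfl, hx, hy, hh⟩ := hq
      rcases hh with ⟨e, -⟩ | e
      · have := h1 a.1
        rw [matchCount, Finite.card_eq_zero_iff] at this
        exact this.false ⟨a, mem_Fr.1 hx, rfl, by rw [hX1]; exact e.symm⟩
      · have hne : a.1 ≠ b.1 := by
          rintro e'
          have := h1 a.1
          rw [matchCount, Finite.card_eq_zero_iff] at this
          exact this.false ⟨a, mem_Fr.1 hx, rfl, by rw [hX1]; exact e'.symm⟩
        have := h2 a.1 b.1 hne
        rw [if_pos (show TreeAdj E a.1 b.1 from Or.inl e)] at this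
        have h0 : matchCount E M a.1 b.1 = 0 := by omega
        rw [matchCount, Finite.card_eq_zero_iff] at h0
        exact h0.false ⟨a, mem_Fr.1 hx, rfl, by rw [hX1]⟩
    · obtain ⟨hx, hy, ha, hb, e1, e2, l, -, lt, -⟩ := hq
      simp only at hx hy ha hb e1 e2 l lt
      have := h2 x.1 y.1 l.ne
      have h0 : matchCount E M x.1 y.1 ≤ 1 := by omega
      rw [matchCount, Finite.card_le_one_iff_subsingleton] at h0
      have := h0.elim ⟨x, mem_Fr.1 hx, rfl, by rw [hX1]⟩
        ⟨a, mem_Fr.1 ha, e1.symm, by rw [hX2, e2]⟩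
      have : x = a := Subtype.ext_iff.1 this
      rw [this] at lt
      exact lt_irrefl _ lt
  · intro H
    have H1 : ∀ x ∈ Fr E, ¬ ((x.1 = (M x).1 ∧ (x.2 : ℕ) < (M x).2) ∨ prE E x.1 (M x).1) := by
      intro x hx hh
      refine H (x := (x, M x, x, M x)) (Finset.mem_union_left _ (mem_I1.2 ?_)) ⟨rfl, rfl⟩
      exact ⟨rfl, rfl, hx, hfr x hx, hh⟩
    have H0 : ∀ x ∈ Fr E, x.1 ≠ (M x).1 := by
      intro x hx e
      rcases lt_trichotomy (x.2 : ℕ) (M x).2 with l | l | l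
      · exact H1 x hx (Or.inl ⟨e, l⟩)
      · exact hnf x hx (HE_ext e l).symm
      · exact H1 (M x) (hfr x hx) (Or.inl (by rw [hM.1]; exact ⟨e.symm, l⟩))
    refine ⟨fun u => ?_, fun u v huv => ?_⟩
    · rw [matchCount, Finite.card_eq_zero_iff]
      refine ⟨?_⟩
      rintro ⟨x, hx, rfl, e⟩
      exact H0 x (mem_Fr.2 hx) e.symm
    · by_cases hT : TreeAdj E u v
      · rw [if_pos hT]
        have : matchCount E M u v = 0 := by
          rw [matchCount, Finite.card_eq_zero_iff]
          refine ⟨?_⟩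
          rintro ⟨x, hx, rfl, rfl⟩
          rcases hT with h | h
          · exact H1 x (mem_Fr.2 hx) (Or.inr h)
          · refine H1 (M x) (hfr x (mem_Fr.2 hx)) (Or.inr ?_)
            rw [hM.1]; exact h
        omega
      · rw [if_neg hT, zero_add, matchCount, Finite.card_le_one_iff_subsingleton]
        refine ⟨?_⟩
        have key : ∀ x a : HE d, x ∈ Fr E → a ∈ Fr E → x.1 = a.1 → (M x).1 = (M a).1 →
            ¬ TreeAdj E x.1 (M x).1 → x.1 < (M x).1 → x = a := by
          intro x a hx ha e1 e2 hT l
          have key' : ∀ x a : HE d, x ∈ Fr E → a ∈ Fr E → x.1 = a.1 → (M x).1 = (M a).1 →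
            ¬ TreeAdj E x.1 (M x).1 → x.1 < (M x).1 → ¬ ((x.2 : ℕ) < a.2) := by
            intro x a hx ha e1 e2 hT l lt
            refine H (x := (x, M x, a, M a)) (Finset.mem_union_right _ (mem_I2.2 ?_)) ⟨rfl, rfl⟩
            refine ⟨hx, hfr x hx, ha, hfr a ha, e1, e2, l, hT, lt, ?_⟩
            intro e
            have : x = a := hM.1.injective e
            rw [this] at lt
            exact lt_irrefl _ lt
          rcases lt_trichotomy (x.2 : ℕ) a.2 with h | h | h
          · exact absurd h (key' x a hx ha e1 e2 hT l)
          · exact HE_ext e1 h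
          · refine absurd h (key' a x ha hx e1.symm e2.symm ?_ ?_)
            · rwa [← e1, ← e2]
            · rwa [← e1, ← e2]
        rintro ⟨x, hx, hxu, hxv⟩ ⟨a, ha, hau, hav⟩
        refine Subtype.ext ?_
        rcases lt_or_gt_of_ne huv with l | l
        · exact key x a (mem_Fr.2 hx) (mem_Fr.2 ha) (hxu.trans hau.symm) (hxv.trans hav.symm)
            (by rwa [hxu, hxv]) (by rwa [hxu, hxv])
        · apply hM.1.injective
          refine key (M x) (M a) (hfr x (mem_Fr.2 hx)) (hfr a (mem_Fr.2 ha))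
            (hxv.trans hav.symm) ?_ ?_ ?_
          · rw [hM.1, hM.1]; exact hxu.trans hau.symm
          · rw [hM.1, hxv, hxu]
            intro h; apply hT
            exact Or.symm h
          · rw [hM.1, hxv, hxu]; exact l

/-! Completions form a good system. -/

lemma Cmp_nonempty {E : Path d} (hev : Even (Fr E).card) : (Cmp E).Nonempty := by
  obtain ⟨k, hk⟩ := hev
  have hc : Fintype.card {h : HE d // ¬ UsedIn E h} = Fintype.card (Fin k ⊕ Fin k) := by
    rw [Fintype.card_subtype]
    simp only [Fintype.card_sum, Fintype.card_fin]
    rw [← hk]; rfl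
  let e : {h : HE d // ¬ UsedIn E h} ≃ Fin k ⊕ Fin k := Fintype.equivOfCardEq hc
  let M : HE d → HE d := fun h => if hh : UsedIn E h then h else (e.symm (e ⟨h, hh⟩).swap).1
  have m1 : ∀ h, UsedIn E h → M h = h := fun h hh => dif_pos hh
  have m2 : ∀ h (hh : ¬ UsedIn E h), M h = (e.symm (e ⟨h, hh⟩).swap).1 := fun h hh => dif_neg hh
  refine ⟨M, mem_Cmp.2 ⟨?_, ?_⟩⟩
  · intro h
    by_cases hh : UsedIn E h
    · rw [m1 h hh, m1 h hh]
    · rw [m2 h hh, m2 _ (e.symm (e ⟨h, hh⟩).swap).2]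
      simp
  · intro h
    refine ⟨fun hM => ?_, m1 h⟩
    by_contra hh
    rw [m2 h hh] at hM
    have h1 : e.symm (e ⟨h, hh⟩).swap = ⟨h, hh⟩ := Subtype.ext hM
    rw [Equiv.symm_apply_eq] at h1
    rcases h2 : e ⟨h, hh⟩ with j | j <;> rw [h2] at h1 <;> simp at h1

theorem good_Cmp {E : Path d} (hev : Even (Fr E).card) : Good (Cmp E) (Fr E) ∅ where
  inv M hM := (mem_Cmp.1 hM).1
  maps M hM a ha := by
    rw [mem_Cmp] at hM
    rw [mem_Fr, ← hM.2] at ha ⊢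
    rw [hM.1]; exact fun e => ha e.symm
  nofix M hM a ha := by
    rw [mem_Cmp] at hM
    rwa [mem_Fr, ← hM.2] at ha
  swap M hM b hb z hz := by
    rw [mem_Cmp] at hM ⊢
    have := conjP_comp (E := E) (E' := E) (σ := Equiv.swap b z) (M := M) ?_ hM
    · convert this using 1
      funext h; simp [cj, conjP]
    · intro x
      by_cases h1 : x = b
      · subst h1; rw [Equiv.swap_apply_left]
        rw [mem_Fr] at hb hz; tauto
      by_cases h2 : x = z
      · subst h2; rw [Equiv.swap_apply_right]
        rw [mem_Fr] at hb hz; tauto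
      rw [Equiv.swap_apply_of_ne_of_ne h1 h2]
  ne := Cmp_nonempty hev
  forced M hM u v hne hu _ := by
    rw [mem_Cmp] at hM
    rw [mem_Fr, not_not, ← hM.2] at hu
    rw [hu]; exact hne

/-! Counting the events. -/

noncomputable def PA (F : Finset (HE d)) : Finset (HE d × HE d) :=
  (F ×ˢ F).filter (fun e => e.1.1 = e.2.1 ∧ e.1 ≠ e.2)
noncomputable def PB (F : Finset (HE d)) (pr : Fin n → Fin n → Prop) : Finset (HE d × HE d) :=
  (F ×ˢ F).filter (fun e => pr e.1.1 e.2.1)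

lemma mem_PA {F : Finset (HE d)} {e : HE d × HE d} :
    e ∈ PA F ↔ e.1 ∈ F ∧ e.2 ∈ F ∧ e.1.1 = e.2.1 ∧ e.1 ≠ e.2 := by
  simp [PA, and_assoc]

lemma mem_PB {F : Finset (HE d)} {pr : Fin n → Fin n → Prop} {e : HE d × HE d} :
    e ∈ PB F pr ↔ e.1 ∈ F ∧ e.2 ∈ F ∧ pr e.1.1 e.2.1 := by
  simp [PB, and_assoc]

noncomputable def PAl (F : Finset (HE d)) : Finset (HE d × HE d) :=
  (PA F).filter (fun e => (e.1.2 : ℕ) < e.2.2)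

lemma card_half {α : Type*} (s : Finset α) (P : α → Prop) [DecidablePred P] (f : α → α) (hf : ∀ a ∈ s, f a ∈ s)
    (hff : ∀ a, f (f a) = a) (hP : ∀ a ∈ s, (P (f a) ↔ ¬ P a)) :
    s.card = 2 * (s.filter P).card := by
  rw [← Finset.card_filter_add_card_filter_not (s := s) P, two_mul]
  congr 1
  refine Finset.card_bij' (fun a _ => f a) (fun a _ => f a) ?_ ?_ ?_ ?_
  · intro a ha
    obtain ⟨h1, h2⟩ := Finset.mem_filter.1 ha
    exact Finset.mem_filter.2 ⟨hf a h1, (hP a h1).2 h2⟩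
  · intro a ha
    obtain ⟨h1, h2⟩ := Finset.mem_filter.1 ha
    exact Finset.mem_filter.2 ⟨hf a h1, fun h => (hP a h1).1 h h2⟩
  · intro a _; exact hff a
  · intro a _; exact hff a

lemma card_PA (F : Finset (HE d)) : (PA F).card = 2 * (PAl F).card := by
  refine card_half (PA F) _ Prod.swap ?_ ?_ ?_
  · intro a ha
    rw [mem_PA] at ha ⊢
    exact ⟨ha.2.1, ha.1, ha.2.2.1.symm, ha.2.2.2.symm⟩
  · intro a; rfl
  · intro a ha
    rw [mem_PA] at ha
    have : (a.1.2 : ℕ) ≠ a.2.2 := fun h => ha.2.2.2 (HE_ext ha.2.2.1 h)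
    simp only [Prod.fst_swap, Prod.snd_swap]
    omega

theorem card_I1 {F : Finset (HE d)} {pr : Fin n → Fin n → Prop} {Δ : ℕ} (hp : PrOK pr Δ) :
    2 * (I1 F pr).card = (PA F).card + 2 * (PB F pr).card := by
  have : (I1 F pr).card = (PAl F ∪ PB F pr).card := by
    refine Finset.card_bij' (fun q _ => (q.1, q.2.1)) (fun e _ => (e.1, e.2, e.1, e.2)) ?_ ?_ ?_ ?_
    · rintro ⟨x, y, a, b⟩ hq
      rw [mem_I1] at hq; simp only [J1] at hq
      obtain ⟨rfl, rfl, hx, hy, h⟩ := hq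
      rw [Finset.mem_union, PAl, Finset.mem_filter, mem_PA, mem_PB]
      rcases h with h | h
      · refine Or.inl ⟨⟨hx, hy, h.1, ?_⟩, h.2⟩
        intro e
        simp only at e
        rw [e] at h
        exact lt_irrefl _ h.2
      · exact Or.inr ⟨hx, hy, h⟩
    · rintro ⟨x, y⟩ he
      rw [Finset.mem_union, PAl, Finset.mem_filter, mem_PA, mem_PB] at he
      rw [mem_I1]
      rcases he with he | he
      · exact ⟨rfl, rfl, he.1.1, he.1.2.1, Or.inl ⟨he.1.2.2.1, he.2⟩⟩
      · exact ⟨rfl, rfl, he.1, he.2.1, Or.inr he.2.2⟩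
    · rintro ⟨x, y, a, b⟩ hq
      rw [mem_I1] at hq; simp only [J1] at hq
      obtain ⟨rfl, rfl, -⟩ := hq
      rfl
    · rintro ⟨x, y⟩ _; rfl
  rw [this, card_PA, Finset.card_union_of_disjoint, mul_add]
  rw [Finset.disjoint_left]
  intro e h1 h2
  have h3 := (mem_PA.1 (Finset.mem_filter.1 h1).1).2.2.1
  have h4 := (mem_PB.1 h2).2.2
  rw [h3] at h4
  exact hp.irr _ h4

def Zp (pr : Fin n → Fin n → Prop) (t : (HE d × HE d) × (HE d × HE d)) : Prop :=
  t.1.1.1 ≠ t.2.1.1 ∧ ¬ ad pr t.1.1.1 t.2.1.1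

noncomputable def Z0 (F : Finset (HE d)) (pr : Fin n → Fin n → Prop) :
    Finset ((HE d × HE d) × (HE d × HE d)) := (PA F ×ˢ PA F).filter (Zp pr)

lemma mem_Z0 {F : Finset (HE d)} {pr : Fin n → Fin n → Prop}
    {t : (HE d × HE d) × (HE d × HE d)} :
    t ∈ Z0 F pr ↔ (t.1 ∈ PA F ∧ t.2 ∈ PA F) ∧ t.1.1.1 ≠ t.2.1.1 ∧ ¬ ad pr t.1.1.1 t.2.1.1 := by
  rw [Z0, Finset.mem_filter, Finset.mem_product]; rfl

theorem card_Z0 {F : Finset (HE d)} {pr : Fin n → Fin n → Prop} :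
    (Z0 F pr).card = 4 * (I2 F pr).card := by
  have h1 := card_half (Z0 F pr) (fun t => t.1.1.1 < t.2.1.1) Prod.swap ?_ ?_ ?_
  have h2 := card_half ((Z0 F pr).filter (fun t => t.1.1.1 < t.2.1.1))
    (fun t => (t.1.1.2 : ℕ) < t.1.2.2) (fun t => (t.1.swap, t.2)) ?_ ?_ ?_
  · rw [h1, h2, ← mul_assoc]
    norm_num
    refine Finset.card_bij' (fun t _ => (t.1.1, t.2.1, t.1.2, t.2.2))
      (fun q _ => ((q.1, q.2.2.1), (q.2.1, q.2.2.2))) ?_ ?_ ?_ ?_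
    · rintro ⟨⟨x, a⟩, ⟨y, b⟩⟩ h
      rw [Finset.mem_filter, Finset.mem_filter, mem_Z0, mem_PA, mem_PA] at h
      obtain ⟨⟨⟨⟨⟨a1, a2, a3, a4⟩, b1, b2, b3, b4⟩, c1, c2⟩, l⟩, lt⟩ := h
      exact mem_I2.2 ⟨a1, b1, a2, b2, a3, b3, l, c2, lt, b4⟩
    · rintro ⟨x, y, a, b⟩ h
      obtain ⟨a1, b1, a2, b2, a3, b3, l, c2, lt, b4⟩ := mem_I2.1 h
      rw [Finset.mem_filter, Finset.mem_filter, mem_Z0, mem_PA, mem_PA]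
      refine ⟨⟨⟨⟨⟨a1, a2, a3, ?_⟩, b1, b2, b3, b4⟩, l.ne, c2⟩, l⟩, lt⟩
      intro e
      simp only at e lt
      rw [e] at lt; exact lt_irrefl _ lt
    · rintro ⟨⟨x, a⟩, ⟨y, b⟩⟩ _; rfl
    · rintro ⟨x, y, a, b⟩ _; rfl
  · rintro ⟨⟨x, a⟩, ⟨y, b⟩⟩ h
    rw [Finset.mem_filter, mem_Z0, mem_PA, mem_PA] at h ⊢
    obtain ⟨⟨⟨⟨a1, a2, a3, a4⟩, b⟩, c1, c2⟩, l⟩ := h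
    simp only [Prod.swap] at a1 a2 a3 a4 b c1 c2 l ⊢
    refine ⟨⟨⟨⟨a2, a1, a3.symm, a4.symm⟩, b⟩, ?_, ?_⟩, ?_⟩
    · rwa [← a3]
    · rwa [← a3]
    · rwa [← a3]
  · intro t; rfl
  · rintro ⟨⟨x, a⟩, ⟨y, b⟩⟩ h
    rw [Finset.mem_filter, mem_Z0, mem_PA, mem_PA] at h
    obtain ⟨⟨⟨⟨a1, a2, a3, a4⟩, b⟩, c1, c2⟩, l⟩ := h
    simp only [Prod.swap] at a3 a4 ⊢
    have : (x.2 : ℕ) ≠ a.2 := fun h => a4 (HE_ext a3 h)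
    omega
  · rintro ⟨⟨x, a⟩, ⟨y, b⟩⟩ h
    rw [mem_Z0] at h ⊢
    simp only [Prod.swap] at h ⊢
    exact ⟨⟨h.1.2, h.1.1⟩, h.2.1.symm, fun h' => h.2.2 (Or.symm h')⟩
  · intro t; rfl
  · rintro ⟨⟨x, a⟩, ⟨y, b⟩⟩ h
    rw [mem_Z0] at h
    have := h.2.1
    simp only [Prod.swap] at this ⊢
    constructor
    · exact fun l => l.asymm
    · intro l; exact lt_of_le_of_ne (not_lt.1 l) (Ne.symm this)

theorem card_I2 {F : Finset (HE d)} {pr : Fin n → Fin n → Prop} {Δ : ℕ} (hΔ : ∀ i, d i ≤ Δ) :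
    4 * (I2 F pr).card ≤ (PA F).card ^ 2 ∧
    (PA F).card ^ 2 ≤ 4 * (I2 F pr).card + Δ ^ 2 * ((PA F).card + 2 * (PB F pr).card) := by
  rw [← card_Z0, sq, ← Finset.card_product]
  refine ⟨Finset.card_le_card (Finset.filter_subset _ _), ?_⟩
  rw [← Finset.card_filter_add_card_filter_not (s := PA F ×ˢ PA F) (Zp pr)]
  refine Nat.add_le_add_left ?_ _
  have hsub : (PA F ×ˢ PA F).filter (fun t => ¬ Zp pr t) ⊆
      ((PA F).biUnion (fun e => (att d e.1.1 ×ˢ att d e.1.1).image (fun f => (e, f))))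
      ∪ ((PB F pr).biUnion (fun e => (att d e.1.1 ×ˢ att d e.2.1).image
          (fun f => ((e.1, f.1), (e.2, f.2))))
      ∪ (PB F pr).biUnion (fun e => (att d e.1.1 ×ˢ att d e.2.1).image
          (fun f => ((e.2, f.2), (e.1, f.1))))) := by
    rintro ⟨⟨x, a⟩, ⟨y, b⟩⟩ h
    rw [Finset.mem_filter, Finset.mem_product, Zp] at h
    obtain ⟨⟨h1, h2⟩, h3⟩ := h
    simp only at h1 h2 h3
    have g1 := mem_PA.1 h1
    have g2 := mem_PA.1 h2
    simp only at g1 g2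
    simp only [Finset.mem_union, Finset.mem_biUnion, Finset.mem_image, Finset.mem_product, att,
      Finset.mem_filter, Finset.mem_univ, true_and]
    by_cases e : x.1 = y.1
    · refine Or.inl ⟨(x, a), h1, (y, b), ⟨e.symm, ?_⟩, rfl⟩
      rw [← g2.2.2.1]; exact e.symm
    · have h4 : ad pr x.1 y.1 := by
        by_contra h4; exact h3 ⟨e, h4⟩
      rcases h4 with h4 | h4
      · exact Or.inr (Or.inl ⟨(x, y), mem_PB.2 ⟨g1.1, g2.1, h4⟩, (a, b),
          ⟨g1.2.2.1.symm, g2.2.2.1.symm⟩, rfl⟩)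
      · exact Or.inr (Or.inr ⟨(y, x), mem_PB.2 ⟨g2.1, g1.1, h4⟩, (b, a),
          ⟨g2.2.2.1.symm, g1.2.2.1.symm⟩, rfl⟩)
  have hc : ∀ u v, (att d u ×ˢ att d v).card ≤ Δ ^ 2 := by
    intro u v
    rw [Finset.card_product, card_att, card_att, sq]
    exact Nat.mul_le_mul (hΔ _) (hΔ _)
  refine (Finset.card_le_card hsub).trans ((Finset.card_union_le _ _).trans ?_)
  refine (Nat.add_le_add_left (Finset.card_union_le _ _) _).trans ?_
  refine (Nat.add_le_add (Finset.card_biUnion_le_card_mul _ _ (Δ ^ 2)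
      fun e _ => Finset.card_image_le.trans (hc _ _))
    (Nat.add_le_add (Finset.card_biUnion_le_card_mul _ _ (Δ ^ 2)
      fun e _ => Finset.card_image_le.trans (hc _ _))
    (Finset.card_biUnion_le_card_mul _ _ (Δ ^ 2)
      fun e _ => Finset.card_image_le.trans (hc _ _)))).trans ?_
  exact le_of_eq (by ring)

end EC

section ED
variable {n : ℕ} {d : Fin n → ℕ}

noncomputable def NE (E : Path d) : ℝ := ((Fr E).card : ℝ)
noncomputable def AE (E : Path d) : ℝ := ((PA (Fr E)).card : ℝ)
noncomputable def BE (E : Path d) : ℝ := ((PB (Fr E) (prE E)).card : ℝ)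
noncomputable def n1E (E : Path d) : ℝ := ((I1 (Fr E) (prE E)).card : ℝ)
noncomputable def n2E (E : Path d) : ℝ := ((I2 (Fr E) (prE E)).card : ℝ)

lemma csp_eq {E : Path d} (hE : IsExecPath d E) : condSimpleProb E
    = avg (Cmp E) (fun M => if WJ (I1 (Fr E) (prE E) ∪ I2 (Fr E) (prE E)) M = 0 then 1 else 0) := by
  rw [condSimple_eq hE]
  unfold avg
  congr 1
  refine Finset.sum_congr rfl fun M hM => ?_
  have := simple_iff (mem_Cmp.1 hM)
  beta_reduce
  by_cases h : SimpleG E M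
  · rw [if_pos h, if_pos (this.1 h)]
  · rw [if_neg h, if_neg (fun h' => h (this.2 h'))]

lemma n1E_eq {E : Path d} (hE : IsExecPath d E) {Δ : ℕ} (hΔ : ∀ i, d i ≤ Δ) :
    n1E E = AE E / 2 + BE E := by
  have := card_I1 (F := Fr E) (prOK hE hΔ)
  have h : (2 : ℝ) * n1E E = AE E + 2 * BE E := by
    unfold n1E AE BE; exact_mod_cast this
  linarith

lemma n2E_le (E : Path d) {Δ : ℕ} (hΔ : ∀ i, d i ≤ Δ) : n2E E ≤ AE E ^ 2 / 4 := by
  have := (card_I2 (F := Fr E) (pr := prE E) hΔ).1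
  have h : (4 : ℝ) * n2E E ≤ AE E ^ 2 := by
    unfold n2E AE; exact_mod_cast this
  linarith

lemma n2E_ge (E : Path d) {Δ : ℕ} (hΔ : ∀ i, d i ≤ Δ) :
    (AE E ^ 2 - (Δ : ℝ) ^ 2 * (AE E + 2 * BE E)) / 4 ≤ n2E E := by
  have := (card_I2 (F := Fr E) (pr := prE E) hΔ).2
  have h : AE E ^ 2 ≤ 4 * n2E E + (Δ : ℝ) ^ 2 * (AE E + 2 * BE E) := by
    unfold n2E AE BE; exact_mod_cast this
  linarith

lemma csp_le_one {E : Path d} (hE : IsExecPath d E) (hev : Even (Fr E).card) :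
    condSimpleProb E ≤ 1 := by
  rw [csp_eq hE]
  refine (avg_mono (Ψ := fun _ => (1 : ℝ)) fun M _ => ?_).trans (avg_const (good_Cmp hev).ne 1).le
  split_ifs <;> norm_num

lemma csp_union {E : Path d} (hE : IsExecPath d E) (hev : Even (Fr E).card) (h2 : 2 ≤ (Fr E).card)
    {Δ : ℕ} (hΔ : ∀ i, d i ≤ Δ) (hΔ1 : 1 ≤ Δ) :
    1 - (2 * (AE E / NE E / 2 + BE E / NE E) + 2 * (AE E / NE E) ^ 2) ≤ condSimpleProb E := by
  have hev2 := evs_ok (F := Fr E) (prOK hE hΔ) hΔ hΔ1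
  refine le_trans ?_ ((hev2.union (good_Cmp hev)).trans (csp_eq hE).ge)
  have hN : (2 : ℝ) ≤ NE E := by unfold NE; exact_mod_cast h2
  have e1 := n1E_eq hE hΔ
  have e2 := n2E_le E hΔ
  have hA : 0 ≤ AE E := by unfold AE; positivity
  have hB : 0 ≤ BE E := by unfold BE; positivity
  have h1 : n1E E / (NE E - 1) ≤ 2 * (AE E / NE E / 2 + BE E / NE E) := by
    rw [e1, div_le_iff₀ (by linarith)]
    have : 2 * (AE E / NE E / 2 + BE E / NE E) * (NE E - 1)
      = (AE E / 2 + BE E) * (2 * (NE E - 1) / NE E) := by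
        field_simp
    rw [this]
    refine le_mul_of_one_le_right (by positivity) ?_
    rw [le_div_iff₀ (by linarith)]; linarith
  have h2' : n2E E / ((NE E - 1) * (NE E - 3)) ≤ 2 * (AE E / NE E) ^ 2 := by
    rcases (I2 (Fr E) (prE E)).eq_empty_or_nonempty with h | ⟨q, hq⟩
    · have : n2E E = 0 := by unfold n2E; rw [h]; simp
      rw [this, zero_div]; positivity
    · have h4 : (4 : ℝ) ≤ NE E := by unfold NE; exact_mod_cast four_le hev2 hq
      have hp : 0 < (NE E - 1) * (NE E - 3) := mul_pos (by linarith) (by linarith)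
      rw [div_le_iff₀ hp]
      have hh : NE E ^ 2 / 8 ≤ (NE E - 1) * (NE E - 3) := by nlinarith
      calc n2E E ≤ AE E ^ 2 / 4 := e2
        _ = 2 * (AE E / NE E) ^ 2 * (NE E ^ 2 / 8) := by field_simp; ring
        _ ≤ _ := mul_le_mul_of_nonneg_left hh (by positivity)
  have : lam (NE E) (n1E E) (n2E E) ≤ 2 * (AE E / NE E / 2 + BE E / NE E) + 2 * (AE E / NE E) ^ 2 :=
    add_le_add h1 h2'
  unfold NE n1E n2E at this
  unfold NE
  linarith

noncomputable def tauE (E : Path d) (Δ : ℕ) : ℝ :=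
  14 * (Δ : ℝ) ^ 2 / (NE E - 5) + 4 * (Δ * ∑ i, (d i : ℝ) ^ 2) / ((NE E - 5) * (NE E - 7))
noncomputable def LamE (E : Path d) (Δ : ℕ) : ℝ :=
  (n1E E + 8 * (Δ : ℝ) ^ 2) / (NE E - 5) + n2E E / ((NE E - 5) * (NE E - 7))

lemma csp_poisson {E : Path d} (hE : IsExecPath d E) (hev : Even (Fr E).card) (h7 : 7 < NE E)
    {Δ : ℕ} (hΔ : ∀ i, d i ≤ Δ) (hΔ1 : 1 ≤ Δ) :
    |condSimpleProb E - Real.exp (-lam (NE E) (n1E E) (n2E E))| ≤ lam (NE E) (n1E E) (n2E E) *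
      (1 / (NE E - 1) + 2 * (3 * tauE E Δ + 4 * LamE E Δ / (NE E - 5))) := by
  have hev2 := evs_ok (F := Fr E) (prOK hE hΔ) hΔ hΔ1
  have := hev2.poisson (good_Cmp hev) (N := NE E) rfl h7 (τ := tauE E Δ) (Λ := LamE E Δ) ?_ ?_
  · rw [csp_eq hE]; exact this
  · unfold tauE; push_cast; congr 2; ring
  · unfold LamE n1E n2E; push_cast; congr 2; ring

/-! The limit of the conditional probability along an abstract filter. -/

lemma tendsto_shift {ι : Type*} {l : Filter ι} {N : ι → ℝ} (hN : Tendsto N l atTop) (c : ℝ) :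
    Tendsto (fun i => N i / (N i - c)) l (nhds 1) := by
  have h1 : Tendsto (fun i => 1 / (1 - c * (N i)⁻¹)) l (nhds (1 / (1 - c * 0))) :=
    tendsto_const_nhds.div
      (tendsto_const_nhds.sub (tendsto_const_nhds.mul hN.inv_tendsto_atTop)) (by norm_num)
  have e : (1 : ℝ) / (1 - c * 0) = 1 := by norm_num
  rw [e] at h1
  refine h1.congr' ?_
  filter_upwards [hN.eventually_gt_atTop (max 0 c)] with i hi
  have p1 : 0 < N i := lt_of_le_of_lt (le_max_left _ _) hi
  have p2 : c < N i := lt_of_le_of_lt (le_max_right _ _) hi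
  have p3 : N i - c ≠ 0 := by linarith
  have p4 : 1 - c * (N i)⁻¹ ≠ 0 := by
    intro h
    apply p3
    field_simp at h
    linarith
  field_simp

lemma tendsto_div_shift {ι : Type*} {l : Filter ι} {N x : ι → ℝ} (hN : Tendsto N l atTop)
    {a : ℝ} (hx : Tendsto (fun i => x i / N i) l (nhds a)) (c : ℝ) :
    Tendsto (fun i => x i / (N i - c)) l (nhds a) := by
  have h := hx.mul (tendsto_shift hN c)
  rw [mul_one] at h
  refine h.congr' ?_
  filter_upwards [hN.eventually_gt_atTop 0] with i hi
  rw [div_mul_div_comm, mul_comm (N i), mul_div_mul_right _ _ hi.ne']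

lemma tendsto_div_shift2 {ι : Type*} {l : Filter ι} {N x : ι → ℝ} (hN : Tendsto N l atTop)
    {a : ℝ} (hx : Tendsto (fun i => x i / N i ^ 2) l (nhds a)) (c c' : ℝ) :
    Tendsto (fun i => x i / ((N i - c) * (N i - c'))) l (nhds a) := by
  have h := (hx.mul (tendsto_shift hN c)).mul (tendsto_shift hN c')
  rw [mul_one, mul_one] at h
  refine h.congr' ?_
  filter_upwards [hN.eventually_gt_atTop 0] with i hi
  rw [div_mul_div_comm, div_mul_div_comm, mul_assoc (x i), mul_assoc (N i ^ 2), sq,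
    mul_comm (x i), mul_div_mul_left]
  positivity

theorem csp_limit_pos {ι : Type*} {l : Filter ι} {n : ι → ℕ} {d : ∀ i, Fin (n i) → ℕ}
    (E : ∀ i, Path (d i)) (hE : ∀ i, IsExecPath (d i) (E i)) (hev : ∀ i, Even (Fr (E i)).card)
    (Δ : ι → ℕ) (hΔ : ∀ i v, d i v ≤ Δ i) (hΔ1 : ∀ i, 1 ≤ Δ i) {ν K : ℝ}
    (hN : Tendsto (fun i => NE (E i)) l atTop)
    (hD : Tendsto (fun i => (Δ i : ℝ) ^ 2 / NE (E i)) l (nhds 0))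
    (hS : Tendsto (fun i => (∑ v, (d i v : ℝ) ^ 2) / NE (E i)) l (nhds K))
    (hA : Tendsto (fun i => AE (E i) / NE (E i)) l (nhds ν))
    (hB : Tendsto (fun i => BE (E i) / NE (E i)) l (nhds ν)) :
    Tendsto (fun i => condSimpleProb (E i)) l (nhds (Real.exp (-(3 * ν / 2 + ν ^ 2 / 4)))) := by
  have g1 : Tendsto (fun i => n1E (E i) / NE (E i)) l (nhds (3 * ν / 2)) := by
    have := (hA.div_const 2).add hB
    have e : ν / 2 + ν = 3 * ν / 2 := by ring
    rw [e] at this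
    refine this.congr fun i => ?_
    rw [n1E_eq (hE i) (hΔ i)]; ring
  have g2 : Tendsto (fun i => n2E (E i) / NE (E i) ^ 2) l (nhds (ν ^ 2 / 4)) := by
    have up : Tendsto (fun i => (AE (E i) / NE (E i)) ^ 2 / 4) l (nhds (ν ^ 2 / 4)) :=
      (hA.pow 2).div_const 4
    have lo : Tendsto (fun i => ((AE (E i) / NE (E i)) ^ 2 - (Δ i : ℝ) ^ 2 / NE (E i) *
        (AE (E i) / NE (E i) + 2 * (BE (E i) / NE (E i)))) / 4) l
        (nhds ((ν ^ 2 - 0 * (ν + 2 * ν)) / 4)) :=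
      ((hA.pow 2).sub (hD.mul (hA.add (hB.const_mul 2)))).div_const 4
    rw [zero_mul, sub_zero] at lo
    refine tendsto_of_tendsto_of_tendsto_of_le_of_le' lo up ?_ ?_
    · filter_upwards [hN.eventually_gt_atTop 0] with i hi
      have h := n2E_ge (E i) (hΔ i)
      rw [le_div_iff₀ (by positivity)]
      refine le_trans (le_of_eq ?_) h
      field_simp
    · filter_upwards [hN.eventually_gt_atTop 0] with i hi
      have h := n2E_le (E i) (hΔ i)
      rw [div_le_iff₀ (by positivity)]
      refine h.trans (le_of_eq ?_)
      field_simp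
  have hl : Tendsto (fun i => lam (NE (E i)) (n1E (E i)) (n2E (E i))) l
      (nhds (3 * ν / 2 + ν ^ 2 / 4)) :=
    (tendsto_div_shift hN g1 1).add (tendsto_div_shift2 hN g2 1 3)
  have hD1 : Tendsto (fun i => (Δ i : ℝ) / NE (E i)) l (nhds 0) := by
    refine tendsto_of_tendsto_of_tendsto_of_le_of_le' tendsto_const_nhds hD ?_ ?_
    · filter_upwards [hN.eventually_gt_atTop 0] with i hi
      positivity
    · filter_upwards [hN.eventually_gt_atTop 0] with i hi
      have : (1 : ℝ) ≤ Δ i := by exact_mod_cast hΔ1 i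
      gcongr
      nlinarith
  have hτ : Tendsto (fun i => tauE (E i) (Δ i)) l (nhds (0 + 0)) := by
    unfold tauE
    refine (tendsto_div_shift hN ?_ 5).add (tendsto_div_shift2 hN ?_ 5 7)
    · have := hD.const_mul 14
      rw [mul_zero] at this
      refine this.congr fun i => ?_
      ring
    · have := (hD1.mul hS).const_mul 4
      rw [zero_mul, mul_zero] at this
      refine this.congr fun i => ?_
      ring
  have hΛ : Tendsto (fun i => LamE (E i) (Δ i)) l (nhds (3 * ν / 2 + 8 * 0 + ν ^ 2 / 4)) := by
    unfold LamE
    refine (tendsto_div_shift hN ?_ 5).add (tendsto_div_shift2 hN g2 5 7)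
    refine (g1.add (hD.const_mul 8)).congr fun i => ?_
    ring
  have hinv : ∀ c : ℝ, Tendsto (fun i => 1 / (NE (E i) - c)) l (nhds 0) := by
    intro c
    refine tendsto_div_shift (x := fun _ => 1) hN ?_ c
    exact hN.inv_tendsto_atTop.congr fun i => by simp
  have hΛ5 : Tendsto (fun i => 4 * LamE (E i) (Δ i) / (NE (E i) - 5)) l (nhds 0) := by
    have := (hΛ.const_mul 4).mul (hinv 5)
    rw [mul_zero] at this
    refine this.congr fun i => ?_
    ring
  have herr := hl.mul ((hinv 1).add (((hτ.const_mul 3).add hΛ5).const_mul 2))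
  have e0 : (3 * ν / 2 + ν ^ 2 / 4) * (0 + 2 * (3 * (0 + 0) + 0)) = 0 := by ring
  rw [e0] at herr
  have hexp : Tendsto (fun i => Real.exp (-lam (NE (E i)) (n1E (E i)) (n2E (E i)))) l
      (nhds (Real.exp (-(3 * ν / 2 + ν ^ 2 / 4)))) :=
    (Real.continuous_exp.tendsto _).comp hl.neg
  have hdiff : Tendsto (fun i => condSimpleProb (E i)
      - Real.exp (-lam (NE (E i)) (n1E (E i)) (n2E (E i)))) l (nhds 0) := by
    refine squeeze_zero_norm' ?_ herr
    filter_upwards [hN.eventually_gt_atTop 7] with i hi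
    exact csp_poisson (hE i) (hev i) hi (hΔ i) (hΔ1 i)
  have := hdiff.add hexp
  rw [zero_add] at this
  refine this.congr fun i => ?_
  ring

theorem csp_limit_zero {ι : Type*} {l : Filter ι} {n : ι → ℕ} {d : ∀ i, Fin (n i) → ℕ}
    (E : ∀ i, Path (d i)) (hE : ∀ i, IsExecPath (d i) (E i)) (hev : ∀ i, Even (Fr (E i)).card)
    (h2 : ∀ i, 2 ≤ (Fr (E i)).card)
    (Δ : ι → ℕ) (hΔ : ∀ i v, d i v ≤ Δ i) (hΔ1 : ∀ i, 1 ≤ Δ i)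
    (hA : Tendsto (fun i => AE (E i) / NE (E i)) l (nhds 0))
    (hB : Tendsto (fun i => BE (E i) / NE (E i)) l (nhds 0)) :
    Tendsto (fun i => condSimpleProb (E i)) l (nhds 1) := by
  have lo : Tendsto (fun i => 1 - (2 * (AE (E i) / NE (E i) / 2 + BE (E i) / NE (E i))
      + 2 * (AE (E i) / NE (E i)) ^ 2)) l (nhds (1 - (2 * (0 / 2 + 0) + 2 * 0 ^ 2))) :=
    tendsto_const_nhds.sub ((((hA.div_const 2).add hB).const_mul 2).add ((hA.pow 2).const_mul 2))
  norm_num at lo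
  exact tendsto_of_tendsto_of_tendsto_of_le_of_le lo tendsto_const_nhds
    (fun i => csp_union (hE i) (hev i) (h2 i) (hΔ i) (hΔ1 i))
    (fun i => csp_le_one (hE i) (hev i))

end ED

section EM
variable {n : ℕ} {d : Fin n → ℕ}

lemma HE_split (hd : ∀ i, 1 ≤ d i) (g : HE d → ℝ) :
    ∑ h, g h = ∑ y : Yt d, g y.1 + ∑ v, g (rHE hd v) := by
  rw [← Fintype.sum_subtype_add_sum_subtype (IsNonRootHE d) g]
  congr 1
  symm
  refine Fintype.sum_bijective
    (fun v => (⟨rHE hd v, fun h => root_ne (rHE_root hd v) h rfl⟩ : {h // ¬ IsNonRootHE d h})) ⟨?_, ?_⟩ _ _ ?_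
  · intro u v huv
    exact congrArg (fun h => h.1.1) huv
  · rintro ⟨h, hh⟩
    refine ⟨h.1, Subtype.ext ?_⟩
    refine rootHE_ext (rHE_root hd _) ?_ rfl
    have := h.2.2
    show (h.2 : ℕ) = d h.1 - 1
    change ¬ (h.2 : ℕ) < d h.1 - 1 at hh
    omega
  · intro v; rfl

lemma sum_HE_fst (g : Fin n → ℝ) : ∑ h : HE d, g h.1 = ∑ v, (d v : ℝ) * g v := by
  rw [Fintype.sum_sigma]
  refine Finset.sum_congr rfl fun v _ => ?_
  simp

lemma sum_Yt (hd : ∀ i, 1 ≤ d i) (g : Fin n → ℝ) :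
    ∑ y : Yt d, g (yv y) = ∑ v, ((d v : ℝ) - 1) * g v := by
  have h := HE_split hd (fun h => g h.1)
  rw [sum_HE_fst] at h
  have e : ∑ v, ((d v : ℝ) - 1) * g v = ∑ v, (d v : ℝ) * g v - ∑ v, g v := by
    rw [← Finset.sum_sub_distrib]
    exact Finset.sum_congr rfl fun v _ => by ring
  rw [e, h]
  simp [yv, rHE]

lemma card_Yt (hd : ∀ i, 1 ≤ d i) : (Fintype.card (Yt d) : ℝ) = ∑ v, ((d v : ℝ) - 1) := by
  have := sum_Yt hd (fun _ => 1)
  simpa using this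

/-- number of free non-root half-edges at `v` -/
noncomputable def fv (S : Fin (n - 1) → Yt d) (v : Fin n) : ℝ :=
  ∑ y : Yt d, if yv y = v then chi S y else 0

lemma fv_nonneg (S : Fin (n - 1) → Yt d) (v : Fin n) : 0 ≤ fv S v := by
  refine Finset.sum_nonneg fun y _ => ?_
  split_ifs
  · exact chi_nonneg _ _
  · exact le_rfl

lemma sum_fv_mul (S : Fin (n - 1) → Yt d) (g : Fin n → ℝ) :
    ∑ v, g v * fv S v = ∑ y, g (yv y) * chi S y := by
  unfold fv
  simp_rw [Finset.mul_sum]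
  rw [Finset.sum_comm]
  refine Finset.sum_congr rfl fun y _ => ?_
  rw [Finset.sum_eq_single (yv y)]
  · simp
  · intro v _ hv
    rw [if_neg (Ne.symm hv), mul_zero]
  · simp

noncomputable def cw (S : Fin (n - 1) → Yt d) (v : Fin n) : ℝ :=
  ((Finset.univ.filter (fun k => yv (S k) = v)).card : ℝ)

lemma cw_add_fv (hd : ∀ i, 1 ≤ d i) {S : Fin (n - 1) → Yt d} (hS : Function.Injective S) (v : Fin n) :
    cw S v + fv S v = (d v : ℝ) - 1 := by
  have h1 : ∑ y : Yt d, (if yv y = v then (1 : ℝ) else 0) = (d v : ℝ) - 1 := by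
    rw [sum_Yt hd (fun u => if u = v then (1 : ℝ) else 0)]
    simp
  rw [← h1]
  have h2 : cw S v = ∑ y : Yt d, (if yv y = v then 1 - chi S y else 0) := by
    unfold cw
    rw [Finset.card_filter]
    push_cast
    have e : ∀ y : Yt d, (if yv y = v then 1 - chi S y else 0)
        = ∑ k, if S k = y then (if yv y = v then (1 : ℝ) else 0) else 0 := by
      intro y
      by_cases hy : ∃ k, S k = y
      · obtain ⟨k, rfl⟩ := hy
        have : chi S (S k) = 0 := by unfold chi; rw [if_neg]; push Not; exact ⟨k, rfl⟩
        rw [this, Finset.sum_eq_single k]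
        · simp
        · intro j _ hj; rw [if_neg (fun h => hj (hS h))]
        · simp
      · push Not at hy
        have : chi S y = 1 := by unfold chi; rw [if_pos hy]
        rw [this, Finset.sum_eq_zero]
        · simp
        · intro k _; rw [if_neg (hy k)]
    simp_rw [e]
    rw [Finset.sum_comm]
    refine Finset.sum_congr rfl fun k _ => ?_
    simp
  rw [h2]
  unfold fv
  rw [← Finset.sum_add_distrib]
  refine Finset.sum_congr rfl fun y _ => ?_
  split_ifs <;> ring

noncomputable def rt (R : Fin (n - 1) → Fin n) (v : Fin n) : ℝ := if ∀ k, R k ≠ v then 1 else 0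

lemma mem_Fr_root (hd : ∀ i, 1 ≤ d i) (S : Fin (n - 1) → Yt d) (R : Fin (n - 1) → Fin n) (v : Fin n) :
    rHE hd v ∈ Fr (mkE hd S R) ↔ ∀ k, R k ≠ v := by
  rw [mem_Fr]
  unfold UsedIn mkE
  constructor
  · intro h k hk
    exact h (Or.inl ⟨k, by rw [hk]⟩)
  · rintro h (⟨k, hk⟩ | ⟨k, hk⟩)
    · exact h k (congrArg Sigma.fst hk)
    · exact root_ne (rHE_root hd v) (S k).2 hk.symm

lemma mem_Fr_y (hd : ∀ i, 1 ≤ d i) (S : Fin (n - 1) → Yt d) (R : Fin (n - 1) → Fin n) (y : Yt d) :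
    y.1 ∈ Fr (mkE hd S R) ↔ ∀ k, S k ≠ y := by
  rw [mem_Fr]
  unfold UsedIn mkE
  constructor
  · intro h k hk
    exact h (Or.inr ⟨k, by rw [hk]⟩)
  · rintro h (⟨k, hk⟩ | ⟨k, hk⟩)
    · exact root_ne (rHE_root hd _) y.2 hk
    · exact h k (Subtype.ext hk)

/-- number of free half-edges at `v` -/
noncomputable def Dv (E : Path d) (v : Fin n) : ℝ := ∑ h : HE d, if h ∈ Fr E ∧ h.1 = v then 1 else 0

lemma Dv_eq (hd : ∀ i, 1 ≤ d i) (S : Fin (n - 1) → Yt d) (R : Fin (n - 1) → Fin n) (v : Fin n) :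
    Dv (mkE hd S R) v = fv S v + rt R v := by
  unfold Dv
  rw [HE_split hd]
  congr 1
  · unfold fv
    refine Finset.sum_congr rfl fun y _ => ?_
    simp only [mem_Fr_y]
    unfold chi yv
    by_cases h1 : y.1.1 = v <;> by_cases h2 : ∀ k, S k ≠ y <;> simp [h1, h2]
  · have : ∀ u, (if rHE hd u ∈ Fr (mkE hd S R) ∧ (rHE hd u).1 = v then (1 : ℝ) else 0)
        = if u = v then rt R v else 0 := by
      intro u
      simp only [mem_Fr_root]
      show (if (∀ k, R k ≠ u) ∧ u = v then (1 : ℝ) else 0) = _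
      unfold rt
      by_cases h1 : u = v
      · subst h1; simp
      · simp [h1]
    simp_rw [this]
    simp

lemma sum_Fr (F : Finset (HE d)) (g : HE d → ℝ) : ∑ h ∈ F, g h = ∑ h, if h ∈ F then g h else 0 := by
  rw [← Finset.sum_filter]; congr 1; ext; simp

lemma AE_eq_Dv (E : Path d) : AE E = ∑ v, (Dv E v ^ 2 - Dv E v) := by
  have h1 : AE E + ∑ v, Dv E v = ∑ v, Dv E v ^ 2 := by
    have e1 : AE E = ∑ a ∈ Fr E, ∑ b ∈ Fr E, if a.1 = b.1 ∧ a ≠ b then (1 : ℝ) else 0 := by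
      unfold AE PA
      rw [Finset.card_filter, ← Finset.sum_product']
      push_cast
      rfl
    have e2 : ∑ v, Dv E v = ∑ a ∈ Fr E, ∑ b ∈ Fr E, if a = b then (1 : ℝ) else 0 := by
      unfold Dv
      rw [Finset.sum_comm, sum_Fr (Fr E)]
      refine Finset.sum_congr rfl fun h _ => ?_
      by_cases hh : h ∈ Fr E <;> simp [hh]
    have e3 : ∑ v, Dv E v ^ 2 = ∑ a ∈ Fr E, ∑ b ∈ Fr E, if a.1 = b.1 then (1 : ℝ) else 0 := by
      have : ∀ v, Dv E v = ∑ h ∈ Fr E, if h.1 = v then (1 : ℝ) else 0 := by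
        intro v
        rw [sum_Fr]
        unfold Dv
        refine Finset.sum_congr rfl fun h _ => ?_
        by_cases hh : h ∈ Fr E <;> simp [hh]
      simp_rw [this, sq, Finset.sum_mul_sum]
      rw [Finset.sum_comm]
      refine Finset.sum_congr rfl fun a _ => ?_
      rw [Finset.sum_comm]
      refine Finset.sum_congr rfl fun b _ => ?_
      simp [eq_comm]
    rw [e1, e2, e3, ← Finset.sum_add_distrib]
    refine Finset.sum_congr rfl fun a _ => ?_
    rw [← Finset.sum_add_distrib]
    refine Finset.sum_congr rfl fun b _ => ?_
    by_cases h : a = b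
    · subst h; simp
    · by_cases h' : a.1 = b.1 <;> simp [h, h']
  rw [Finset.sum_sub_distrib, ← h1]; ring

lemma BE_eq_Dv {E : Path d} (hE : IsExecPath d E) : BE E = ∑ k, Dv E (Rv E k) * Dv E (wv E k) := by
  have hv : ∀ v, Dv E v = ∑ h ∈ Fr E, if h.1 = v then (1 : ℝ) else 0 := by
    intro v
    rw [sum_Fr]
    unfold Dv
    refine Finset.sum_congr rfl fun h _ => ?_
    by_cases hh : h ∈ Fr E <;> simp [hh]
  have e1 : BE E = ∑ a ∈ Fr E, ∑ b ∈ Fr E, if prE E a.1 b.1 then (1 : ℝ) else 0 := by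
    unfold BE PB
    rw [Finset.card_filter, ← Finset.sum_product']
    push_cast
    rfl
  rw [e1]
  simp_rw [hv, Finset.sum_mul_sum]
  symm
  rw [Finset.sum_comm]
  refine Finset.sum_congr rfl fun a _ => ?_
  rw [Finset.sum_comm]
  refine Finset.sum_congr rfl fun b _ => ?_
  by_cases h : prE E a.1 b.1
  · rw [if_pos h]
    obtain ⟨k, h1, h2⟩ := (prE_iff hE _ _).1 h
    rw [Finset.sum_eq_single k]
    · simp [h1, h2]
    · intro j _ hj
      rw [if_neg, zero_mul]
      intro h'
      exact hj (Rv_inj hE (h'.symm.trans h1.symm))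
    · simp
  · rw [if_neg h]
    refine Finset.sum_eq_zero fun k _ => ?_
    by_cases h1 : a.1 = Rv E k
    · by_cases h2 : b.1 = wv E k
      · exact absurd ((prE_iff hE _ _).2 ⟨k, h1.symm, h2.symm⟩) h
      · simp [h2]
    · simp [h1]

lemma mkE_exec (hd : ∀ i, 1 ≤ d i) {S : Fin (n - 1) → Yt d} {R : Fin (n - 1) → Fin n}
    (hS : Function.Injective S) (hR : R ∈ RV (fun k => yv (S k))) : IsExecPath d (mkE hd S R) := by
  rw [exec_iff]
  refine ⟨fun k => ⟨rHE_root hd _, (S k).2⟩, fun j k h => hS (Subtype.ext h), ?_⟩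
  exact (Finset.mem_filter.1 hR).2

noncomputable def Ap (S : Fin (n - 1) → Yt d) : ℝ := ∑ v, (fv S v ^ 2 - fv S v)
noncomputable def Bp (S : Fin (n - 1) → Yt d) (R : Fin (n - 1) → Fin n) : ℝ :=
  ∑ k, fv S (R k) * fv S (yv (S k))
noncomputable def Cp (S : Fin (n - 1) → Yt d) : ℝ := ∑ k, fv S (yv (S k))

lemma AE_mk (hd : ∀ i, 1 ≤ d i) (S : Fin (n - 1) → Yt d) (R : Fin (n - 1) → Fin n) :
    AE (mkE hd S R) = Ap S + 2 * ∑ v, (if ∀ k, R k ≠ v then fv S v else 0) := by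
  rw [AE_eq_Dv, Ap, Finset.mul_sum, ← Finset.sum_add_distrib]
  refine Finset.sum_congr rfl fun v _ => ?_
  rw [Dv_eq]
  unfold rt
  split_ifs <;> ring

lemma BE_mk (hd : ∀ i, 1 ≤ d i) {S : Fin (n - 1) → Yt d} {R : Fin (n - 1) → Fin n}
    (hS : Function.Injective S) (hR : R ∈ RV (fun k => yv (S k))) :
    BE (mkE hd S R) = Bp S R + ∑ k, (if ∀ j, R j ≠ yv (S k) then fv S (R k) else 0) := by
  rw [BE_eq_Dv (mkE_exec hd hS hR), Bp, ← Finset.sum_add_distrib]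
  refine Finset.sum_congr rfl fun k _ => ?_
  have e1 : Rv (mkE hd S R) k = R k := rfl
  have e2 : wv (mkE hd S R) k = yv (S k) := rfl
  rw [e1, e2, Dv_eq, Dv_eq]
  have : rt R (R k) = 0 := by unfold rt; rw [if_neg]; push Not; exact ⟨k, rfl⟩
  rw [this]
  unfold rt
  split_ifs <;> ring

/-- pairs of distinct non-root half-edges at the same vertex -/
noncomputable def PY (d : Fin n → ℕ) : Finset (Yt d × Yt d) :=
  Finset.univ.filter (fun q => yv q.1 = yv q.2 ∧ q.1 ≠ q.2)

lemma Ap_eq (S : Fin (n - 1) → Yt d) : Ap S = ∑ q ∈ PY d, chi S q.1 * chi S q.2 := by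
  have e3 : ∑ v, fv S v ^ 2 = ∑ a : Yt d, ∑ b : Yt d, if yv a = yv b then chi S a * chi S b else 0 := by
    unfold fv
    simp_rw [sq, Finset.sum_mul_sum]
    rw [Finset.sum_comm]
    refine Finset.sum_congr rfl fun a _ => ?_
    rw [Finset.sum_comm]
    refine Finset.sum_congr rfl fun b _ => ?_
    rw [Finset.sum_eq_single (yv a)]
    · by_cases h : yv a = yv b <;> simp [h, eq_comm]
    · intro v _ hv; simp [Ne.symm hv]
    · simp
  have e2 : ∑ v, fv S v = ∑ a : Yt d, ∑ b : Yt d, if a = b then chi S a * chi S b else 0 := by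
    have := sum_fv_mul S (fun _ => 1)
    simp only [one_mul] at this
    rw [this]
    refine Finset.sum_congr rfl fun a _ => ?_
    simp [chi_sq]
  have e1 : ∑ q ∈ PY d, chi S q.1 * chi S q.2
      = ∑ a : Yt d, ∑ b : Yt d, if yv a = yv b ∧ a ≠ b then chi S a * chi S b else 0 := by
    unfold PY
    rw [Finset.sum_filter, ← Finset.univ_product_univ, Finset.sum_product]
  unfold Ap
  rw [Finset.sum_sub_distrib, e1, e2, e3, ← Finset.sum_sub_distrib]
  refine Finset.sum_congr rfl fun a _ => ?_
  rw [← Finset.sum_sub_distrib]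
  refine Finset.sum_congr rfl fun b _ => ?_
  by_cases h : a = b
  · subst h; simp
  · by_cases h' : yv a = yv b <;> simp [h, h']

lemma card_at (hd : ∀ i, 1 ≤ d i) (v : Fin n) :
    ((Finset.univ.filter (fun y : Yt d => yv y = v)).card : ℝ) = (d v : ℝ) - 1 := by
  have h1 := sum_Yt hd (fun u => if u = v then (1 : ℝ) else 0)
  rw [Finset.card_filter]
  push_cast
  rw [h1]
  simp

lemma card_PY (hd : ∀ i, 1 ≤ d i) : ((PY d).card : ℝ) = ∑ v, ((d v : ℝ) - 1) * ((d v : ℝ) - 2) := by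
  have e1 : ((PY d).card : ℝ) = ∑ a : Yt d, ∑ b : Yt d, if yv a = yv b ∧ a ≠ b then (1 : ℝ) else 0 := by
    unfold PY
    rw [Finset.card_filter, ← Finset.univ_product_univ, Finset.sum_product]
    push_cast
    rfl
  rw [e1, ← sum_Yt hd (fun v => (d v : ℝ) - 2)]
  refine Finset.sum_congr rfl fun a _ => ?_
  have h1 := card_at hd (yv a)
  rw [Finset.card_filter] at h1
  push_cast at h1
  have h2 : ∑ b : Yt d, (if a = b then (1 : ℝ) else 0) = 1 := by simp
  have h3 : (d (yv a) : ℝ) - 2 = (d (yv a) - 1) - 1 := by ring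
  rw [h3, ← h1, ← h2, ← Finset.sum_sub_distrib]
  refine Finset.sum_congr rfl fun b _ => ?_
  by_cases h : a = b
  · subst h; simp
  · by_cases h' : yv a = yv b <;> simp [h, h', eq_comm]

lemma PY_fib1 (hd : ∀ i, 1 ≤ d i) {Δ : ℕ} (hΔ : ∀ i, d i ≤ Δ) (y : Yt d) :
    ((PY d).filter (fun q => q.1 = y)).card ≤ Δ := by
  have h1 : ((PY d).filter (fun q => q.1 = y)).card
      ≤ (Finset.univ.filter (fun z : Yt d => yv z = yv y)).card := by
    refine Finset.card_le_card_of_injOn Prod.snd ?_ ?_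
    · intro q hq
      simp only [PY, Finset.coe_filter, Finset.mem_filter, Finset.mem_univ, true_and,
        Set.mem_ofPred_eq] at hq ⊢
      rw [← hq.2]; exact hq.1.1.symm
    · intro q hq q' hq' h
      simp only [PY, Finset.coe_filter, Finset.mem_filter, Finset.mem_univ, true_and,
        Set.mem_ofPred_eq] at hq hq'
      exact Prod.ext (hq.2.trans hq'.2.symm) h
  have h2 := card_at hd (yv y)
  have h3 : (d (yv y) : ℝ) ≤ Δ := by exact_mod_cast hΔ _
  have : (((PY d).filter (fun q => q.1 = y)).card : ℝ) ≤ Δ := by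
    have h1' : (((PY d).filter (fun q => q.1 = y)).card : ℝ)
      ≤ (Finset.univ.filter (fun z : Yt d => yv z = yv y)).card := by exact_mod_cast h1
    linarith
  exact_mod_cast this

lemma PY_fib2 (hd : ∀ i, 1 ≤ d i) {Δ : ℕ} (hΔ : ∀ i, d i ≤ Δ) (y : Yt d) :
    ((PY d).filter (fun q => q.2 = y)).card ≤ Δ := by
  refine le_trans ?_ (PY_fib1 hd hΔ y)
  refine Finset.card_le_card_of_injOn Prod.swap ?_ (fun _ _ _ _ h => Prod.swap_injective h)
  intro q hq
  simp only [PY, Finset.coe_filter, Finset.mem_filter, Finset.mem_univ, true_and,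
    Set.mem_ofPred_eq] at hq ⊢
  exact ⟨⟨hq.1.1.symm, Ne.symm hq.1.2⟩, hq.2⟩

lemma sum_cw_mul (S : Fin (n - 1) → Yt d) (g : Fin n → ℝ) :
    ∑ k, g (yv (S k)) = ∑ v, cw S v * g v := by
  have : ∀ v, cw S v * g v = ∑ k, if yv (S k) = v then g v else 0 := by
    intro v
    unfold cw
    rw [Finset.card_filter]
    push_cast
    rw [Finset.sum_mul]
    exact Finset.sum_congr rfl fun k _ => by split_ifs <;> simp
  simp_rw [this]
  rw [Finset.sum_comm]
  simp

noncomputable def D1 (S : Fin (n - 1) → Yt d) : ℝ := ∑ y, ((d (yv y) : ℝ) - 1) * chi S y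

lemma Cp_eq (hd : ∀ i, 1 ≤ d i) {S : Fin (n - 1) → Yt d} (hS : Function.Injective S) :
    Cp S = D1 S - Ap S - ∑ v, fv S v := by
  unfold Cp D1 Ap
  rw [sum_cw_mul S (fv S), ← sum_fv_mul S (fun v => (d v : ℝ) - 1), ← Finset.sum_sub_distrib,
    ← Finset.sum_sub_distrib]
  refine Finset.sum_congr rfl fun v _ => ?_
  have := cw_add_fv hd hS v
  rw [← this]; ring

lemma sum_fv (hd : ∀ i, 1 ≤ d i) {S : Fin (n - 1) → Yt d} (hS : Function.Injective S) :
    ∑ v, fv S v = (Fintype.card (Yt d) : ℝ) - Fintype.card (Fin (n - 1)) := by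
  have h1 : ∑ v, cw S v = Fintype.card (Fin (n - 1)) := by
    have := sum_cw_mul S (fun _ => 1)
    simp at this
    simp [← this]
  rw [card_Yt hd, ← h1, ← Finset.sum_sub_distrib]
  refine Finset.sum_congr rfl fun v _ => ?_
  have := cw_add_fv hd hS v
  linarith

lemma fv_le (hd : ∀ i, 1 ≤ d i) {S : Fin (n - 1) → Yt d} (hS : Function.Injective S) (v : Fin n) :
    fv S v ≤ (d v : ℝ) - 1 := by
  have := cw_add_fv hd hS v
  have h : 0 ≤ cw S v := by unfold cw; positivity
  linarith

lemma cw_nonneg (S : Fin (n - 1) → Yt d) (v : Fin n) : 0 ≤ cw S v := by unfold cw; positivity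

lemma cw_le (hd : ∀ i, 1 ≤ d i) {S : Fin (n - 1) → Yt d} (hS : Function.Injective S) (v : Fin n) :
    cw S v ≤ (d v : ℝ) - 1 := by
  have := cw_add_fv hd hS v
  have h := fv_nonneg S v
  linarith

lemma Cp_nonneg (S : Fin (n - 1) → Yt d) : 0 ≤ Cp S := Finset.sum_nonneg fun _ _ => fv_nonneg _ _

lemma Cp_le (hd : ∀ i, 1 ≤ d i) {S : Fin (n - 1) → Yt d} (hS : Function.Injective S) :
    Cp S ≤ D1 S := by
  unfold Cp D1
  rw [sum_cw_mul S (fv S), ← sum_fv_mul S (fun v => (d v : ℝ) - 1)]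
  exact Finset.sum_le_sum fun v _ => mul_le_mul_of_nonneg_right (cw_le hd hS v) (fv_nonneg S v)

lemma Cp_le2 (hd : ∀ i, 1 ≤ d i) {S : Fin (n - 1) → Yt d} (hS : Function.Injective S) :
    Cp S ≤ ∑ v, (d v : ℝ) ^ 2 := by
  unfold Cp
  rw [sum_cw_mul S (fv S)]
  refine Finset.sum_le_sum fun v _ => ?_
  have h1 := cw_le hd hS v
  have h2 := fv_le hd hS v
  have h3 := fv_nonneg S v
  have h4 := cw_nonneg S v
  have : (1 : ℝ) ≤ d v := by exact_mod_cast hd v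
  nlinarith

lemma Qp_le (hd : ∀ i, 1 ≤ d i) {S : Fin (n - 1) → Yt d} (hS : Function.Injective S) {Δ : ℕ}
    (hΔ : ∀ i, d i ≤ Δ) : ∑ k, fv S (yv (S k)) ^ 2 ≤ Δ * Cp S := by
  unfold Cp
  rw [Finset.mul_sum]
  refine Finset.sum_le_sum fun k _ => ?_
  have h2 := fv_le hd hS (yv (S k))
  have h3 := fv_nonneg S (yv (S k))
  have : (d (yv (S k)) : ℝ) ≤ Δ := by exact_mod_cast hΔ _
  nlinarith

lemma Gp_le (hd : ∀ i, 1 ≤ d i) {S : Fin (n - 1) → Yt d} (hS : Function.Injective S) {Δ : ℕ}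
    (hΔ : ∀ i, d i ≤ Δ) : ∑ v, fv S v ^ 2 ≤ Δ * ∑ v, fv S v := by
  rw [Finset.mul_sum]
  refine Finset.sum_le_sum fun k _ => ?_
  have h2 := fv_le hd hS k
  have h3 := fv_nonneg S k
  have : (d k : ℝ) ≤ Δ := by exact_mod_cast hΔ _
  nlinarith

lemma ccp_le (hd : ∀ i, 1 ≤ d i) {S : Fin (n - 1) → Yt d} (hS : Function.Injective S) :
    ∑ k, cw S (yv (S k)) ≤ ∑ v, (d v : ℝ) ^ 2 := by
  rw [sum_cw_mul S (cw S)]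
  refine Finset.sum_le_sum fun v _ => ?_
  have h1 := cw_le hd hS v
  have h4 := cw_nonneg S v
  have : (1 : ℝ) ≤ d v := by exact_mod_cast hd v
  nlinarith

end EM

lemma cs_abs {α : Type*} (s : Finset α) (x : α → ℝ) {V : ℝ}
    (h : ∑ a ∈ s, x a ^ 2 ≤ (s.card : ℝ) * V) : ∑ a ∈ s, |x a| ≤ s.card * √V := by
  have h1 := sq_sum_le_card_mul_sum_sq (s := s) (f := fun a => |x a|)
  simp only [sq_abs] at h1
  have h2 : (∑ a ∈ s, |x a|) ^ 2 ≤ (s.card : ℝ) ^ 2 * V := by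
    refine h1.trans ?_
    rw [sq, mul_assoc]
    exact mul_le_mul_of_nonneg_left h (by positivity)
  calc ∑ a ∈ s, |x a| ≤ √((s.card : ℝ) ^ 2 * V) := Real.le_sqrt_of_sq_le h2
    _ = s.card * √V := by
      rw [Real.sqrt_mul (by positivity), Real.sqrt_sq (by positivity)]

section EB
variable {n : ℕ} {d : Fin n → ℕ}

noncomputable def mR (_ : Fin n → ℕ) : ℝ := (n : ℝ) - 1
noncomputable def MR (d : Fin n → ℕ) : ℝ := ∑ v, ((d v : ℝ) - 1)
noncomputable def LR (d : Fin n → ℕ) : ℝ := MR d - mR d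
noncomputable def S2 (d : Fin n → ℕ) : ℝ := ∑ v, (d v : ℝ) ^ 2
noncomputable def P2 (d : Fin n → ℕ) : ℝ := ∑ v, ((d v : ℝ) - 1) * ((d v : ℝ) - 2)
noncomputable def S1 (d : Fin n → ℕ) : ℝ := ∑ v, ((d v : ℝ) - 1) * ((d v : ℝ) - 1)
noncomputable def a0 (d : Fin n → ℕ) : ℝ := LR d * (LR d - 1) / (MR d * (MR d - 1)) * P2 d
noncomputable def c0 (d : Fin n → ℕ) : ℝ := LR d / MR d * S1 d - a0 d - LR d
noncomputable def KK (d : Fin n → ℕ) (Δ : ℕ) : ℝ :=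
  S2 d ^ 2 / (mR d ^ 2 * (mR d - 1)) + (Δ : ℝ) ^ 2 / mR d + 2 * S2 d * Δ / mR d ^ 2

structure OKd (d : Fin n → ℕ) (Δ : ℕ) : Prop where
  hd : ∀ i, 1 ≤ d i
  hn : 3 ≤ n
  hge : 2 * n ≤ ∑ i, d i
  hΔ : ∀ i, d i ≤ Δ

variable {Δ : ℕ}

lemma mR_card (h : OKd d Δ) : mR d = Fintype.card (Fin (n - 1)) := by
  have := h.hn
  unfold mR
  rw [Fintype.card_fin, Nat.cast_sub (by omega)]; simp

lemma two_le_m (h : OKd d Δ) : 2 ≤ mR d := by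
  have : (3 : ℝ) ≤ n := by exact_mod_cast h.hn
  unfold mR; linarith

lemma M_eq (d : Fin n → ℕ) : MR d = (∑ v, (d v : ℝ)) - n := by
  unfold MR; rw [Finset.sum_sub_distrib]; simp

lemma M_ge (h : OKd d Δ) : mR d + 1 ≤ MR d := by
  have : (2 * n : ℝ) ≤ ∑ v, (d v : ℝ) := by exact_mod_cast h.hge
  rw [M_eq]; unfold mR; linarith

lemma L_ge (h : OKd d Δ) : 1 ≤ LR d := by
  have := M_ge h
  unfold LR; linarith

lemma M_card (h : OKd d Δ) : MR d = Fintype.card (Yt d) := (card_Yt h.hd).symm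

lemma card_le (h : OKd d Δ) : Fintype.card (Fin (n - 1)) + 1 ≤ Fintype.card (Yt d) := by
  have h1 := M_ge h
  rw [M_card h, mR_card h] at h1
  exact_mod_cast h1

lemma cardV (h : OKd d Δ) : Fintype.card (Fin n) = Fintype.card (Fin (n - 1)) + 1 := by
  have := h.hn
  simp; omega

lemma d_one (h : OKd d Δ) (v : Fin n) : (1 : ℝ) ≤ d v := by exact_mod_cast h.hd v
lemma d_le (h : OKd d Δ) (v : Fin n) : (d v : ℝ) ≤ Δ := by exact_mod_cast h.hΔ v

lemma S2_nonneg (d : Fin n → ℕ) : 0 ≤ S2 d := Finset.sum_nonneg fun _ _ => by positivity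

lemma P2_nonneg (h : OKd d Δ) : 0 ≤ P2 d := by
  refine Finset.sum_nonneg fun v _ => ?_
  have := d_one h v
  rcases Nat.lt_or_ge (d v) 2 with h2 | h2
  · have : d v = 1 := by have := h.hd v; omega
    rw [this]; norm_num
  · have : (2 : ℝ) ≤ d v := by exact_mod_cast h2
    exact mul_nonneg (by linarith) (by linarith)

lemma P2_le (h : OKd d Δ) : P2 d ≤ S2 d := by
  refine Finset.sum_le_sum fun v _ => ?_
  have := d_one h v
  nlinarith

lemma S1_le (h : OKd d Δ) : S1 d ≤ S2 d := by
  refine Finset.sum_le_sum fun v _ => ?_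
  have := d_one h v
  nlinarith

lemma L_le_S2 (h : OKd d Δ) : LR d ≤ S2 d := by
  have h1 := two_le_m h
  have : MR d ≤ S2 d := by
    refine Finset.sum_le_sum fun v _ => ?_
    have := d_one h v
    nlinarith
  unfold LR; linarith

lemma pi2_le (h : OKd d Δ) : LR d * (LR d - 1) / (MR d * (MR d - 1)) ≤ (LR d / MR d) ^ 2 := by
  have h1 := two_le_m h
  have h2 := M_ge h
  have h3 := L_ge h
  have h4 : LR d ≤ MR d := by unfold LR; linarith
  rw [div_pow, div_le_div_iff₀ (mul_pos (by linarith) (by linarith)) (by nlinarith)]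
  have : LR d * (MR d ^ 2 * (LR d - 1)) ≤ LR d * (LR d * MR d * (MR d - 1)) := by
    refine mul_le_mul_of_nonneg_left ?_ (by linarith)
    nlinarith
  linarith

lemma LM_le_one (h : OKd d Δ) : LR d / MR d ≤ 1 := by
  have h1 := two_le_m h
  have h2 := M_ge h
  rw [div_le_one (by linarith)]
  unfold LR; linarith

lemma LM_nonneg (h : OKd d Δ) : 0 ≤ LR d / MR d := by
  have h1 := two_le_m h
  have h2 := M_ge h
  have h3 := L_ge h
  exact div_nonneg (by linarith) (by linarith)

lemma LM_le (h : OKd d Δ) : LR d / MR d ≤ LR d / mR d := by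
  have h1 := two_le_m h
  have h2 := M_ge h
  have h3 := L_ge h
  exact div_le_div_of_nonneg_left (by linarith) (by linarith) (by linarith)

noncomputable abbrev IS (d : Fin n → ℕ) : Finset (Fin (n - 1) → Yt d) := Inj (Fin (n - 1)) (Yt d)

lemma inj_of {S : Fin (n - 1) → Yt d} (hS : S ∈ IS d) : Function.Injective S := by
  simpa [IS, Inj] using hS

lemma SA (h : OKd d Δ) :
    ∑ S ∈ IS d, |Ap S - a0 d| ≤ (IS d).card * (LR d / MR d * (2 * √(Δ * S2 d))) := by
  have h1 := chi_pair_var (ι := Fin (n - 1)) (MR d) (LR d) (M_card h) (by rw [LR, mR_card h])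
    (card_le h) (PY d) (fun q hq => (Finset.mem_filter.1 hq).2.2) Δ (PY_fib1 h.hd h.hΔ)
    (PY_fib2 h.hd h.hΔ)
  simp only [← Ap_eq, card_PY h.hd] at h1
  have h2 := cs_abs (IS d) (fun S => Ap S - a0 d)
    (V := (LR d / MR d * (2 * √(Δ * S2 d))) ^ 2) (h1.trans ?_)
  · rw [Real.sqrt_sq] at h2
    · exact h2
    · have := LM_nonneg h; positivity
  · refine mul_le_mul_of_nonneg_left ?_ (by positivity)
    have e : (LR d / MR d * (2 * √(Δ * S2 d))) ^ 2 = (LR d / MR d) ^ 2 * (4 * Δ * S2 d) := by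
      rw [mul_pow, mul_pow, Real.sq_sqrt (mul_nonneg (by positivity) (S2_nonneg d))]; ring
    rw [e]
    refine mul_le_mul (pi2_le h) (mul_le_mul_of_nonneg_left (P2_le h) (by positivity)) ?_ (by positivity)
    exact mul_nonneg (by positivity) (P2_nonneg h)

lemma SD (h : OKd d Δ) :
    ∑ S ∈ IS d, |D1 S - LR d / MR d * S1 d| ≤ (IS d).card * √(Δ * S2 d) := by
  have h1 := chi_lin_var (ι := Fin (n - 1)) (MR d) (LR d) (M_card h) (by rw [LR, mR_card h])
    (card_le h) (fun y : Yt d => (d (yv y) : ℝ) - 1) (fun y => by linarith [d_one h (yv y)])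
  rw [sum_Yt h.hd (fun v => (d v : ℝ) - 1), sum_Yt h.hd (fun v => ((d v : ℝ) - 1) ^ 2)] at h1
  refine cs_abs (IS d) (fun S => D1 S - LR d / MR d * S1 d) (h1.trans ?_)
  refine mul_le_mul_of_nonneg_left ?_ (by positivity)
  have h2 : ∑ v, ((d v : ℝ) - 1) * ((d v : ℝ) - 1) ^ 2 ≤ Δ * S2 d := by
    unfold S2
    rw [Finset.mul_sum]
    refine Finset.sum_le_sum fun v _ => ?_
    have h1 := d_one h v
    have h2 := d_le h v
    exact mul_le_mul (by linarith) (by nlinarith) (by positivity) (by positivity)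
  calc _ ≤ 1 * ∑ v, ((d v : ℝ) - 1) * ((d v : ℝ) - 1) ^ 2 := by
        refine mul_le_mul_of_nonneg_right (LM_le_one h) (Finset.sum_nonneg fun v _ => ?_)
        have h1 := d_one h v
        exact mul_nonneg (by linarith) (by positivity)
    _ ≤ _ := by rw [one_mul]; exact h2

lemma SC1 (h : OKd d Δ) : ∑ S ∈ IS d, Cp S ≤ (IS d).card * (LR d * S2 d / mR d) := by
  have h1 := chi_lin_mean (ι := Fin (n - 1)) (MR d) (LR d) (M_card h) (by rw [LR, mR_card h])
    (card_le h) (fun y : Yt d => (d (yv y) : ℝ) - 1)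
  rw [sum_Yt h.hd (fun v => (d v : ℝ) - 1)] at h1
  refine (Finset.sum_le_sum fun S hS => Cp_le h.hd (inj_of hS)).trans (h1.le.trans ?_)
  refine mul_le_mul_of_nonneg_left ?_ (by positivity)
  rw [mul_div_right_comm]
  refine mul_le_mul (LM_le h) (S1_le h) (Finset.sum_nonneg fun v _ => mul_self_nonneg _) ?_
  exact (LM_nonneg h).trans (LM_le h)

lemma sum_fv' (h : OKd d Δ) {S : Fin (n - 1) → Yt d} (hS : S ∈ IS d) : ∑ v, fv S v = LR d := by
  rw [sum_fv h.hd (inj_of hS), LR, mR_card h, M_card h]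

lemma SC (h : OKd d Δ) :
    ∑ S ∈ IS d, |Cp S - c0 d| ≤ (IS d).card * (3 * √(Δ * S2 d)) := by
  have h1 : ∀ S ∈ IS d, |Cp S - c0 d| ≤ |D1 S - LR d / MR d * S1 d| + |Ap S - a0 d| := by
    intro S hS
    rw [Cp_eq h.hd (inj_of hS), sum_fv' h hS, c0]
    have : D1 S - Ap S - LR d - (LR d / MR d * S1 d - a0 d - LR d)
      = (D1 S - LR d / MR d * S1 d) - (Ap S - a0 d) := by ring
    rw [this]
    exact abs_sub _ _
  refine (Finset.sum_le_sum h1).trans ?_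
  rw [Finset.sum_add_distrib]
  have h2 := SD h
  have h3 := SA h
  have h4 : LR d / MR d * (2 * √(Δ * S2 d)) ≤ 1 * (2 * √(Δ * S2 d)) :=
    mul_le_mul_of_nonneg_right (LM_le_one h) (by positivity)
  have h5 := mul_le_mul_of_nonneg_left h4 (Nat.cast_nonneg (α := ℝ) (IS d).card)
  linarith

lemma card_Exec (h : OKd d Δ) : ((Exec d).card : ℝ) = (IS d).card * ((n - 1).factorial : ℝ) := by
  have h1 := sum_Exec h.hd (fun _ => 1)
  simp only [Finset.sum_const, nsmul_eq_mul, mul_one] at h1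
  rw [h1]
  simp only [card_RV (cardV h), Fintype.card_fin, Finset.sum_const, nsmul_eq_mul]

lemma exec_avg (h : OKd d Δ) (Φ : Path d → ℝ) (ψ : (Fin (n - 1) → Yt d) → ℝ) {b : ℝ}
    (h1 : ∀ S ∈ IS d, ∑ R ∈ RV (fun k => yv (S k)), Φ (mkE h.hd S R) ≤ ((n - 1).factorial : ℝ) * ψ S)
    (h2 : ∑ S ∈ IS d, ψ S ≤ (IS d).card * b) :
    ∑ E ∈ Exec d, Φ E ≤ (Exec d).card * b := by
  rw [sum_Exec h.hd, card_Exec h]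
  refine (Finset.sum_le_sum h1).trans ?_
  rw [← Finset.mul_sum]
  have := mul_le_mul_of_nonneg_left h2 (Nat.cast_nonneg (α := ℝ) (n - 1).factorial)
  linarith

lemma fact1 (h : OKd d Δ) : ((n - 1).factorial : ℝ) = mR d * ((n - 1 - 1).factorial : ℝ) := by
  have hn := h.hn
  have h1 := mR_card h
  rw [Fintype.card_fin] at h1
  rw [h1, ← Nat.mul_factorial_pred (by omega)]
  push_cast; rfl

lemma fact2 (h : OKd d Δ) :
    ((n - 1).factorial : ℝ) = mR d * (mR d - 1) * ((n - 1 - 2).factorial : ℝ) := by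
  have hn := h.hn
  have h1 := mR_card h
  rw [Fintype.card_fin] at h1
  have h2 : (n - 1 - 1).factorial = (n - 1 - 1) * (n - 1 - 2).factorial :=
    (Nat.mul_factorial_pred (by omega)).symm
  rw [fact1 h, h2, mul_assoc]
  congr 1
  push_cast
  rw [h1, Nat.cast_sub (by omega : 1 ≤ n - 1)]; simp

theorem A_bound (h : OKd d Δ) : ∑ E ∈ Exec d, |AE E - a0 d|
    ≤ (Exec d).card * (LR d * (2 * √(Δ * S2 d) / mR d + 2 * S2 d / mR d ^ 2)) := by
  have hm := two_le_m h
  refine exec_avg h _ (fun S => |Ap S - a0 d| + 2 * (Cp S / mR d)) ?_ ?_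
  · intro S hS
    have e1 : ∑ R ∈ RV (fun k => yv (S k)), ∑ v, (if ∀ k, R k ≠ v then fv S v else 0)
        = ((n - 1 - 1).factorial : ℝ) * Cp S := by
      have := RV_root (cardV h) (by simp; have := h.hn; omega) (fun k => yv (S k)) (fv S)
      rw [Fintype.card_fin] at this
      refine Eq.trans ?_ this
      congr!
    have e2 : ∀ R ∈ RV (fun k => yv (S k)), |AE (mkE h.hd S R) - a0 d|
        ≤ |Ap S - a0 d| + 2 * ∑ v, (if ∀ k, R k ≠ v then fv S v else 0) := by
      intro R _
      rw [AE_mk]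
      have h0 : 0 ≤ ∑ v, (if ∀ k, R k ≠ v then fv S v else 0) :=
        Finset.sum_nonneg fun v _ => by
          split_ifs
          · exact fv_nonneg _ _
          · exact le_rfl
      have : Ap S + 2 * ∑ v, (if ∀ k, R k ≠ v then fv S v else 0) - a0 d
        = (Ap S - a0 d) + 2 * ∑ v, (if ∀ k, R k ≠ v then fv S v else 0) := by ring
      rw [this]
      refine (abs_add_le _ _).trans ?_
      rw [abs_of_nonneg (by positivity : 0 ≤ 2 * ∑ v, (if ∀ k, R k ≠ v then fv S v else 0))]
    refine (Finset.sum_le_sum e2).trans (le_of_eq ?_)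
    rw [Finset.sum_add_distrib, ← Finset.mul_sum, e1, Finset.sum_const, card_RV (cardV h),
      nsmul_eq_mul, Fintype.card_fin]
    rw [mul_add, fact1 h]
    have : mR d ≠ 0 := by linarith
    field_simp
  · rw [Finset.sum_add_distrib, ← Finset.mul_sum, ← Finset.sum_div]
    have h1 := SA h
    have h2 := SC1 h
    have h3 : (∑ S ∈ IS d, Cp S) / mR d ≤ (IS d).card * (LR d * S2 d / mR d) / mR d :=
      div_le_div_of_nonneg_right h2 (by linarith)
    have h4 : LR d / MR d * (2 * √(Δ * S2 d)) ≤ LR d / mR d * (2 * √(Δ * S2 d)) :=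
      mul_le_mul_of_nonneg_right (LM_le h) (by positivity)
    have h5 := mul_le_mul_of_nonneg_left h4 (Nat.cast_nonneg (α := ℝ) (IS d).card)
    calc _ ≤ ((IS d).card : ℝ) * (LR d / mR d * (2 * √(Δ * S2 d)))
          + 2 * ((IS d).card * (LR d * S2 d / mR d) / mR d) := by linarith
      _ = _ := by field_simp

lemma SB (h : OKd d Δ) {S : Fin (n - 1) → Yt d} (hS : S ∈ IS d) :
    ∑ R ∈ RV (fun k => yv (S k)), |Bp S R - Cp S * LR d / mR d|
      ≤ ((n - 1).factorial : ℝ) * √(Cp S * (LR d * KK d Δ)) := by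
  have hm := two_le_m h
  have hn := h.hn
  have h1 := RV_var (cardV h) (by simp; omega) (fun k => yv (S k)) (fv S) (fv_nonneg S) (mR d)
    (Cp S) (LR d) _ _ (mR_card h) rfl (sum_fv' h hS).symm rfl rfl
  have e := card_RV (cardV h) (fun k => yv (S k))
  rw [Fintype.card_fin] at e h1
  have := cs_abs (RV (fun k => yv (S k))) (fun R => Bp S R - Cp S * LR d / mR d)
    (V := Cp S * (LR d * KK d Δ)) ?_
  · rw [e] at this; exact this
  · rw [e]
    refine h1.trans (mul_le_mul_of_nonneg_left ?_ (by positivity))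
    have hC := Cp_nonneg S
    have hL := L_ge h
    have hLS := L_le_S2 h
    have hCS : Cp S ≤ S2 d := Cp_le2 h.hd (inj_of hS)
    have hQ := Qp_le h.hd (inj_of hS) h.hΔ
    have hG := Gp_le h.hd (inj_of hS) h.hΔ
    rw [sum_fv' h hS] at hG
    have hQ0 : 0 ≤ ∑ k, fv S (yv (S k)) ^ 2 := Finset.sum_nonneg fun _ _ => by positivity
    have hG0 : 0 ≤ ∑ k, fv S k ^ 2 := Finset.sum_nonneg fun _ _ => by positivity
    have t1 : Cp S ^ 2 * LR d ^ 2 / (mR d ^ 2 * (mR d - 1))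
        ≤ Cp S * LR d * (S2 d ^ 2 / (mR d ^ 2 * (mR d - 1))) := by
      rw [← mul_div_assoc]
      refine div_le_div_of_nonneg_right ?_ (mul_nonneg (by positivity) (by linarith))
      have : Cp S * LR d ≤ S2 d ^ 2 := by nlinarith
      calc Cp S ^ 2 * LR d ^ 2 = Cp S * LR d * (Cp S * LR d) := by ring
        _ ≤ _ := mul_le_mul_of_nonneg_left this (by positivity)
    have t2 : (∑ k, fv S (yv (S k)) ^ 2) * (∑ k, fv S k ^ 2) / mR d
        ≤ Cp S * LR d * ((Δ : ℝ) ^ 2 / mR d) := by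
      rw [← mul_div_assoc]
      refine div_le_div_of_nonneg_right ?_ (by linarith)
      calc _ ≤ (Δ * Cp S) * (Δ * LR d) := mul_le_mul hQ hG hG0 (by positivity)
        _ = _ := by ring
    have t3 : 2 * Cp S * LR d * (∑ k, fv S (yv (S k)) ^ 2) / mR d ^ 2
        ≤ Cp S * LR d * (2 * S2 d * Δ / mR d ^ 2) := by
      rw [← mul_div_assoc]
      refine div_le_div_of_nonneg_right ?_ (by positivity)
      calc 2 * Cp S * LR d * (∑ k, fv S (yv (S k)) ^ 2) ≤ 2 * Cp S * LR d * (Δ * S2 d) :=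
            mul_le_mul_of_nonneg_left (hQ.trans (mul_le_mul_of_nonneg_left hCS (by positivity)))
              (by positivity)
        _ = _ := by ring
    unfold KK
    have := add_le_add (add_le_add t1 t2) t3
    refine this.trans (le_of_eq (by ring))

theorem B_bound (h : OKd d Δ) (x : ℝ) : ∑ E ∈ Exec d, |BE E - x|
    ≤ (Exec d).card * (LR d * √(S2 d / mR d * KK d Δ) + LR d * (3 * √(Δ * S2 d) / mR d)
      + |c0 d * LR d / mR d - x| + LR d * (2 * S2 d / (mR d * (mR d - 1)))) := by
  have hm := two_le_m h
  have hL := L_ge h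
  have hS2 := S2_nonneg d
  have hK : 0 ≤ KK d Δ := by
    unfold KK
    have : 0 ≤ mR d - 1 := by linarith
    have : 0 ≤ mR d := by linarith
    positivity
  have hn := h.hn
  refine exec_avg h _ (fun S => √(Cp S * (LR d * KK d Δ)) + |Cp S - c0 d| * (LR d / mR d)
    + |c0 d * LR d / mR d - x| + (LR d * S2 d + mR d * Cp S) / (mR d * (mR d - 1))) ?_ ?_
  · intro S hS
    have e1 := RV_root_children (cardV h) (by simp; omega) (fun k => yv (S k)) (fv S) (fv_nonneg S)
    rw [sum_fv' h hS, ← mR_card h, Fintype.card_fin] at e1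
    have e1' : ∑ R ∈ RV (fun k => yv (S k)), ∑ k, (if ∀ j, R j ≠ yv (S k) then fv S (R k) else 0)
        ≤ ((n - 1).factorial : ℝ) * ((LR d * S2 d + mR d * Cp S) / (mR d * (mR d - 1))) := by
      refine le_trans (le_of_eq (by congr!)) (e1.trans ?_)
      have : ((n - 1).factorial : ℝ) * ((LR d * S2 d + mR d * Cp S) / (mR d * (mR d - 1)))
          = ((n - 1 - 2).factorial : ℝ) * (LR d * S2 d + mR d * Cp S) := by
        rw [fact2 h]
        have h1 : mR d ≠ 0 := by linarith
        have h2 : mR d - 1 ≠ 0 := by linarith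
        field_simp
      rw [this]
      refine mul_le_mul_of_nonneg_left (add_le_add ?_ le_rfl) (by positivity)
      exact mul_le_mul_of_nonneg_left (ccp_le h.hd (inj_of hS)) (by linarith)
    have e2 : ∀ R ∈ RV (fun k => yv (S k)), |BE (mkE h.hd S R) - x|
        ≤ |Bp S R - Cp S * LR d / mR d| + (|Cp S - c0 d| * (LR d / mR d)
            + |c0 d * LR d / mR d - x|)
          + ∑ k, (if ∀ j, R j ≠ yv (S k) then fv S (R k) else 0) := by
      intro R hR
      rw [BE_mk h.hd (inj_of hS) hR]
      set g := ∑ k, (if ∀ j, R j ≠ yv (S k) then fv S (R k) else 0) with hg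
      have h0 : 0 ≤ g :=
        Finset.sum_nonneg fun v _ => by
          split_ifs
          · exact fv_nonneg _ _
          · exact le_rfl
      have h2 : |Cp S - c0 d| * (LR d / mR d) = |(Cp S - c0 d) * (LR d / mR d)| := by
        rw [abs_mul, abs_of_nonneg (div_nonneg (by linarith) (by linarith) : 0 ≤ LR d / mR d)]
      rw [h2]
      have : Bp S R + g - x = (Bp S R - Cp S * LR d / mR d) + ((Cp S - c0 d) * (LR d / mR d)
          + (c0 d * LR d / mR d - x)) + g := by ring
      rw [this]
      refine (abs_add_le _ _).trans ?_
      rw [abs_of_nonneg h0]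
      refine add_le_add ((abs_add_le _ _).trans (add_le_add le_rfl (abs_add_le _ _))) le_rfl
    refine (Finset.sum_le_sum e2).trans ?_
    rw [Finset.sum_add_distrib, Finset.sum_add_distrib, Finset.sum_const, card_RV (cardV h),
      nsmul_eq_mul, Fintype.card_fin]
    have e3 := SB h hS
    linarith
  · rw [Finset.sum_add_distrib, Finset.sum_add_distrib, Finset.sum_add_distrib, Finset.sum_const,
      nsmul_eq_mul, ← Finset.sum_mul, ← Finset.sum_div, Finset.sum_add_distrib, Finset.sum_const,
      nsmul_eq_mul, ← Finset.mul_sum]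
    have hC := SC1 h
    have h1 : ∑ S ∈ IS d, √(Cp S * (LR d * KK d Δ))
        ≤ (IS d).card * (LR d * √(S2 d / mR d * KK d Δ)) := by
      have := cs_abs (IS d) (fun S => √(Cp S * (LR d * KK d Δ)))
        (V := LR d ^ 2 * (S2 d / mR d * KK d Δ)) ?_
      · rw [Real.sqrt_mul (by positivity), Real.sqrt_sq (by linarith)] at this
        refine le_trans (le_of_eq ?_) this
        exact Finset.sum_congr rfl fun S _ => (abs_of_nonneg (Real.sqrt_nonneg _)).symm
      · have e : ∀ S ∈ IS d, √(Cp S * (LR d * KK d Δ)) ^ 2 = Cp S * (LR d * KK d Δ) := fun S _ =>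
          Real.sq_sqrt (mul_nonneg (Cp_nonneg S) (by positivity))
        rw [Finset.sum_congr rfl e, ← Finset.sum_mul]
        refine (mul_le_mul_of_nonneg_right hC (by positivity)).trans (le_of_eq (by ring))
    have h2 : (∑ S ∈ IS d, |Cp S - c0 d|) * (LR d / mR d)
        ≤ (IS d).card * (LR d * (3 * √(Δ * S2 d) / mR d)) := by
      refine (mul_le_mul_of_nonneg_right (SC h) (div_nonneg (by linarith) (by linarith))).trans
        (le_of_eq (by ring))
    have h3 : ((IS d).card * (LR d * S2 d) + mR d * ∑ S ∈ IS d, Cp S) / (mR d * (mR d - 1))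
        ≤ (IS d).card * (LR d * (2 * S2 d / (mR d * (mR d - 1)))) := by
      have : (IS d).card * (LR d * (2 * S2 d / (mR d * (mR d - 1))))
        = ((IS d).card * (LR d * S2 d) + mR d * ((IS d).card * (LR d * S2 d / mR d)))
          / (mR d * (mR d - 1)) := by
        have h1 : mR d ≠ 0 := by linarith
        field_simp; ring
      rw [this]
      refine div_le_div_of_nonneg_right ?_ (mul_nonneg (by linarith) (by linarith))
      exact add_le_add le_rfl (mul_le_mul_of_nonneg_left hC (by linarith))
    linarith

end EB

section LIM
variable {dseq : (n : ℕ) → Fin n → ℕ}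

lemma sum_trunc {n : ℕ} (d : Fin n → ℕ) (g : ℕ → ℝ) (K : ℕ) :
    ∑ k ∈ Finset.range K, g k * (Nat.card {i : Fin n // d i = k} : ℝ)
      = ∑ i, if d i < K then g (d i) else 0 := by
  have : ∀ k, g k * (Nat.card {i : Fin n // d i = k} : ℝ) = ∑ i, if d i = k then g k else 0 := by
    intro k
    rw [Nat.card_eq_fintype_card, Fintype.card_subtype, Finset.card_filter]
    push_cast
    rw [Finset.mul_sum]
    exact Finset.sum_congr rfl fun i _ => by split_ifs <;> simp
  simp_rw [this]
  rw [Finset.sum_comm]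
  refine Finset.sum_congr rfl fun i _ => ?_
  simp [Finset.sum_ite_eq]

noncomputable def mxd {n : ℕ} (d : Fin n → ℕ) : ℕ := Finset.univ.sup d

lemma le_mxd {n : ℕ} (d : Fin n → ℕ) (i : Fin n) : d i ≤ mxd d := Finset.le_sup (Finset.mem_univ i)

lemma trunc_tendsto {p : ℕ → ℝ} (hpconv : ∀ k : ℕ, Tendsto
      (fun n => (Nat.card {i : Fin n // dseq n i = k} : ℝ) / n) atTop (nhds (p k))) (g : ℕ → ℝ) (K : ℕ) :
    Tendsto (fun n => (∑ i, if dseq n i < K then g (dseq n i) else 0) / n) atTop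
      (nhds (∑ k ∈ Finset.range K, g k * p k)) := by
  have := tendsto_finsetSum (Finset.range K) (fun k _ => (hpconv k).const_mul (g k))
  refine this.congr fun n => ?_
  rw [← sum_trunc, Finset.sum_div]
  exact Finset.sum_congr rfl fun k _ => by ring

lemma mean_tendsto {p : ℕ → ℝ} (hpnn : ∀ k, 0 ≤ p k) {μ2 : ℝ}
    (hμ2 : HasSum (fun k : ℕ => (k : ℝ) ^ 2 * p k) μ2)
    (hpconv : ∀ k : ℕ, Tendsto
      (fun n => (Nat.card {i : Fin n // dseq n i = k} : ℝ) / n) atTop (nhds (p k)))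
    (hμ2conv : Tendsto (fun n => (∑ i, (dseq n i : ℝ) ^ 2) / n) atTop (nhds μ2)) :
    HasSum (fun k : ℕ => (k : ℝ) * p k) (mu1 p) ∧
    Tendsto (fun n => (∑ i, (dseq n i : ℝ)) / n) atTop (nhds (mu1 p)) := by
  have hsum : Summable (fun k : ℕ => (k : ℝ) * p k) := by
    refine Summable.of_nonneg_of_le (fun k => mul_nonneg (by positivity) (hpnn k)) (fun k => ?_) hμ2.summable
    refine mul_le_mul_of_nonneg_right ?_ (hpnn k)
    rcases Nat.eq_zero_or_pos k with rfl | hk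
    · simp
    · have : (1 : ℝ) ≤ k := by exact_mod_cast hk
      nlinarith
  have hs : HasSum (fun k : ℕ => (k : ℝ) * p k) (mu1 p) := hsum.hasSum
  refine ⟨hs, ?_⟩
  have hnn : 0 ≤ μ2 := hμ2.nonneg fun k => mul_nonneg (by positivity) (hpnn k)
  rw [Metric.tendsto_atTop]
  intro ε hε
  obtain ⟨K, hK⟩ := exists_nat_gt ((4 * (μ2 + 1)) / ε)
  have hK0 : (0 : ℝ) < K := lt_trans (by positivity) hK
  have hKe : (μ2 + 1) / K < ε / 4 := by
    rw [div_lt_iff₀ hK0]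
    rw [div_lt_iff₀ hε] at hK
    linarith
  have hpt : |mu1 p - ∑ k ∈ Finset.range K, (k : ℝ) * p k| ≤ μ2 / K := by
    have h1 : ∑ k ∈ Finset.range K, (k : ℝ) * p k ≤ mu1 p :=
      sum_le_hasSum _ (fun k _ => mul_nonneg (by positivity) (hpnn k)) hs
    rw [abs_of_nonneg (by linarith)]
    have h2 := (hasSum_nat_add_iff' (f := fun k : ℕ => (k : ℝ) * p k) K).2 hs
    have h3 := (hasSum_nat_add_iff' (f := fun k : ℕ => (k : ℝ) ^ 2 * p k) K).2 hμ2
    have h4 := hasSum_le (fun k => ?_) h2 (h3.div_const (K : ℝ))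
    · refine h4.trans (div_le_div_of_nonneg_right ?_ hK0.le)
      have : 0 ≤ ∑ k ∈ Finset.range K, (k : ℝ) ^ 2 * p k :=
        Finset.sum_nonneg fun k _ => mul_nonneg (by positivity) (hpnn k)
      linarith
    · rw [le_div_iff₀ hK0]
      push_cast
      have hk : (0 : ℝ) ≤ k := by positivity
      have := hpnn (k + K)
      have : ((k : ℝ) + K) * K ≤ (k + K) ^ 2 := by nlinarith
      calc ((k : ℝ) + K) * p (k + K) * K = (((k : ℝ) + K) * K) * p (k + K) := by ring
        _ ≤ _ := mul_le_mul_of_nonneg_right this (hpnn _)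
  have ev1 := (Metric.tendsto_atTop.1 (trunc_tendsto hpconv (fun k => (k : ℝ)) K)) (ε / 4) (by positivity)
  have ev2 := (Metric.tendsto_atTop.1 hμ2conv) 1 one_pos
  obtain ⟨N1, h1⟩ := ev1
  obtain ⟨N2, h2⟩ := ev2
  refine ⟨max N1 N2, fun n hn => ?_⟩
  have e1 := h1 n (le_trans (le_max_left _ _) hn)
  have e2 := h2 n (le_trans (le_max_right _ _) hn)
  rw [Real.dist_eq] at e1 e2 ⊢
  have e3 : |(∑ i, (dseq n i : ℝ)) / n - (∑ i, if dseq n i < K then (dseq n i : ℝ) else 0) / n|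
      ≤ (∑ i, (dseq n i : ℝ) ^ 2) / n / K := by
    rw [← sub_div, ← Finset.sum_sub_distrib]
    rw [abs_of_nonneg]
    · rw [div_right_comm]
      refine div_le_div_of_nonneg_right ?_ (by positivity)
      rw [Finset.sum_div]
      refine Finset.sum_le_sum fun i _ => ?_
      split_ifs with h
      · simp; positivity
      · rw [sub_zero, le_div_iff₀ hK0, sq]
        have : (K : ℝ) ≤ dseq n i := by exact_mod_cast not_lt.1 h
        exact mul_le_mul_of_nonneg_left this (by positivity)
    · refine div_nonneg (Finset.sum_nonneg fun i _ => ?_) (by positivity)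
      split_ifs <;> simp
  have e4 : (∑ i, (dseq n i : ℝ) ^ 2) / n / K ≤ (μ2 + 1) / K := by
    refine div_le_div_of_nonneg_right ?_ hK0.le
    have := (abs_lt.1 e2).2
    linarith
  have e5 : μ2 / K ≤ (μ2 + 1) / K := div_le_div_of_nonneg_right (by linarith) hK0.le
  have e6 := abs_sub_comm (mu1 p) (∑ k ∈ Finset.range K, (k : ℝ) * p k)
  have e7 : |(∑ i, (dseq n i : ℝ)) / n - mu1 p|
    ≤ |(∑ i, (dseq n i : ℝ)) / n - (∑ i, if dseq n i < K then (dseq n i : ℝ) else 0) / n|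
      + |(∑ i, if dseq n i < K then (dseq n i : ℝ) else 0) / n - ∑ k ∈ Finset.range K, (k : ℝ) * p k|
      + |∑ k ∈ Finset.range K, (k : ℝ) * p k - mu1 p| := by
    refine le_trans (abs_sub_le _ _ _) (add_le_add (abs_sub_le _ _ _) le_rfl)
  linarith

lemma mxd_tendsto {p : ℕ → ℝ} {μ2 : ℝ}
    (hμ2 : HasSum (fun k : ℕ => (k : ℝ) ^ 2 * p k) μ2)
    (hpconv : ∀ k : ℕ, Tendsto
      (fun n => (Nat.card {i : Fin n // dseq n i = k} : ℝ) / n) atTop (nhds (p k)))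
    (hμ2conv : Tendsto (fun n => (∑ i, (dseq n i : ℝ) ^ 2) / n) atTop (nhds μ2)) :
    Tendsto (fun n => (mxd (dseq n) : ℝ) ^ 2 / n) atTop (nhds 0) := by
  rw [Metric.tendsto_atTop]
  intro ε hε
  obtain ⟨K, hK⟩ := ((Metric.tendsto_atTop.1 hμ2.tendsto_sum_nat) (ε / 2) (by positivity))
  have hK := hK K le_rfl
  rw [Real.dist_eq] at hK
  have hK' : μ2 - ∑ k ∈ Finset.range K, (k : ℝ) ^ 2 * p k < ε / 2 := by
    have := (abs_lt.1 hK).1; linarith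
  have t1 : Tendsto (fun n : ℕ => (K : ℝ) ^ 2 / n + ((∑ i, (dseq n i : ℝ) ^ 2) / n
      - (∑ i, if dseq n i < K then (dseq n i : ℝ) ^ 2 else 0) / n)) atTop
      (nhds (0 + (μ2 - ∑ k ∈ Finset.range K, (k : ℝ) ^ 2 * p k))) :=
    (tendsto_const_div_atTop_nhds_zero_nat _).add
      (hμ2conv.sub (trunc_tendsto hpconv (fun k => (k : ℝ) ^ 2) K))
  have t2 := t1.eventually_lt_const (u := ε) (by linarith)
  rw [eventually_atTop] at t2
  obtain ⟨N, hN⟩ := t2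
  refine ⟨max N 1, fun n hn => ?_⟩
  rw [Real.dist_eq, sub_zero, abs_of_nonneg (by positivity)]
  refine lt_of_le_of_lt ?_ (hN n (le_trans (le_max_left _ _) hn))
  rw [← sub_div, ← add_div]
  refine div_le_div_of_nonneg_right ?_ (by positivity)
  have hn1 : 1 ≤ n := le_trans (le_max_right _ _) hn
  have : Nonempty (Fin n) := ⟨⟨0, hn1⟩⟩
  obtain ⟨i, -, hi⟩ := Finset.exists_mem_eq_sup (Finset.univ : Finset (Fin n)) Finset.univ_nonempty (dseq n)
  have hi' : mxd (dseq n) = dseq n i := hi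
  rw [hi', ← Finset.sum_sub_distrib]
  have hnn : ∀ j ∈ (Finset.univ : Finset (Fin n)),
      0 ≤ (dseq n j : ℝ) ^ 2 - (if dseq n j < K then (dseq n j : ℝ) ^ 2 else 0) := by
    intro j _
    split_ifs <;> simp
  by_cases h : dseq n i < K
  · have h1 : (dseq n i : ℝ) ≤ K := by exact_mod_cast h.le
    have h2 := Finset.sum_nonneg hnn
    have h3 : (dseq n i : ℝ) ^ 2 ≤ (K : ℝ) ^ 2 := by gcongr
    linarith
  · have h2 := Finset.single_le_sum hnn (Finset.mem_univ i)
    rw [if_neg h, sub_zero] at h2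
    have : 0 ≤ (K : ℝ) ^ 2 := by positivity
    linarith

end LIM

noncomputable def Nu (μ μ2 : ℝ) : ℝ := (μ - 2) * (μ2 - 3 * μ + 2) / (μ - 1) ^ 2

noncomputable def errA {n : ℕ} (d : Fin n → ℕ) (Δ : ℕ) (ν : ℝ) : ℝ :=
  2 * √(Δ * S2 d) / mR d + 2 * S2 d / mR d ^ 2 + |a0 d / (LR d + 1) - ν|
noncomputable def errB {n : ℕ} (d : Fin n → ℕ) (Δ : ℕ) (ν : ℝ) : ℝ :=
  √(S2 d / mR d * KK d Δ) + 3 * √(Δ * S2 d) / mR d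
      + |c0 d * LR d / mR d / (LR d + 1) - ν| + 2 * S2 d / (mR d * (mR d - 1))

structure Lims (dseq : (n : ℕ) → Fin n → ℕ) (μ μ2 : ℝ) : Prop where
  hd : ∀ n i, 1 ≤ dseq n i
  hge : ∀ n, 2 * n ≤ ∑ i, dseq n i
  s1 : Tendsto (fun n => (∑ i, (dseq n i : ℝ)) / n) atTop (nhds μ)
  s2 : Tendsto (fun n => (∑ i, (dseq n i : ℝ) ^ 2) / n) atTop (nhds μ2)
  sΔ : Tendsto (fun n => (mxd (dseq n) : ℝ) ^ 2 / n) atTop (nhds 0)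
  hμ : 2 ≤ μ

section LL
variable {dseq : (n : ℕ) → Fin n → ℕ} {μ μ2 : ℝ}

lemma Lims.ok (h : Lims dseq μ μ2) {n : ℕ} (hn : 3 ≤ n) : OKd (dseq n) (mxd (dseq n)) :=
  ⟨h.hd n, hn, h.hge n, le_mxd _⟩

lemma inv_n : Tendsto (fun n : ℕ => 1 / (n : ℝ)) atTop (nhds 0) := tendsto_const_div_atTop_nhds_zero_nat 1

lemma ev_pos : ∀ᶠ n : ℕ in atTop, (n : ℝ) ≠ 0 ∧ 3 ≤ n := by
  filter_upwards [eventually_ge_atTop 3] with n hn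
  refine ⟨?_, hn⟩
  have : (3 : ℝ) ≤ n := by exact_mod_cast hn
  linarith

lemma lim_m : Tendsto (fun n => mR (dseq n) / n) atTop (nhds 1) := by
  have : Tendsto (fun n : ℕ => 1 - 1 / (n : ℝ)) atTop (nhds (1 - 0)) := tendsto_const_nhds.sub inv_n
  rw [sub_zero] at this
  refine this.congr' ?_
  filter_upwards [ev_pos] with n hn
  have := hn.1
  unfold mR; field_simp

lemma lim_sub1 {X : ℕ → ℝ} {x : ℝ} (hX : Tendsto (fun n => X n / n) atTop (nhds x)) :
    Tendsto (fun n => (X n - 1) / n) atTop (nhds x) := by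
  have := hX.sub inv_n
  rw [sub_zero] at this
  exact this.congr fun n => by ring

lemma Lims.M (h : Lims dseq μ μ2) : Tendsto (fun n => MR (dseq n) / n) atTop (nhds (μ - 1)) := by
  refine (h.s1.sub_const 1).congr' ?_
  filter_upwards [ev_pos] with n hn
  have := hn.1
  rw [M_eq]; field_simp

lemma Lims.L (h : Lims dseq μ μ2) : Tendsto (fun n => LR (dseq n) / n) atTop (nhds (μ - 2)) := by
  have := h.M.sub (lim_m (dseq := dseq))
  have e : μ - 1 - 1 = μ - 2 := by ring
  rw [e] at this
  exact this.congr fun n => by unfold LR; ring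

lemma Lims.P (h : Lims dseq μ μ2) :
    Tendsto (fun n => P2 (dseq n) / n) atTop (nhds (μ2 - 3 * μ + 2)) := by
  refine ((h.s2.sub (h.s1.const_mul 3)).add_const 2).congr' ?_
  filter_upwards [ev_pos] with n hn
  have hn0 := hn.1
  have : P2 (dseq n) = ∑ i, (dseq n i : ℝ) ^ 2 - 3 * ∑ i, (dseq n i : ℝ) + 2 * n := by
    have e : (2 * n : ℝ) = ∑ _i : Fin n, (2 : ℝ) := by simp [mul_comm]
    rw [e, Finset.mul_sum, ← Finset.sum_sub_distrib, ← Finset.sum_add_distrib]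
    exact Finset.sum_congr rfl fun i _ => by ring
  rw [this]; field_simp

lemma Lims.S1 (h : Lims dseq μ μ2) :
    Tendsto (fun n => S1 (dseq n) / n) atTop (nhds (μ2 - 2 * μ + 1)) := by
  refine ((h.s2.sub (h.s1.const_mul 2)).add_const 1).congr' ?_
  filter_upwards [ev_pos] with n hn
  have hn0 := hn.1
  have : TWG.S1 (dseq n) = ∑ i, (dseq n i : ℝ) ^ 2 - 2 * ∑ i, (dseq n i : ℝ) + n := by
    have e : (n : ℝ) = ∑ _i : Fin n, (1 : ℝ) := by simp
    conv_rhs => rw [e]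
    rw [Finset.mul_sum, ← Finset.sum_sub_distrib, ← Finset.sum_add_distrib]
    exact Finset.sum_congr rfl fun i _ => by ring
  rw [this]; field_simp

lemma Lims.D (h : Lims dseq μ μ2) : Tendsto (fun n => (mxd (dseq n) : ℝ) / n) atTop (nhds 0) := by
  refine tendsto_of_tendsto_of_tendsto_of_le_of_le tendsto_const_nhds h.sΔ
    (fun n => by positivity) (fun n => ?_)
  refine div_le_div_of_nonneg_right ?_ (by positivity)
  have h0 : mxd (dseq n) ≤ mxd (dseq n) ^ 2 := Nat.le_self_pow (by norm_num) _
  have h1 : (mxd (dseq n) : ℝ) ≤ (mxd (dseq n) : ℝ) ^ 2 := by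
    have := (Nat.cast_le (α := ℝ)).2 h0
    rwa [Nat.cast_pow] at this
  exact h1

lemma Lims.sq0 (h : Lims dseq μ μ2) :
    Tendsto (fun n => √(mxd (dseq n) * S2 (dseq n)) / mR (dseq n)) atTop (nhds 0) := by
  have h1 : Tendsto (fun n => √(mxd (dseq n) / n * (S2 (dseq n) / n)) / (mR (dseq n) / n)) atTop
      (nhds (√(0 * μ2) / 1)) :=
    ((Real.continuous_sqrt.tendsto _).comp (h.D.mul h.s2)).div lim_m one_ne_zero
  rw [zero_mul, Real.sqrt_zero, zero_div] at h1
  refine h1.congr' ?_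
  filter_upwards [ev_pos] with n hn
  have hn0 := hn.1
  have : (mxd (dseq n) / n * (S2 (dseq n) / n) : ℝ) = (mxd (dseq n) * S2 (dseq n)) / (n : ℝ) ^ 2 := by
    field_simp
  rw [this, Real.sqrt_div' _ (by positivity), Real.sqrt_sq (by positivity)]
  field_simp

lemma Lims.S2m (h : Lims dseq μ μ2) :
    Tendsto (fun n => S2 (dseq n) / mR (dseq n)) atTop (nhds μ2) := by
  have := h.s2.div (lim_m (dseq := dseq)) one_ne_zero
  rw [div_one] at this
  refine this.congr' ?_
  filter_upwards [ev_pos] with n hn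
  have hn0 := hn.1
  unfold S2
  simp only [Pi.div_apply]
  field_simp

lemma lim_minv (c : ℝ) : Tendsto (fun n => 1 / (mR (dseq n) - c)) atTop (nhds 0) := by
  have h : Tendsto (fun n : ℕ => (n : ℝ)) atTop atTop := tendsto_natCast_atTop_atTop
  have := tendsto_atTop_add_const_right atTop (-(1 + c)) h
  refine this.inv_tendsto_atTop.congr fun n => ?_
  simp only [Pi.inv_apply, one_div, mR]
  congr 1; ring

lemma Lims.S2mm (h : Lims dseq μ μ2) :
    Tendsto (fun n => 2 * S2 (dseq n) / mR (dseq n) ^ 2) atTop (nhds 0) := by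
  have := (h.S2m.const_mul 2).mul (lim_minv (dseq := dseq) 0)
  rw [mul_zero] at this
  refine this.congr fun n => ?_
  rw [sub_zero]; ring

lemma Lims.S2mm' (h : Lims dseq μ μ2) :
    Tendsto (fun n => 2 * S2 (dseq n) / (mR (dseq n) * (mR (dseq n) - 1))) atTop (nhds 0) := by
  have := (h.S2m.const_mul 2).mul (lim_minv (dseq := dseq) 1)
  rw [mul_zero] at this
  refine this.congr fun n => ?_
  rw [← mul_div_assoc 2, div_mul_div_comm, mul_one]

lemma Lims.K (h : Lims dseq μ μ2) :
    Tendsto (fun n => √(S2 (dseq n) / mR (dseq n) * KK (dseq n) (mxd (dseq n)))) atTop (nhds 0) := by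
  have hD : Tendsto (fun n => (mxd (dseq n) : ℝ) ^ 2 / mR (dseq n)) atTop (nhds 0) := by
    have := h.sΔ.div (lim_m (dseq := dseq)) one_ne_zero
    rw [zero_div] at this
    refine this.congr' ?_
    filter_upwards [ev_pos] with n hn
    have hn0 := hn.1
    simp only [Pi.div_apply]
    field_simp
  have hD1 : Tendsto (fun n => (mxd (dseq n) : ℝ) / mR (dseq n)) atTop (nhds 0) := by
    have := h.D.div (lim_m (dseq := dseq)) one_ne_zero
    rw [zero_div] at this
    refine this.congr' ?_
    filter_upwards [ev_pos] with n hn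
    have hn0 := hn.1
    simp only [Pi.div_apply]
    field_simp
  have hK : Tendsto (fun n => KK (dseq n) (mxd (dseq n))) atTop (nhds (μ2 ^ 2 * 0 + 0 + 2 * μ2 * 0)) := by
    refine ((((h.S2m.pow 2).mul (lim_minv (dseq := dseq) 1)).add hD).add ((h.S2m.const_mul 2).mul hD1)).congr fun n => ?_
    unfold KK
    congr 1
    · congr 1
      rw [div_pow, div_mul_div_comm, mul_one]
    · rw [← mul_div_assoc 2, div_mul_div_comm, sq]
  have := (Real.continuous_sqrt.tendsto _).comp (h.S2m.mul hK)
  have e : √(μ2 * (μ2 ^ 2 * 0 + 0 + 2 * μ2 * 0)) = 0 := by simp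
  rw [e] at this
  exact this

lemma Lims.LL (h : Lims dseq μ μ2) :
    Tendsto (fun n => LR (dseq n) * (LR (dseq n) - 1) / (LR (dseq n) + 1) / n) atTop (nhds (μ - 2)) := by
  have h1 : Tendsto (fun n => 2 * LR (dseq n) / (LR (dseq n) + 1) / n) atTop (nhds 0) := by
    refine tendsto_of_tendsto_of_tendsto_of_le_of_le' tendsto_const_nhds
      (tendsto_const_div_atTop_nhds_zero_nat 2) ?_ ?_
    · filter_upwards [ev_pos] with n hn
      have := L_ge (h.ok hn.2)
      positivity
    · filter_upwards [ev_pos] with n hn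
      have := L_ge (h.ok hn.2)
      refine div_le_div_of_nonneg_right ?_ (by positivity)
      rw [div_le_iff₀ (by linarith)]; linarith
  have := h.L.sub h1
  rw [sub_zero] at this
  refine this.congr' ?_
  filter_upwards [ev_pos] with n hn
  have := L_ge (h.ok hn.2)
  have h2 : LR (dseq n) + 1 ≠ 0 := by linarith
  rw [← sub_div]
  congr 1
  field_simp
  ring

lemma Lims.a0 (h : Lims dseq μ μ2) :
    Tendsto (fun n => a0 (dseq n) / (LR (dseq n) + 1)) atTop (nhds (Nu μ μ2)) := by
  have hμ := h.hμ
  have := (h.LL.mul h.P).div (h.M.mul (lim_sub1 h.M)) (mul_ne_zero (by linarith) (by linarith))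
  rw [← sq] at this
  refine this.congr' ?_
  filter_upwards [ev_pos] with n hn
  have hn0 := hn.1
  have ok := h.ok hn.2
  have h1 := L_ge ok
  have h2 := M_ge ok
  have h3 := two_le_m ok
  have e1 : LR (dseq n) + 1 ≠ 0 := by linarith
  have e2 : MR (dseq n) ≠ 0 := by linarith
  have e3 : MR (dseq n) - 1 ≠ 0 := by linarith
  unfold TWG.a0
  simp only [Pi.div_apply]
  field_simp

lemma Lims.c0 (h : Lims dseq μ μ2) :
    Tendsto (fun n => c0 (dseq n) / mR (dseq n)) atTop (nhds (Nu μ μ2)) := by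
  have hμ := h.hμ
  have t1 := ((h.L.mul (lim_sub1 h.L)).mul h.P).div (h.M.mul (lim_sub1 h.M))
    (mul_ne_zero (by linarith) (by linarith))
  have t2 := (h.L.mul h.S1).div h.M (by linarith)
  have := ((t2.sub t1).sub h.L).div (lim_m (dseq := dseq)) one_ne_zero
  have e : ((μ - 2) * (μ2 - 2 * μ + 1) / (μ - 1) - (μ - 2) * (μ - 2) * (μ2 - 3 * μ + 2)
      / ((μ - 1) * (μ - 1)) - (μ - 2)) / 1 = Nu μ μ2 := by
    have : μ - 1 ≠ 0 := by linarith
    unfold Nu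
    field_simp
    ring
  rw [e] at this
  refine this.congr' ?_
  filter_upwards [ev_pos] with n hn
  have hn0 := hn.1
  have ok := h.ok hn.2
  have h1 := L_ge ok
  have h2 := M_ge ok
  have h3 := two_le_m ok
  have e2 : MR (dseq n) ≠ 0 := by linarith
  have e3 : MR (dseq n) - 1 ≠ 0 := by linarith
  have e4 : mR (dseq n) ≠ 0 := by linarith
  unfold TWG.c0 TWG.a0
  simp only [Pi.div_apply]
  field_simp

lemma Lims.Linf (h : Lims dseq μ μ2) (h2 : 2 < μ) : Tendsto (fun n => LR (dseq n) + 1) atTop atTop := by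
  have h1 : Tendsto (fun n : ℕ => (n : ℝ)) atTop atTop := tendsto_natCast_atTop_atTop
  have := h.L.pos_mul_atTop (by linarith) h1
  refine (tendsto_atTop_add_const_right atTop 1 this).congr' ?_
  filter_upwards [ev_pos] with n hn
  have hn0 := hn.1
  field_simp

lemma Lims.nuN (h : Lims dseq μ μ2) :
    Tendsto (fun n => Nu μ μ2 / (LR (dseq n) + 1)) atTop (nhds 0) := by
  rcases h.hμ.eq_or_lt with h2 | h2
  · have : Nu μ μ2 = 0 := by unfold Nu; rw [← h2]; simp
    simp [this]
  · exact (h.Linf h2).const_div_atTop _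

lemma Lims.cL (h : Lims dseq μ μ2) :
    Tendsto (fun n => TWG.c0 (dseq n) * LR (dseq n) / mR (dseq n) / (LR (dseq n) + 1)) atTop
      (nhds (Nu μ μ2)) := by
  have h1 : Tendsto (fun n => (TWG.c0 (dseq n) / mR (dseq n) - Nu μ μ2) * (LR (dseq n) / (LR (dseq n) + 1)))
      atTop (nhds 0) := by
    have t := h.c0.sub_const (Nu μ μ2)
    rw [sub_self] at t
    have t2 := t.abs
    rw [abs_zero] at t2
    refine squeeze_zero_norm' ?_ t2
    filter_upwards [ev_pos] with n hn
    have := L_ge (h.ok hn.2)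
    rw [Real.norm_eq_abs, abs_mul]
    refine mul_le_of_le_one_right (abs_nonneg _) ?_
    rw [abs_of_nonneg (by positivity), div_le_one (by linarith)]
    linarith
  have := (h1.sub h.nuN).add_const (Nu μ μ2)
  rw [sub_zero, zero_add] at this
  refine this.congr' ?_
  filter_upwards [ev_pos] with n hn
  have h1 := L_ge (h.ok hn.2)
  have e1 : LR (dseq n) + 1 ≠ 0 := by linarith
  have h3 := two_le_m (h.ok hn.2)
  have e4 : mR (dseq n) ≠ 0 := by linarith
  field_simp
  ring

lemma Lims.errA (h : Lims dseq μ μ2) :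
    Tendsto (fun n => errA (dseq n) (mxd (dseq n)) (Nu μ μ2)) atTop (nhds 0) := by
  have t := (h.a0.sub_const (Nu μ μ2)).abs
  rw [sub_self, abs_zero] at t
  have := ((h.sq0.const_mul 2).add h.S2mm).add t
  rw [mul_zero, add_zero, add_zero] at this
  refine this.congr fun n => ?_
  unfold TWG.errA
  ring

lemma Lims.errB (h : Lims dseq μ μ2) :
    Tendsto (fun n => errB (dseq n) (mxd (dseq n)) (Nu μ μ2)) atTop (nhds 0) := by
  have t := (h.cL.sub_const (Nu μ μ2)).abs
  rw [sub_self, abs_zero] at t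
  have := ((h.K.add (h.sq0.const_mul 3)).add t).add h.S2mm'
  rw [mul_zero, add_zero, add_zero, add_zero] at this
  refine this.congr fun n => ?_
  unfold TWG.errB
  ring

end LL

section AV
variable {n : ℕ} {d : Fin n → ℕ} {Δ : ℕ}

lemma NE_eq (h : OKd d Δ) {E : Path d} (hE : IsExecPath d E) : NE E = LR d + 1 := by
  have h1 := card_Fr hE
  have h2 := h.hn
  have h3 : (NE E) + 2 * mR d = ∑ v, (d v : ℝ) := by
    rw [mR_card h, Fintype.card_fin]
    unfold NE
    exact_mod_cast h1
  unfold LR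
  rw [M_eq]
  unfold mR at *
  linarith

theorem A_err (h : OKd d Δ) (ν : ℝ) :
    ∑ E ∈ Exec d, |AE E / NE E - ν| ≤ (Exec d).card * errA d Δ ν := by
  have hL := L_ge h
  have hm := two_le_m h
  have h1 : ∀ E ∈ Exec d, |AE E / NE E - ν| ≤ |AE E - a0 d| / (LR d + 1) + |a0 d / (LR d + 1) - ν| := by
    intro E hE
    rw [NE_eq h (mem_Exec.1 hE)]
    have : |AE E - a0 d| / (LR d + 1) = |AE E / (LR d + 1) - a0 d / (LR d + 1)| := by
      rw [← sub_div, abs_div, abs_of_pos (by linarith : 0 < LR d + 1)]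
    rw [this]
    exact abs_sub_le _ _ _
  refine (Finset.sum_le_sum h1).trans ?_
  rw [Finset.sum_add_distrib, ← Finset.sum_div, Finset.sum_const, nsmul_eq_mul]
  unfold errA
  rw [mul_add]
  refine add_le_add ?_ le_rfl
  rw [div_le_iff₀ (by linarith)]
  refine (A_bound h).trans ?_
  rw [mul_assoc]
  refine mul_le_mul_of_nonneg_left ?_ (by positivity)
  rw [mul_comm]
  refine mul_le_mul_of_nonneg_left (by linarith) ?_
  have := S2_nonneg d
  positivity

theorem B_err (h : OKd d Δ) (ν : ℝ) :
    ∑ E ∈ Exec d, |BE E / NE E - ν| ≤ (Exec d).card * errB d Δ ν := by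
  have hL := L_ge h
  have hm := two_le_m h
  have hN : 0 < LR d + 1 := by linarith
  have h1 : ∀ E ∈ Exec d, |BE E / NE E - ν| = |BE E - ν * (LR d + 1)| / (LR d + 1) := by
    intro E hE
    rw [NE_eq h (mem_Exec.1 hE)]
    have : BE E / (LR d + 1) - ν = (BE E - ν * (LR d + 1)) / (LR d + 1) := by
      field_simp
    rw [this, abs_div, abs_of_pos hN]
  rw [Finset.sum_congr rfl h1, ← Finset.sum_div, div_le_iff₀ hN]
  refine (B_bound h _).trans ?_
  rw [mul_assoc]
  refine mul_le_mul_of_nonneg_left ?_ (by positivity)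
  have h2 : |c0 d * LR d / mR d - ν * (LR d + 1)|
      = |c0 d * LR d / mR d / (LR d + 1) - ν| * (LR d + 1) := by
    have := abs_mul (c0 d * LR d / mR d / (LR d + 1) - ν) (LR d + 1)
    rw [abs_of_pos hN, sub_mul, div_mul_cancel₀ _ hN.ne'] at this
    exact this
  have hS := S2_nonneg d
  have p1 : 0 ≤ √(S2 d / mR d * KK d Δ) := Real.sqrt_nonneg _
  have p2 : 0 ≤ 3 * √(Δ * S2 d) / mR d := by positivity
  have p3 : 0 ≤ 2 * S2 d / (mR d * (mR d - 1)) :=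
    div_nonneg (by positivity) (mul_nonneg (by linarith) (by linarith))
  rw [h2]
  unfold errB
  linarith

end AV

lemma hs_congr {ι : Type*} {f g : ι → ℝ} {s : ℝ} (h : ∀ i, f i = g i) : HasSum f s ↔ HasSum g s := by
  rw [funext h]

section Binom
variable (ρ : ℝ) (m : ℕ)

lemma binomP_eval (a : ℕ) : binomP ρ m a = (bernsteinPolynomial ℝ m a).eval ρ := by
  simp [binomP, bernsteinPolynomial]

lemma bin0 : ∑ a ∈ Finset.range (m + 1), binomP ρ m a = 1 := by
  have := congrArg (Polynomial.eval ρ) (bernsteinPolynomial.sum ℝ m)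
  rw [Polynomial.eval_finsetSum] at this
  simpa [binomP_eval] using this

lemma bin1 : ∑ a ∈ Finset.range (m + 1), (a : ℝ) * binomP ρ m a = m * ρ := by
  have := congrArg (Polynomial.eval ρ) (bernsteinPolynomial.sum_smul ℝ m)
  rw [Polynomial.eval_finsetSum] at this
  simpa [binomP_eval] using this

lemma bin2 : ∑ a ∈ Finset.range (m + 1), (a : ℝ) * (a - 1) * binomP ρ m a = m * (m - 1) * ρ ^ 2 := by
  have := congrArg (Polynomial.eval ρ) (bernsteinPolynomial.sum_mul_smul ℝ m)
  rw [Polynomial.eval_finsetSum] at this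
  have e : ∀ k : ℕ, ((k * (k - 1) : ℕ) : ℝ) = (k : ℝ) * (k - 1) := by
    intro k; cases k <;> simp
  simp only [nsmul_eq_mul, Polynomial.eval_mul, Polynomial.eval_natCast, e, Polynomial.eval_pow,
    Polynomial.eval_X] at this
  simpa only [binomP_eval] using this

lemma antisum (f : ℕ → ℕ → ℝ) : ∑ x ∈ Finset.HasAntidiagonal.antidiagonal m, f x.1 x.2
    = ∑ a ∈ Finset.range (m + 1), f (m - a) a := by
  rw [← Finset.Nat.sum_antidiagonal_swap, Finset.Nat.sum_antidiagonal_eq_sum_range_succ_mk]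
  rfl

lemma binW (w : ℕ → ℕ → ℝ) (A B C : ℝ)
    (hw : ∀ a ≤ m, w (m - a) a = A + B * a + C * ((a : ℝ) * (a - 1))) :
    ∑ x ∈ Finset.HasAntidiagonal.antidiagonal m, w x.1 x.2 * binomP ρ (x.1 + x.2) x.2
      = A + B * (m * ρ) + C * (m * (m - 1) * ρ ^ 2) := by
  rw [antisum m (fun k a => w k a * binomP ρ (k + a) a), ← bin1, ← bin2]
  conv_rhs => enter [1, 1]; rw [← mul_one A, ← bin0 ρ m]
  rw [Finset.mul_sum, Finset.mul_sum, Finset.mul_sum, ← Finset.sum_add_distrib,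
    ← Finset.sum_add_distrib]
  refine Finset.sum_congr rfl fun a ha => ?_
  have h : a ≤ m := by have := Finset.mem_range.1 ha; omega
  rw [hw a h, Nat.sub_add_cancel h]; ring
end Binom

noncomputable def FF (p : ℕ → ℝ) (x : ℕ × ℕ) : ℝ := p (x.1 + x.2 + 1) * binomP (rho p) (x.1 + x.2) x.2

section Cl
variable {p : ℕ → ℝ} {μ2 : ℝ}

lemma rho_mem (h : 2 ≤ mu1 p) : 0 ≤ rho p ∧ rho p ≤ 1 := by
  unfold rho
  constructor
  · exact div_nonneg zero_le_one (by linarith)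
  · rw [div_le_one (by linarith)]; linarith

lemma FF_nonneg (hpnn : ∀ k, 0 ≤ p k) (h : 2 ≤ mu1 p) (x : ℕ × ℕ) : 0 ≤ FF p x := by
  obtain ⟨h0, h1⟩ := rho_mem h
  unfold FF binomP
  have := hpnn (x.1 + x.2 + 1)
  have h2 : 0 ≤ 1 - rho p := by linarith
  positivity

lemma hasSum_anti (f : ℕ × ℕ → ℝ) (hf : ∀ x, 0 ≤ f x) {s : ℝ}
    (h : HasSum (fun m => ∑ x ∈ Finset.HasAntidiagonal.antidiagonal m, f x) s) : HasSum f s := by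
  rw [← Finset.HasAntidiagonal.sigmaAntidiagonalEquivProd.hasSum_iff]
  have hs : ∀ m, HasSum (fun x : Finset.HasAntidiagonal.antidiagonal m => f x.1)
      (∑ x ∈ Finset.HasAntidiagonal.antidiagonal m, f x) := fun m => by
    rw [← Finset.sum_coe_sort]
    exact hasSum_fintype _
  refine HasSum.sigma_of_hasSum h hs ?_
  rw [summable_sigma_of_nonneg]
  · refine ⟨fun m => (hs m).summable, ?_⟩
    refine h.summable.congr fun m => ?_
    exact ((hs m).tsum_eq).symm
  · intro x; exact hf _

lemma hasSum_W (hpnn : ∀ k, 0 ≤ p k) (h2 : 2 ≤ mu1 p) (w : ℕ → ℕ → ℝ) (hw0 : ∀ k a, 0 ≤ w k a)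
    (A B C : ℕ → ℝ)
    (hw : ∀ m a, a ≤ m → w (m - a) a = A m + B m * a + C m * ((a : ℝ) * (a - 1))) {s : ℝ}
    (hs : HasSum (fun m : ℕ => p (m + 1) *
      (A m + B m * (m * rho p) + C m * (m * (m - 1) * rho p ^ 2))) s) :
    HasSum (fun x : ℕ × ℕ => w x.1 x.2 * FF p x) s := by
  refine hasSum_anti _ (fun x => mul_nonneg (hw0 _ _) (FF_nonneg hpnn h2 x)) ?_
  refine (hs_congr fun m => ?_).2 hs
  rw [← binW (rho p) m w (A m) (B m) (C m) (fun a ha => hw m a ha), Finset.mul_sum]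
  refine Finset.sum_congr rfl fun x hx => ?_
  have := Finset.HasAntidiagonal.mem_antidiagonal.1 hx
  unfold FF
  rw [this]; ring

structure PH (p : ℕ → ℝ) (μ2 : ℝ) : Prop where
  hp0 : p 0 = 0
  nn : ∀ k, 0 ≤ p k
  h1 : HasSum p 1
  hμ1 : HasSum (fun k : ℕ => (k : ℝ) * p k) (mu1 p)
  hμ2 : HasSum (fun k : ℕ => (k : ℝ) ^ 2 * p k) μ2
  hge : 2 ≤ mu1 p

lemma shift {f : ℕ → ℝ} {s : ℝ} (h : HasSum f s) (h0 : f 0 = 0) : HasSum (fun m => f (m + 1)) s := by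
  rw [hasSum_nat_add_iff' 1 (f := f) |>.symm] at h
  simpa [h0] using h

lemma PH.s0 (h : PH p μ2) : HasSum (fun m => p (m + 1)) 1 := shift h.h1 h.hp0

lemma PH.s1 (h : PH p μ2) : HasSum (fun m : ℕ => (m : ℝ) * p (m + 1)) (mu1 p - 1) := by
  have := (shift h.hμ1 (by simp)).sub h.s0
  refine (hs_congr fun m => ?_).2 this
  push_cast; ring

lemma PH.s2 (h : PH p μ2) : HasSum (fun m : ℕ => (m : ℝ) * (m - 1) * p (m + 1))
    (μ2 - 3 * mu1 p + 2) := by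
  have := ((shift h.hμ2 (by simp)).sub ((shift h.hμ1 (by simp)).mul_left 3)).add (h.s0.mul_left 2)
  rw [mul_one] at this
  refine (hs_congr fun m => ?_).2 this
  push_cast; ring

lemma PH.f1 (h : PH p μ2) : HasSum (fun x : ℕ × ℕ => FF p x) 1 := by
  have := hasSum_W h.nn h.hge (fun _ _ => 1) (fun _ _ => zero_le_one) (fun _ => 1) (fun _ => 0)
    (fun _ => 0) (fun m a _ => by ring) (s := 1) (by simpa using h.s0)
  simpa using this

lemma PH.rhomul (h : PH p μ2) : rho p * (mu1 p - 1) = 1 := by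
  have := h.hge
  unfold rho; rw [one_div, inv_mul_cancel₀]; linarith

lemma PH.fa (h : PH p μ2) : HasSum (fun x : ℕ × ℕ => (x.2 : ℝ) * FF p x) 1 := by
  refine hasSum_W h.nn h.hge (fun _ a => a) (fun _ a => by positivity) (fun _ => 0) (fun _ => 1)
    (fun _ => 0) (fun m a _ => by ring) ?_
  have := h.s1.mul_left (rho p)
  rw [h.rhomul] at this
  refine (hs_congr fun m => ?_).2 this
  ring

lemma PH.fk (h : PH p μ2) : HasSum (fun x : ℕ × ℕ => (x.1 : ℝ) * FF p x) (mu1 p - 2) := by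
  refine hasSum_W h.nn h.hge (fun k _ => k) (fun _ a => by positivity) (fun m => m) (fun _ => -1)
    (fun _ => 0) (fun m a ha => by push_cast [Nat.cast_sub ha]; ring) ?_
  have := h.s1.mul_left (1 - rho p)
  have e : (1 - rho p) * (mu1 p - 1) = mu1 p - 2 := by linear_combination - h.rhomul
  rw [e] at this
  refine (hs_congr fun m => ?_).2 this
  ring

lemma PH.fkk (h : PH p μ2) : HasSum (fun x : ℕ × ℕ => (x.1 : ℝ) ^ 2 * FF p x)
    ((1 - rho p) ^ 2 * (μ2 - 3 * mu1 p + 2) + (mu1 p - 2)) := by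
  refine hasSum_W h.nn h.hge (fun k _ => (k : ℝ) ^ 2) (fun _ a => by positivity)
    (fun m => (m : ℝ) ^ 2) (fun m => - 2 * m + 1)
    (fun _ => 1) (fun m a ha => by push_cast [Nat.cast_sub ha]; ring) ?_
  have := (h.s2.mul_left ((1 - rho p) ^ 2)).add (h.s1.mul_left (1 - rho p))
  have e : (1 - rho p) * (mu1 p - 1) = mu1 p - 2 := by linear_combination - h.rhomul
  rw [e] at this
  refine (hs_congr fun m => ?_).2 this
  ring

lemma PH.fka (h : PH p μ2) : HasSum (fun x : ℕ × ℕ => (x.1 : ℝ) * x.2 * FF p x)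
    (rho p * (1 - rho p) * (μ2 - 3 * mu1 p + 2)) := by
  refine hasSum_W h.nn h.hge (fun k a => (k : ℝ) * a) (fun _ a => by positivity)
    (fun m => 0) (fun m => m - 1)
    (fun _ => -1) (fun m a ha => by push_cast [Nat.cast_sub ha]; ring) ?_
  have := h.s2.mul_left (rho p * (1 - rho p))
  refine (hs_congr fun m => ?_).2 this
  ring

noncomputable def qq (p : ℕ → ℝ) (k : ℕ) : ℝ := ∑' a, FF p (k, a)
noncomputable def rr (p : ℕ → ℝ) (k : ℕ) : ℝ := ∑' a : ℕ, (a : ℝ) * FF p (k, a)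

lemma PH.hq (h : PH p μ2) (k : ℕ) : HasSum (fun a => FF p (k, a)) (qq p k) :=
  (h.f1.summable.prod_factor k).hasSum
lemma PH.hr (h : PH p μ2) (k : ℕ) : HasSum (fun a : ℕ => (a : ℝ) * FF p (k, a)) (rr p k) :=
  (h.fa.summable.prod_factor k).hasSum

lemma PH.alpha (h : PH p μ2) (k l : ℕ) : alphaF p k l = qq p k * rr p l := by
  have hn := FF_nonneg h.nn h.hge
  have hs := (h.hq k).summable.mul_of_nonneg (h.hr l).summable (fun a => hn _)
    (fun a => mul_nonneg (Nat.cast_nonneg a) (hn _))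
  have := (h.hq k).mul (h.hr l) hs
  rw [← this.tsum_eq]
  unfold alphaF
  refine tsum_congr fun a => ?_
  unfold FF
  ring

lemma PH.r1 (h : PH p μ2) : HasSum (rr p) 1 := h.fa.prod_fiberwise (fun k => h.hr k)

lemma PH.pm (h : PH p μ2) (k : ℕ) : pMinus p k = qq p k := by
  unfold pMinus
  have := h.r1.mul_left (qq p k)
  rw [mul_one] at this
  rw [← this.tsum_eq]
  exact tsum_congr fun l => h.alpha k l

lemma PH.m1 (h : PH p μ2) : HasSum (fun k : ℕ => (k : ℝ) * qq p k) (mu1 p - 2) :=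
  h.fk.prod_fiberwise (fun k => (h.hq k).mul_left _)

lemma PH.m2 (h : PH p μ2) : HasSum (fun k : ℕ => (k : ℝ) ^ 2 * qq p k)
    ((1 - rho p) ^ 2 * (μ2 - 3 * mu1 p + 2) + (mu1 p - 2)) :=
  h.fkk.prod_fiberwise (fun k => (h.hq k).mul_left _)

lemma PH.r2 (h : PH p μ2) : HasSum (fun k : ℕ => (k : ℝ) * rr p k)
    (rho p * (1 - rho p) * (μ2 - 3 * mu1 p + 2)) :=
  h.fka.prod_fiberwise (fun k => by
    have := (h.hr k).mul_left (k : ℝ)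
    refine (hs_congr fun a => ?_).2 this
    ring)

lemma PH.m1t (h : PH p μ2) : ∑' k : ℕ, (k : ℝ) * pMinus p k = mu1 p - 2 := by
  rw [← h.m1.tsum_eq]
  exact tsum_congr fun k => by rw [h.pm]

theorem PH.nu (h : PH p μ2) : nuConst p = Nu (mu1 p) μ2 := by
  have hge := h.hge
  unfold nuConst
  split_ifs with h2
  · rw [h.m1t]
    have : ∑' k : ℕ, (k : ℝ) ^ 2 * pMinus p k = _ :=
      (tsum_congr fun k => by rw [h.pm]).trans h.m2.tsum_eq
    rw [this]
    unfold Nu rho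
    have e1 : mu1 p - 1 ≠ 0 := by linarith
    have e2 : mu1 p - 2 ≠ 0 := by linarith
    field_simp
    ring
  · have : mu1 p = 2 := le_antisymm (not_lt.1 h2) hge
    simp [Nu, this]

theorem PH.eta (h : PH p μ2) : etaConst p = Nu (mu1 p) μ2 := by
  have hge := h.hge
  unfold etaConst
  split_ifs with h2
  · rw [h.m1t]
    have hn := FF_nonneg h.nn h.hge
    have hqn : ∀ k : ℕ, 0 ≤ (k : ℝ) * qq p k := fun k =>
      mul_nonneg (Nat.cast_nonneg k) ((h.hq k).nonneg fun a => hn _)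
    have hrn : ∀ k : ℕ, 0 ≤ (k : ℝ) * rr p k := fun k =>
      mul_nonneg (Nat.cast_nonneg k) ((h.hr k).nonneg fun a => mul_nonneg (Nat.cast_nonneg a) (hn _))
    have hs := h.m1.summable.mul_of_nonneg h.r2.summable hqn hrn
    have h3 := (h.m1.mul h.r2 hs).tsum_eq
    have : ∑' kl : ℕ × ℕ, (kl.1 : ℝ) * kl.2 * alphaF p kl.1 kl.2 = _ :=
      (tsum_congr fun kl => by rw [h.alpha]; ring).trans h3
    rw [this]
    unfold Nu rho
    have e1 : mu1 p - 1 ≠ 0 := by linarith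
    have e2 : mu1 p - 2 ≠ 0 := by linarith
    field_simp
    ring
  · have : mu1 p = 2 := le_antisymm (not_lt.1 h2) hge
    simp [Nu, this]
end Cl

lemma ratio_le {n : ℕ} (d : Fin n → ℕ) (B : Path d → Prop) :
    (Nat.card {x : Path d × (HE d → HE d) // (IsExecPath d x.1 ∧ IsCompletion x.1 x.2) ∧ B x.1} : ℝ)
      / (Nat.card {x : Path d × (HE d → HE d) // IsExecPath d x.1 ∧ IsCompletion x.1 x.2} : ℝ)
      ≤ (((Exec d).filter B).card : ℝ) / (Exec d).card := by
  have e1 : Nat.card {x : Path d × (HE d → HE d) //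
      (IsExecPath d x.1 ∧ IsCompletion x.1 x.2) ∧ B x.1}
      = Nat.card {x : Path d × (HE d → HE d) //
      (IsExecPath d x.1 ∧ B x.1) ∧ IsCompletion x.1 x.2} :=
    Nat.card_congr (Equiv.subtypeEquivRight fun x => by tauto)
  rw [e1]
  rcases (Exec d).eq_empty_or_nonempty with h | ⟨E₀, hE₀⟩
  · have h1 : Finset.univ.filter (fun E => IsExecPath d E) = ∅ := h
    have k2 : Nat.card {x : Path d × (HE d → HE d) // IsExecPath d x.1 ∧ IsCompletion x.1 x.2}
        = 0 := by
      rw [card_pairs (fun E => IsExecPath d E), h1]; rfl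
    rw [k2, h]; simp
  · have hE₀' := mem_Exec.1 hE₀
    have c1 : ∀ E, IsExecPath d E → (Finset.univ.filter (IsCompletion E)).card = (Cmp E₀).card :=
      fun E hE => card_Cmp_eq hE hE₀'
    have s1 : ∑ E ∈ Finset.univ.filter (fun E => IsExecPath d E ∧ B E),
        (Finset.univ.filter (IsCompletion E)).card = ((Exec d).filter B).card * (Cmp E₀).card := by
      rw [Finset.sum_congr rfl (fun E hE => c1 E (Finset.mem_filter.1 hE).2.1), Finset.sum_const,
        smul_eq_mul]
      congr 2
      ext E
      simp [mem_Exec]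
    have s2 : ∑ E ∈ Finset.univ.filter (fun E => IsExecPath d E),
        (Finset.univ.filter (IsCompletion E)).card = (Exec d).card * (Cmp E₀).card := by
      rw [Finset.sum_congr rfl (fun E hE => c1 E (Finset.mem_filter.1 hE).2), Finset.sum_const,
        smul_eq_mul]
      rfl
    have k1 : Nat.card {x : Path d × (HE d → HE d) //
        (IsExecPath d x.1 ∧ B x.1) ∧ IsCompletion x.1 x.2}
        = ((Exec d).filter B).card * (Cmp E₀).card := by
      rw [card_pairs (fun E => IsExecPath d E ∧ B E), ← s1]
      congr!
    have k2 : Nat.card {x : Path d × (HE d → HE d) // IsExecPath d x.1 ∧ IsCompletion x.1 x.2}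
        = (Exec d).card * (Cmp E₀).card := by
      rw [card_pairs (fun E => IsExecPath d E), ← s2]
    rw [k1, k2]
    push_cast
    rcases eq_or_ne (Cmp E₀).card 0 with h0 | h0
    · rw [h0]; simp; positivity
    · rw [mul_div_mul_right _ _ (by exact_mod_cast h0)]

section Fin
variable {dseq : (n : ℕ) → Fin n → ℕ} {μ μ2 : ℝ}

lemma Lims.evFr (h : Lims dseq μ μ2) (heven : ∀ n, Even (∑ i, dseq n i)) {n : ℕ} (hn : 3 ≤ n)
    {E : Path (dseq n)} (hE : IsExecPath (dseq n) E) :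
    Even (Fr E).card ∧ 2 ≤ (Fr E).card := by
  have h1 := card_Fr hE
  have h2 := h.hge n
  obtain ⟨k, hk⟩ := heven n
  refine ⟨⟨k - (n - 1), by omega⟩, by omega⟩

lemma Lims.unif (h : Lims dseq μ μ2) (heven : ∀ n, Even (∑ i, dseq n i)) {ε : ℝ} (hε : 0 < ε) :
    ∃ δ > 0, ∀ᶠ n in atTop, ∀ E, IsExecPath (dseq n) E → |AE E / NE E - Nu μ μ2| < δ →
      |BE E / NE E - Nu μ μ2| < δ →
      |condSimpleProb E - Real.exp (-(3 * Nu μ μ2 / 2 + Nu μ μ2 ^ 2 / 4))| < ε := by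
  let ι := {x : (Σ n, Path (dseq n)) // 3 ≤ x.1 ∧ IsExecPath (dseq x.1) x.2}
  let f : ι → ℕ × (ℝ × ℝ) := fun i => (i.1.1, (AE i.1.2 / NE i.1.2, BE i.1.2 / NE i.1.2))
  let l : Filter ι := comap f (atTop ×ˢ (nhds (Nu μ μ2, Nu μ μ2)))
  have hf : Tendsto f l (atTop ×ˢ (nhds (Nu μ μ2, Nu μ μ2))) := tendsto_comap
  have tn : Tendsto (fun i : ι => i.1.1) l atTop := tendsto_fst.comp hf
  have t2 : Tendsto (fun i : ι => (AE i.1.2 / NE i.1.2, BE i.1.2 / NE i.1.2)) l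
      (nhds (Nu μ μ2, Nu μ μ2)) := tendsto_snd.comp hf
  have tA : Tendsto (fun i : ι => AE i.1.2 / NE i.1.2) l (nhds (Nu μ μ2)) :=
    (continuous_fst.tendsto _).comp t2
  have tB : Tendsto (fun i : ι => BE i.1.2 / NE i.1.2) l (nhds (Nu μ μ2)) :=
    (continuous_snd.tendsto _).comp t2
  have hΔ1 : ∀ i : ι, 1 ≤ mxd (dseq i.1.1) := fun i =>
    (h.hd i.1.1 ⟨0, by have := i.2.1; omega⟩).trans (le_mxd _ _)
  have hNE : ∀ i : ι, NE i.1.2 = LR (dseq i.1.1) + 1 := fun i => NE_eq (h.ok i.2.1) i.2.2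
  have key : Tendsto (fun i : ι => condSimpleProb i.1.2) l
      (nhds (Real.exp (-(3 * Nu μ μ2 / 2 + Nu μ μ2 ^ 2 / 4)))) := by
    rcases h.hμ.eq_or_lt with hμ | hμ
    · have h0 : Nu μ μ2 = 0 := by unfold Nu; rw [← hμ]; simp
      have := csp_limit_zero (l := l) (n := fun i : ι => i.1.1) (d := fun i => dseq i.1.1)
        (fun i => i.1.2) (fun i => i.2.2) (fun i => (h.evFr heven i.2.1 i.2.2).1)
        (fun i => (h.evFr heven i.2.1 i.2.2).2) (fun i => mxd (dseq i.1.1)) (fun i => le_mxd _)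
        hΔ1 (h0 ▸ tA) (h0 ▸ tB)
      simpa [h0] using this
    · have hne : μ - 2 ≠ 0 := by linarith
      have hL1 : Tendsto (fun n : ℕ => (LR (dseq n) + 1) / n) atTop (nhds (μ - 2)) := by
        have := h.L.add inv_n
        rw [add_zero] at this
        exact this.congr fun n => by ring
      have dv : ∀ {X : ℕ → ℝ} {x : ℝ}, Tendsto (fun n => X n / n) atTop (nhds x) →
          Tendsto (fun n => X n / (LR (dseq n) + 1)) atTop (nhds (x / (μ - 2))) := by
        intro X x hX
        refine (hX.div hL1 hne).congr' ?_
        filter_upwards [ev_pos] with n hn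
        simp only [Pi.div_apply]
        exact div_div_div_cancel_right₀ hn.1 _ _
      refine csp_limit_pos (l := l) (n := fun i : ι => i.1.1) (d := fun i => dseq i.1.1)
        (fun i => i.1.2) (fun i => i.2.2) (fun i => (h.evFr heven i.2.1 i.2.2).1)
        (fun i => mxd (dseq i.1.1)) (fun i => le_mxd _) hΔ1 (K := μ2 / (μ - 2)) ?_ ?_ ?_ tA tB
      · exact ((h.Linf hμ).comp tn).congr fun i => (hNE i).symm
      · have := (dv h.sΔ).comp tn
        rw [zero_div] at this
        exact this.congr fun i => by simp only [Function.comp]; rw [hNE i]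
      · have := (dv h.s2).comp tn
        exact this.congr fun i => by simp only [Function.comp]; rw [hNE i]
  have ev := (Metric.tendsto_nhds.1 key) ε hε
  rw [eventually_comap, eventually_prod_iff] at ev
  obtain ⟨pa, hpa, pb, hpb, hh⟩ := ev
  obtain ⟨δ, hδ, hδ'⟩ := Metric.eventually_nhds_iff.1 hpb
  refine ⟨δ, hδ, ?_⟩
  filter_upwards [hpa, eventually_ge_atTop 3] with n hn hn3 E hE hA hB
  have hb := hδ' (y := (AE E / NE E, BE E / NE E)) (by
    rw [Prod.dist_eq, max_lt_iff]
    exact ⟨hA, hB⟩)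
  exact hh hn hb ⟨⟨n, E⟩, hn3, hE⟩ rfl

lemma Lims.final (h : Lims dseq μ μ2) (heven : ∀ n, Even (∑ i, dseq n i)) {ε : ℝ} (hε : 0 < ε) :
    Tendsto (fun n =>
      (Nat.card {x : Path (dseq n) × (HE (dseq n) → HE (dseq n)) //
          (IsExecPath (dseq n) x.1 ∧ IsCompletion x.1 x.2) ∧
          ε < |condSimpleProb x.1 - Real.exp (-(3 * Nu μ μ2 / 2 + Nu μ μ2 ^ 2 / 4))|} : ℝ)
        / (Nat.card {x : Path (dseq n) × (HE (dseq n) → HE (dseq n)) //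
            IsExecPath (dseq n) x.1 ∧ IsCompletion x.1 x.2} : ℝ))
      atTop (nhds 0) := by
  obtain ⟨δ, hδ, hu⟩ := h.unif heven hε
  have lim := ((h.errA.add h.errB).abs).div_const δ
  rw [add_zero, abs_zero, zero_div] at lim
  refine tendsto_of_tendsto_of_tendsto_of_le_of_le' tendsto_const_nhds lim
    (Eventually.of_forall fun n => by positivity) ?_
  filter_upwards [hu, ev_pos] with n hn hn3
  set c := Real.exp (-(3 * Nu μ μ2 / 2 + Nu μ μ2 ^ 2 / 4)) with hc
  refine (ratio_le (dseq n) (fun E => ε < |condSimpleProb E - c|)).trans ?_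
  have ok := h.ok hn3.2
  have hA := A_err ok (Nu μ μ2)
  have hB := B_err ok (Nu μ μ2)
  set F := (Exec (dseq n)).filter (fun E => ε < |condSimpleProb E - c|) with hF
  have h1 : (F.card : ℝ) * δ ≤ ∑ E ∈ Exec (dseq n),
      (|AE E / NE E - Nu μ μ2| + |BE E / NE E - Nu μ μ2|) := by
    rw [← nsmul_eq_mul, ← Finset.sum_const]
    refine (Finset.sum_le_sum ?_).trans (Finset.sum_le_sum_of_subset_of_nonneg
      (Finset.filter_subset _ _) (fun E _ _ => by positivity))
    intro E hE
    obtain ⟨hE1, hE2⟩ := Finset.mem_filter.1 hE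
    by_contra hlt
    rw [not_le] at hlt
    have a1 := abs_nonneg (AE E / NE E - Nu μ μ2)
    have a2 := abs_nonneg (BE E / NE E - Nu μ μ2)
    exact absurd (hn E (mem_Exec.1 hE1) (by linarith) (by linarith)) (not_lt.2 hE2.le)
  rw [Finset.sum_add_distrib] at h1
  have h2 : (F.card : ℝ) * δ ≤ (Exec (dseq n)).card *
      |TWG.errA (dseq n) (mxd (dseq n)) (Nu μ μ2) + TWG.errB (dseq n) (mxd (dseq n)) (Nu μ μ2)| := by
    refine h1.trans ((add_le_add hA hB).trans ?_)
    rw [← mul_add]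
    exact mul_le_mul_of_nonneg_left (le_abs_self _) (by positivity)
  rcases Nat.eq_zero_or_pos (Exec (dseq n)).card with h0 | h0
  · rw [h0]; simp; positivity
  · have h0' : (0 : ℝ) < (Exec (dseq n)).card := by exact_mod_cast h0
    rw [div_le_div_iff₀ h0' hδ]
    linarith
end Fin

/-- As `n → ∞`, `P(G(dⁿ) is simple | T(dⁿ)) → exp(−ν/2 − ν²/4 − η)` in probability. -/
theorem conditional_simplicity_probability
    (dseq : (n : ℕ) → Fin n → ℕ)
    (hd : ∀ n i, 1 ≤ dseq n i)
    (heven : ∀ n, Even (∑ i, dseq n i))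
    (hge : ∀ n, 2 * n ≤ ∑ i, dseq n i)
    (p : ℕ → ℝ) (hp0 : p 0 = 0) (hpnn : ∀ k, 0 ≤ p k) (hp1 : HasSum p 1)
    (hp2 : p 2 < 1)
    (μ2 : ℝ) (hμ2 : HasSum (fun k : ℕ => (k : ℝ) ^ 2 * p k) μ2) (hμ2pos : 0 < μ2)
    (hpconv : ∀ k : ℕ, Tendsto
      (fun n => (Nat.card {i : Fin n // dseq n i = k} : ℝ) / n) atTop (nhds (p k)))
    (hμ2conv : Tendsto (fun n => (∑ i, (dseq n i : ℝ) ^ 2) / n) atTop (nhds μ2)) :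
    ∀ ε : ℝ, 0 < ε → Tendsto (fun n =>
      (Nat.card {x : Path (dseq n) × (HE (dseq n) → HE (dseq n)) //
          (IsExecPath (dseq n) x.1 ∧ IsCompletion x.1 x.2) ∧
          ε < |condSimpleProb x.1
                - Real.exp (-(nuConst p) / 2 - (nuConst p) ^ 2 / 4 - etaConst p)|} : ℝ)
        / (Nat.card {x : Path (dseq n) × (HE (dseq n) → HE (dseq n)) //
            IsExecPath (dseq n) x.1 ∧ IsCompletion x.1 x.2} : ℝ))
      atTop (nhds 0) := by
  intro ε hε
  obtain ⟨hm, hs1⟩ := mean_tendsto hpnn hμ2 hpconv hμ2conv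
  have h2 : 2 ≤ mu1 p := by
    refine ge_of_tendsto hs1 ?_
    filter_upwards [ev_pos] with n hn
    have h3 : (0 : ℝ) < n := by
      have := hn.2
      exact_mod_cast (by omega : 0 < n)
    rw [le_div_iff₀ h3]
    exact_mod_cast hge n
  have L : Lims dseq (mu1 p) μ2 :=
    ⟨hd, hge, hs1, hμ2conv, mxd_tendsto hμ2 hpconv hμ2conv, h2⟩
  have H : PH p μ2 := ⟨hp0, hpnn, hp1, hm, hμ2, h2⟩
  have e : -(nuConst p) / 2 - (nuConst p) ^ 2 / 4 - etaConst p
      = -(3 * Nu (mu1 p) μ2 / 2 + Nu (mu1 p) μ2 ^ 2 / 4) := by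
    rw [H.nu, H.eta]; ring
  rw [e]
  exact L.final heven hε

end TWG
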